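/- Let G be the non quasi-split unramified unitary group in four variables over F_0, and let π be an irreducible smooth representation of G of positive level. Then π contains a fundamental skew stratum [Λ, n, n−1, β] which satisfies one of the following: (i) Λ = Λ_i for some 1 ≤ i ≤ 5 and gcd(e(Λ), n) = 2; (ii) Λ = Λ_i for some 1 ≤ i ≤ 3 and gcd(e(Λ), n) = 1. -/

import Mathlib

/-!
Common framework for formalizing statements from
"Representations of non quasi-split U(4) over a p-adic field I" (M. Miyauchi).

We model the non-archimedean local field `F` with its (possibly trivial) Galois
involution, ring of integers `O`, uniformizer `ϖ`, a finite-dimensional hermitian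
space `(V, h)` over `F`, the adjoint involution `σA` on `A = End_F V`, the unitary
group `G = {g ∈ A^× | g σ(g) = 1}` (as a subgroup of `Aˣ`), self-dual lattice
sequences, the filtrations `a_n(Λ)`, the congruence subsets `P_n(Λ)`, skew
(semisimple) strata, characters attached to strata, smooth representations, and
Hecke algebras.
-/

noncomputable section
open scoped Classical Pointwise

universe u v w

/-- The ambient data: a field `F` with involution `conj` (Galois involution of
`F/F₀`), ring of integers `O` (a valuation subring with uniformizer `ϖ` and finite
residue field), a hermitian space `(V, h)` and the adjoint involution `σA` on
`End_F V` induced by `h`. -/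
structure USetting (F : Type u) [Field F] (V : Type v) [AddCommGroup V] [Module F V] where
  /-- the Galois involution `x ↦ x̄` on `F` -/
  conj : F ≃+* F
  conj_invol : ∀ x : F, conj (conj x) = x
  /-- the ring of integers `o_F` -/
  O : Subring F
  /-- a uniformizer `ϖ_F` -/
  ϖ : F
  ϖ_mem : ϖ ∈ O
  ϖ_ne_zero : ϖ ≠ 0
  ϖ_not_unit : ∀ y ∈ O, ϖ * y ≠ 1
  conj_O : ∀ x ∈ O, conj x ∈ O
  /-- `O` is a valuation ring of `F` -/
  O_val : ∀ x : F, x ≠ 0 → x ∈ O ∨ x⁻¹ ∈ O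
  /-- every nonunit of `O` is divisible by `ϖ`: the maximal ideal is `ϖO` -/
  unif : ∀ x ∈ O, (∀ y ∈ O, x * y ≠ 1) → ∃ z ∈ O, x = ϖ * z
  /-- the residue field `o_F/p_F` is finite -/
  res_fin : Finite (O ⧸ (Ideal.span {(⟨ϖ, ϖ_mem⟩ : O)} : Ideal O))
  /-- the hermitian form `h` on `V` -/
  h : V → V → F
  h_add_left : ∀ u v w : V, h (u + v) w = h u w + h v w
  h_smul_left : ∀ (c : F) (u w : V), h (c • u) w = conj c * h u w
  h_conj_symm : ∀ u w : V, h w u = conj (h u w)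
  h_nondeg : ∀ u : V, (∀ w : V, h u w = 0) → u = 0
  /-- the involution on `A = End_F V` induced by `h` -/
  σA : Module.End F V → Module.End F V
  σA_adj : ∀ (X : Module.End F V) (u w : V), h (X u) w = h u (σA X w)
  σA_one : σA 1 = 1
  σA_mul : ∀ X Y, σA (X * Y) = σA Y * σA X
  σA_add : ∀ X Y, σA (X + Y) = σA X + σA Y
  σA_invol : ∀ X, σA (σA X) = X

namespace USetting

variable {F : Type u} [Field F] {V : Type v} [AddCommGroup V] [Module F V]
variable (S : USetting F V)

/-- the maximal ideal `p_F = ϖ o_F` of `o_F`, as a subset of `F` -/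
def pF : Set F := {y : F | ∃ z ∈ S.O, y = S.ϖ * z}

/-- the residue characteristic of `F` -/
def residueChar : ℕ :=
  ringChar (S.O ⧸ (Ideal.span {(⟨S.ϖ, S.ϖ_mem⟩ : S.O)} : Ideal S.O))

/-- An `o_F`-lattice sequence in `V`: a decreasing `ℤ`-indexed family of
`o_F`-submodules of `V`, periodic with (minimal) period `e` under multiplication
by `ϖ`. -/
structure LatSeq where
  L : ℤ → Set V
  zero_mem : ∀ i, (0 : V) ∈ L i
  add_mem : ∀ i, ∀ v w : V, v ∈ L i → w ∈ L i → v + w ∈ L i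
  smul_mem : ∀ i, ∀ c ∈ S.O, ∀ v ∈ L i, c • v ∈ L i
  dec : ∀ i, L (i + 1) ⊆ L i
  e : ℤ
  e_pos : 0 < e
  periodic : ∀ i, L (i + e) = S.ϖ • L i
  e_min : ∀ e' : ℤ, 0 < e' → (∀ i, L (i + e') = S.ϖ • L i) → e ≤ e'

/-- each member of the sequence is a full `o_F`-lattice in `V`
(finitely generated over `o_F` and spanning `V` over `F`) -/
def IsFull (Λ : S.LatSeq) : Prop :=
  ∀ i : ℤ, Submodule.span F (Λ.L i) = ⊤ ∧
    ∃ s : Finset V, ↑s ⊆ Λ.L i ∧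
      ∀ v ∈ Λ.L i, ∃ c : V → F, (∀ w ∈ s, c w ∈ S.O) ∧ v = ∑ w ∈ s, c w • w

/-- the filtration `a_n(Λ)` of `A = End_F V` -/
def aFil (Λ : S.LatSeq) (n : ℤ) : Set (Module.End F V) :=
  {X : Module.End F V | ∀ i : ℤ, ∀ v ∈ Λ.L i, X v ∈ Λ.L (i + n)}

/-- `A_- = {X ∈ A | X + σ(X) = 0}` -/
def Aminus : Set (Module.End F V) := {X | S.σA X = -X}

/-- the dual lattice `L^# = {v | h(v, L) ⊆ o_F}` -/
def dualLat (L : Set V) : Set V := {v : V | ∀ w ∈ L, S.h v w ∈ S.O}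

/-- `Λ` is self-dual with duality invariant `d`: `Λ(i)^# = Λ(d - i)` -/
def selfDualWith (Λ : S.LatSeq) (d : ℤ) : Prop :=
  ∀ i : ℤ, S.dualLat (Λ.L i) = Λ.L (d - i)

def isSelfDual (Λ : S.LatSeq) : Prop := ∃ d : ℤ, S.selfDualWith Λ d

/-- the unitary group `G = {g ∈ A^× | g σ(g) = 1}` as a subgroup of `Aˣ` -/
def GU : Subgroup (Module.End F V)ˣ where
  carrier := {u : (Module.End F V)ˣ |
    S.σA (u : Module.End F V) = ((u⁻¹ : (Module.End F V)ˣ) : Module.End F V)}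
  one_mem' := by simpa using S.σA_one
  mul_mem' := by
    intro a b ha hb
    simp only [Set.mem_setOf_eq] at *
    rw [Units.val_mul, S.σA_mul, ha, hb, mul_inv_rev, Units.val_mul]
  inv_mem' := by
    intro a ha
    simp only [Set.mem_setOf_eq] at *
    rw [← ha, S.σA_invol, inv_inv]

/-- the underlying endomorphism of an element of `G` -/
def toE (g : S.GU) : Module.End F V := ((g : (Module.End F V)ˣ) : Module.End F V)

/-- `P_k(Λ) = G ∩ (1 + a_k(Λ))` (for `k ≥ 1`) -/
def Pset (Λ : S.LatSeq) (k : ℤ) : Set S.GU := {g : S.GU | S.toE g - 1 ∈ S.aFil Λ k}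

/-- `P_0(Λ) = G ∩ a_0(Λ)` -/
def P0set (Λ : S.LatSeq) : Set S.GU := {g : S.GU | S.toE g ∈ S.aFil Λ 0}

/-- `B`, the `A`-centralizer of `β` -/
def Bcent (β : Module.End F V) : Set (Module.End F V) := {X | X * β = β * X}

/-- `B^⊥`, the orthogonal complement of `B` in `A` w.r.t. the pairing `(x,y) ↦ tr_{A/F}(xy)` -/
def Bperp (β : Module.End F V) : Set (Module.End F V) :=
  {X | ∀ Y ∈ Bcent β, LinearMap.trace F V (X * Y) = 0}

/-- sum of two subsets of `A` -/
def setAdd (s t : Set (Module.End F V)) : Set (Module.End F V) :=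
  {z | ∃ x ∈ s, ∃ y ∈ t, z = x + y}

/-- `𝔍 = a'_n ⊕ a^⊥_{[(n+1)/2]}` -/
def frakJ (Λ : S.LatSeq) (n : ℤ) (β : Module.End F V) : Set (Module.End F V) :=
  setAdd (S.aFil Λ n ∩ Bcent β) (S.aFil Λ ((n + 1) / 2) ∩ Bperp β)

/-- `𝔍₊ = a'_n ⊕ a^⊥_{[n/2]+1}` -/
def frakJplus (Λ : S.LatSeq) (n : ℤ) (β : Module.End F V) : Set (Module.End F V) :=
  setAdd (S.aFil Λ n ∩ Bcent β) (S.aFil Λ (n / 2 + 1) ∩ Bperp β)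

/-- `J = (1 + 𝔍) ∩ G` -/
def Jset (Λ : S.LatSeq) (n : ℤ) (β : Module.End F V) : Set S.GU :=
  {g : S.GU | S.toE g - 1 ∈ S.frakJ Λ n β}

/-- `J₊ = (1 + 𝔍₊) ∩ G` -/
def Jplusset (Λ : S.LatSeq) (n : ℤ) (β : Module.End F V) : Set S.GU :=
  {g : S.GU | S.toE g - 1 ∈ S.frakJplus Λ n β}

/-- `G_E = G ∩ B`, the `G`-centralizer of `β` -/
def GEset (β : Module.End F V) : Set S.GU := {g : S.GU | S.toE g ∈ Bcent β}

/-- the set `J G_E J` -/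
def JGEJ (Λ : S.LatSeq) (n : ℤ) (β : Module.End F V) : Set S.GU :=
  {a : S.GU | ∃ j₁ ∈ S.Jset Λ n β, ∃ c ∈ S.GEset β, ∃ j₂ ∈ S.Jset Λ n β, a = j₁ * c * j₂}

/-- `ν_Λ(X) = k`, i.e. `X ∈ a_k(Λ) \ a_{k+1}(Λ)` -/
def HasVal (Λ : S.LatSeq) (X : Module.End F V) (k : ℤ) : Prop :=
  X ∈ S.aFil Λ k ∧ X ∉ S.aFil Λ (k + 1)

/-- `y_β = ϖ^{n/k} β^{e/k}` where `k = gcd(e(Λ), n)` -/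
def ybeta (Λ : S.LatSeq) (n : ℤ) (β : Module.End F V) : Module.End F V :=
  S.ϖ ^ ((n / (Int.gcd Λ.e n : ℤ)).toNat) • β ^ ((Λ.e / (Int.gcd Λ.e n : ℤ)).toNat)

/-- two polynomials over `F` with integral coefficients are coprime modulo `p_F` -/
def CoprimeModP (f g : Polynomial F) : Prop :=
  ∃ u v : Polynomial F, (∀ i, u.coeff i ∈ S.O) ∧ (∀ i, v.coeff i ∈ S.O) ∧
    ∀ i, (u * f + v * g - 1).coeff i ∈ S.pF

/-- the filtration `a_m(Λ ∩ U)` on `End_F(U)` cut out by a subspace `U ⊆ V` -/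
def aFilOn (Λ : S.LatSeq) (U : Submodule F V) (m : ℤ) : Set (Module.End F U) :=
  {X : Module.End F U | ∀ i : ℤ, ∀ v : U, (v : V) ∈ Λ.L i → ((X v : U) : V) ∈ Λ.L (i + m)}

def HasValOn (Λ : S.LatSeq) (U : Submodule F V) (X : Module.End F U) (k : ℤ) : Prop :=
  X ∈ S.aFilOn Λ U k ∧ X ∉ S.aFilOn Λ U (k + 1)

/-- `x` is integral over `o_F` -/
def IsIntegralO {R : Type*} [Ring R] [Algebra F R] (x : R) : Prop :=
  ∃ p : Polynomial F, p.Monic ∧ (∀ i, p.coeff i ∈ S.O) ∧ Polynomial.aeval x p = 0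

/-- `[Λ|U, n, n-1, βU]` is a simple stratum: `E = F[βU]` is a field, `Λ|U` is an
`o_E`-lattice sequence, `ν(βU) = -n`, and `βU` is minimal over `F` (expressed by
the standard equivalent exactness property of `ad(βU)`, cf. Bushnell–Kutzko
(1.4.9), (1.4.15)). -/
def SimpleOn (Λ : S.LatSeq) (n : ℤ) (U : Submodule F V) (βU : Module.End F U) : Prop :=
  IsField (Algebra.adjoin F ({βU} : Set (Module.End F U))) ∧
  (∀ x : Module.End F U, x ∈ Algebra.adjoin F ({βU} : Set (Module.End F U)) →
      S.IsIntegralO x → ∀ i : ℤ, ∀ v : U, (v : V) ∈ Λ.L i → ((x v : U) : V) ∈ Λ.L i) ∧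
  S.HasValOn Λ U βU (-n) ∧
  (∀ m : ℤ, ∀ X ∈ S.aFilOn Λ U m, βU * X - X * βU ∈ S.aFilOn Λ U (m - n + 1) →
      ∃ Y : Module.End F U, Y * βU = βU * Y ∧ X - Y ∈ S.aFilOn Λ U (m + 1))

/-- `E = F[βU]` is tamely ramified over `F`: the ramification index
`e(E/F) = e(Λ)/g`, where `g` generates the value group `ν_Λ(E^×)`, is prime to
the residue characteristic. -/
def TameOn (Λ : S.LatSeq) (U : Submodule F V) (βU : Module.End F U) : Prop :=
  ∃ g : ℤ, 0 < g ∧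
    (∀ x : Module.End F U, x ∈ Algebra.adjoin F ({βU} : Set (Module.End F U)) → x ≠ 0 →
        ∃ m : ℤ, g ∣ m ∧ S.HasValOn Λ U x m) ∧
    (∃ x : Module.End F U, x ∈ Algebra.adjoin F ({βU} : Set (Module.End F U)) ∧
        S.HasValOn Λ U x g) ∧
    ¬ ((S.residueChar : ℤ) ∣ (Λ.e / g))

/-- restriction of an endomorphism to an invariant subspace -/
def restr (β : Module.End F V) (U : Submodule F V) (hU : ∀ v ∈ U, β v ∈ U) :
    Module.End F U :=
  LinearMap.restrict β hU

lemma pow_inv (β : Module.End F V) (U : Submodule F V) (hU : ∀ v ∈ U, β v ∈ U) :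
    ∀ m : ℕ, ∀ v ∈ U, (β ^ m) v ∈ U := by
  intro m
  induction m with
  | zero => intro v hv; simpa using hv
  | succ t ih =>
      intro v hv
      rw [pow_succ]
      exact ih _ (hU v hv)

lemma ybeta_inv (Λ : S.LatSeq) (n : ℤ) (β : Module.End F V) (U : Submodule F V)
    (hU : ∀ v ∈ U, β v ∈ U) : ∀ v ∈ U, S.ybeta Λ n β v ∈ U := by
  intro v hv
  show (S.ϖ ^ ((n / (Int.gcd Λ.e n : ℤ)).toNat) •
      β ^ ((Λ.e / (Int.gcd Λ.e n : ℤ)).toNat)) v ∈ U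
  rw [LinearMap.smul_apply]
  exact U.smul_mem _ (pow_inv β U hU _ v hv)

variable [FiniteDimensional F V]

/-- `[Λ, n, n-1, β]` is a skew semisimple stratum, split with respect to the
orthogonal `F`-splitting `V = W 0 ⊥ … ⊥ W (k-1)`: `Λ` is a full self-dual
lattice sequence, `β` is skew with `ν_Λ(β) = -n`, the splitting is orthogonal,
compatible with `Λ` and preserved by `β`, each restricted stratum is zero or
simple, no characteristic polynomial of a nonzero component is divisible by `X`
mod `p_F`, and the characteristic polynomials of distinct components are
coprime mod `p_F`. -/
structure IsSkewSS (Λ : S.LatSeq) (n : ℤ) (β : Module.End F V)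
    (k : ℕ) (W : Fin k → Submodule F V) : Prop where
  full : S.IsFull Λ
  selfdual : S.isSelfDual Λ
  n_pos : 0 < n
  skew : β ∈ S.Aminus
  mem : β ∈ S.aFil Λ (-n)
  val : β ∉ S.aFil Λ (1 - n)
  k_pos : 0 < k
  internal : DirectSum.IsInternal W
  orth : ∀ i j, i ≠ j → ∀ v ∈ W i, ∀ w ∈ W j, S.h v w = 0
  lat_compat : ∀ m : ℤ, ∀ f : Fin k → V, (∀ i, f i ∈ W i) →
      ((∑ i, f i) ∈ Λ.L m ↔ ∀ i, f i ∈ Λ.L m)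
  β_inv : ∀ i, ∀ v ∈ W i, β v ∈ W i
  comp : ∀ i, (∀ v ∈ W i, β v = 0) ∨ S.SimpleOn Λ n (W i) (restr β (W i) (β_inv i))
  comp_nondeg : ∀ i, ¬ (∀ v ∈ W i, β v = 0) →
      (LinearMap.charpoly
        (restr (S.ybeta Λ n β) (W i) (S.ybeta_inv Λ n β (W i) (β_inv i)))).coeff 0 ∉ S.pF
  coprime : ∀ i j, i ≠ j →
      S.CoprimeModP
        (LinearMap.charpoly
          (restr (S.ybeta Λ n β) (W i) (S.ybeta_inv Λ n β (W i) (β_inv i))))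
        (LinearMap.charpoly
          (restr (S.ybeta Λ n β) (W j) (S.ybeta_inv Λ n β (W j) (β_inv j))))

/-- the stratum `[Λ, n, n-1, β]` is fundamental: the reduction mod `p_F` of the
characteristic polynomial of `y_β` is not `X^N` -/
def IsFundamental (Λ : S.LatSeq) (n : ℤ) (β : Module.End F V) : Prop :=
  ¬ ∀ i : ℕ, i < Module.finrank F V →
      (LinearMap.charpoly (S.ybeta Λ n β)).coeff i ∈ S.pF

section Char

variable (F₀ : Type w) [Field F₀] [Algebra F₀ F]

/-- `tr_{A/F₀} = tr_{F/F₀} ∘ tr_{A/F}` -/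
def trA0 (X : Module.End F V) : F₀ := Algebra.trace F₀ F (LinearMap.trace F V X)

/-- the character `ψ_β(x) = ψ₀(tr_{A/F₀}(β(x-1)))` -/
def psiCh (ψ₀ : F₀ → ℂ) (β : Module.End F V) (g : S.GU) : ℂ :=
  ψ₀ (trA0 F₀ (β * (S.toE g - 1)))

/-- `ψ₀` is an additive character of `F₀` with conductor `p₀` -/
def IsAddCh (ψ₀ : F₀ → ℂ) : Prop :=
  (∀ x y : F₀, ψ₀ (x + y) = ψ₀ x * ψ₀ y) ∧
  (∀ x : F₀, algebraMap F₀ F x ∈ S.pF → ψ₀ x = 1) ∧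
  (∃ x : F₀, algebraMap F₀ F x ∈ S.O ∧ ψ₀ x ≠ 1)

/-- `F₀` is the fixed field of the involution -/
def FixedField : Prop := ∀ x : F, S.conj x = x ↔ x ∈ (algebraMap F₀ F).range

end Char

section Rep

variable {W : Type*} [AddCommGroup W] [Module ℂ W]

/-- smoothness of a representation of `G` (relative to the lattice sequence `Λ`:
the groups `P_k(Λ)`, `k ≥ 1`, form a basis of neighborhoods of the identity) -/
def SmoothRel (Λ : S.LatSeq) (π : S.GU →* Module.End ℂ W) : Prop :=
  ∀ w : W, ∃ k : ℤ, 1 ≤ k ∧ ∀ g ∈ S.Pset Λ k, π g w = w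

/-- smoothness of a representation of `G` -/
def Smooth (π : S.GU →* Module.End ℂ W) : Prop :=
  ∀ w : W, ∃ Λ : S.LatSeq, S.IsFull Λ ∧ S.isSelfDual Λ ∧
    ∃ k : ℤ, 1 ≤ k ∧ ∀ g ∈ S.Pset Λ k, π g w = w

/-- irreducibility -/
def Irred (π : S.GU →* Module.End ℂ W) : Prop :=
  (∃ w : W, w ≠ 0) ∧
  ∀ U : Submodule ℂ W, (∀ g : S.GU, ∀ w ∈ U, π g w ∈ U) → U = ⊥ ∨ U = ⊤

/-- `π` contains the character `χ` of the subset `K ⊆ G` -/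
def ContainsChar (π : S.GU →* Module.End ℂ W) (K : Set S.GU) (χ : S.GU → ℂ) : Prop :=
  ∃ w : W, w ≠ 0 ∧ ∀ g ∈ K, π g w = χ g • w

/-- `π` has positive level: no nonzero `P_1(Λ)`-fixed vector for any self-dual `Λ` -/
def PositiveLevel (π : S.GU →* Module.End ℂ W) : Prop :=
  ∀ Λ : S.LatSeq, S.IsFull Λ → S.isSelfDual Λ →
    ∀ w : W, (∀ g ∈ S.Pset Λ 1, π g w = w) → w = 0

end Rep

section Hecke

/-- the double coset `KgK` -/
def dCoset (K : Subgroup S.GU) (g : S.GU) : Set S.GU :=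
  {a : S.GU | ∃ x ∈ K, ∃ y ∈ K, a = x * g * y}

/-- the double coset `KgK` for a subset `K` -/
def dCosetSet (K : Set S.GU) (g : S.GU) : Set S.GU :=
  {a : S.GU | ∃ x ∈ K, ∃ y ∈ K, a = x * g * y}

/-- convolution of two functions on `G` relative to the open compact subgroup `K`
(Haar measure normalized by `vol(K) = 1`):
`(f₁ * f₂)(g) = ∑_{xK ∈ G/K} f₁(x) f₂(x⁻¹ g)`. -/
def hConv {M : Type*} [Ring M] (K : Subgroup S.GU) (f₁ f₂ : S.GU → M) : S.GU → M :=
  fun g => ∑ᶠ q : S.GU ⧸ K, f₁ (Quotient.out q) * f₂ ((Quotient.out q)⁻¹ * g)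

/-- `f` belongs to the Hecke algebra `H(G//K, τ)` with support contained in `supp`:
`f(kgk') = τ(k) f(g) τ(k')` for `k, k' ∈ K`, and `f` is compactly supported
(its support meets only finitely many cosets of `K`). -/
def IsHecke {M : Type*} [Ring M] (K : Subgroup S.GU) (supp : Set S.GU)
    (τ : S.GU → M) (f : S.GU → M) : Prop :=
  (∀ k ∈ K, ∀ g : S.GU, ∀ k' ∈ K, f (k * g * k') = τ k * f g * τ k') ∧
  Function.support f ⊆ supp ∧
  ((fun a : S.GU => (QuotientGroup.mk a : S.GU ⧸ K)) '' Function.support f).Finite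

/-- `[KgK : K] = [K : K ∩ gKg⁻¹]`, the number of left cosets of `K` in `KgK` -/
def dcIndex (K : Subgroup S.GU) (g : S.GU) : ℕ :=
  Nat.card ((fun a : S.GU => (QuotientGroup.mk a : S.GU ⧸ K)) '' S.dCoset K g)

end Hecke


section U4

/-! Concrete data for the non quasi-split unramified unitary group in four
variables: `V = F^4`, `h(v,w) = ᵗv̄ H w` with `H = E₁₄ + ϖE₂₂ + E₃₃ + E₄₁`,
the standard lattices `N₀, N₁` and their duals, and the standard self-dual
lattice sequences `Λ₁, …, Λ₅`. -/

variable (T : USetting F (Fin 4 → F))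

/-- the hermitian form of the non quasi-split unramified `U(4)`:
`h(v, w) = ᵗv̄ H w`, `H = E₁₄ + ϖE₂₂ + E₃₃ + E₄₁` -/
def IsU4Form : Prop :=
  ∀ v w : Fin 4 → F, T.h v w =
    T.conj (v 0) * w 3 + T.ϖ * (T.conj (v 1) * w 1) + T.conj (v 2) * w 2 +
      T.conj (v 3) * w 0

/-- `F/F₀` is quadratic unramified with common uniformizer `ϖ`:
`ϖ` is fixed by the involution, and `F = F₀[√ε]` for a non-square unit `ε` of `o₀`. -/
def IsUnramifiedQuadratic : Prop :=
  T.conj T.ϖ = T.ϖ ∧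
  ∃ ε s : F, ε ∈ T.O ∧ (∃ y ∈ T.O, ε * y = 1) ∧ T.conj ε = ε ∧
    (¬ ∃ y : F, T.conj y = y ∧ y ^ 2 = ε) ∧ s ^ 2 = ε ∧ T.conj s = -s

/-- `N₀ = o_F e₁ ⊕ o_F e₂ ⊕ o_F e₃ ⊕ o_F e₄` -/
def N0 : Set (Fin 4 → F) := {v | ∀ j, v j ∈ T.O}

/-- `N₁ = o_F e₁ ⊕ o_F e₂ ⊕ o_F e₃ ⊕ p_F e₄` -/
def N1 : Set (Fin 4 → F) := {v | (∀ j, v j ∈ T.O) ∧ v 3 ∈ T.pF}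

/-- `N₀^# = o_F e₁ ⊕ p_F⁻¹ e₂ ⊕ o_F e₃ ⊕ o_F e₄` -/
def N0s : Set (Fin 4 → F) :=
  {v | v 0 ∈ T.O ∧ T.ϖ * v 1 ∈ T.O ∧ v 2 ∈ T.O ∧ v 3 ∈ T.O}

/-- `N₁^# = p_F⁻¹ e₁ ⊕ p_F⁻¹ e₂ ⊕ o_F e₃ ⊕ o_F e₄` -/
def N1s : Set (Fin 4 → F) :=
  {v | T.ϖ * v 0 ∈ T.O ∧ T.ϖ * v 1 ∈ T.O ∧ v 2 ∈ T.O ∧ v 3 ∈ T.O}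

/-- `Λ₁(2i) = ϖ^i N₀`, `Λ₁(2i+1) = ϖ^{i+1} N₀^#` -/
def IsLam1 (Λ : T.LatSeq) : Prop :=
  Λ.e = 2 ∧ ∀ i : ℤ,
    Λ.L (2*i) = T.ϖ ^ i • T.N0 ∧ Λ.L (2*i+1) = T.ϖ ^ (i+1) • T.N0s

/-- `Λ₂(2i) = ϖ^i N₁`, `Λ₂(2i+1) = ϖ^{i+1} N₁^#` -/
def IsLam2 (Λ : T.LatSeq) : Prop :=
  Λ.e = 2 ∧ ∀ i : ℤ,
    Λ.L (2*i) = T.ϖ ^ i • T.N1 ∧ Λ.L (2*i+1) = T.ϖ ^ (i+1) • T.N1s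

/-- `Λ₃(4i) = ϖ^i N₀`, `Λ₃(4i+1) = ϖ^i N₁`, `Λ₃(4i+2) = ϖ^{i+1} N₁^#`,
`Λ₃(4i+3) = ϖ^{i+1} N₀^#` -/
def IsLam3 (Λ : T.LatSeq) : Prop :=
  Λ.e = 4 ∧ ∀ i : ℤ,
    Λ.L (4*i) = T.ϖ ^ i • T.N0 ∧ Λ.L (4*i+1) = T.ϖ ^ i • T.N1 ∧
    Λ.L (4*i+2) = T.ϖ ^ (i+1) • T.N1s ∧ Λ.L (4*i+3) = T.ϖ ^ (i+1) • T.N0s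

/-- `Λ₄(6i) = Λ₄(6i+1) = ϖ^i N₀`, `Λ₄(6i+2) = ϖ^i N₁`, `Λ₄(6i+3) = ϖ^{i+1} N₁^#`,
`Λ₄(6i+4) = Λ₄(6i+5) = ϖ^{i+1} N₀^#` -/
def IsLam4 (Λ : T.LatSeq) : Prop :=
  Λ.e = 6 ∧ ∀ i : ℤ,
    Λ.L (6*i) = T.ϖ ^ i • T.N0 ∧ Λ.L (6*i+1) = T.ϖ ^ i • T.N0 ∧
    Λ.L (6*i+2) = T.ϖ ^ i • T.N1 ∧ Λ.L (6*i+3) = T.ϖ ^ (i+1) • T.N1s ∧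
    Λ.L (6*i+4) = T.ϖ ^ (i+1) • T.N0s ∧ Λ.L (6*i+5) = T.ϖ ^ (i+1) • T.N0s

/-- `Λ₅(6i-1) = ϖ^i N₀`, `Λ₅(6i) = Λ₅(6i+1) = ϖ^i N₁`,
`Λ₅(6i+2) = Λ₅(6i+3) = ϖ^{i+1} N₁^#`, `Λ₅(6i+4) = ϖ^{i+1} N₀^#` -/
def IsLam5 (Λ : T.LatSeq) : Prop :=
  Λ.e = 6 ∧ ∀ i : ℤ,
    Λ.L (6*i-1) = T.ϖ ^ i • T.N0 ∧ Λ.L (6*i) = T.ϖ ^ i • T.N1 ∧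
    Λ.L (6*i+1) = T.ϖ ^ i • T.N1 ∧ Λ.L (6*i+2) = T.ϖ ^ (i+1) • T.N1s ∧
    Λ.L (6*i+3) = T.ϖ ^ (i+1) • T.N1s ∧ Λ.L (6*i+4) = T.ϖ ^ (i+1) • T.N0s

/-- the matrix of `β = ϖ^{-m}(Y E₂₃ - ϖ Ȳ E₃₂)` -/
def betaMat (m : ℤ) (Y : F) : Matrix (Fin 4) (Fin 4) F :=
  fun i j =>
    if i = 1 ∧ j = 2 then T.ϖ ^ (-m) * Y
    else if i = 2 ∧ j = 1 then -(T.ϖ ^ (1 - m) * T.conj Y) else 0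

/-- the matrix of `s₁ = E₁₄ + E₂₂ + E₃₃ + E₄₁` -/
def s1Mat : Matrix (Fin 4) (Fin 4) F :=
  !![0,0,0,1; 0,1,0,0; 0,0,1,0; 1,0,0,0]

/-- the matrix of `s₂ = ϖ⁻¹E₁₄ + E₂₂ + E₃₃ + ϖE₄₁` -/
def s2Mat : Matrix (Fin 4) (Fin 4) F :=
  !![0,0,0,T.ϖ⁻¹; 0,1,0,0; 0,0,1,0; T.ϖ,0,0,0]

end U4

end USetting


namespace U4H
open USetting

section basics
variable {F : Type u} [Field F] (T : USetting F (Fin 4 → F))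

/-- `ϖ^k O` -/
def pw (k : ℤ) : AddSubgroup F where
  carrier := {x | T.ϖ ^ (-k) * x ∈ T.O}
  zero_mem' := by simp [T.O.zero_mem]
  add_mem' := by
    intro a b ha hb
    simp only [Set.mem_ofPred_eq, mul_add] at *
    exact T.O.add_mem ha hb
  neg_mem' := by
    intro a ha
    simp only [Set.mem_ofPred_eq, mul_neg] at *
    exact T.O.neg_mem ha

lemma mem_pw {k : ℤ} {x : F} : x ∈ pw T k ↔ T.ϖ ^ (-k) * x ∈ T.O := Iff.rfl

lemma mem_pw0 {x : F} : x ∈ pw T 0 ↔ x ∈ T.O := by simp [mem_pw]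

lemma zpow_mul_zpow (a b : ℤ) : T.ϖ ^ a * T.ϖ ^ b = T.ϖ ^ (a + b) :=
  (zpow_add₀ T.ϖ_ne_zero a b).symm

lemma pw_mul {a b : ℤ} {x y : F} (hx : x ∈ pw T a) (hy : y ∈ pw T b) :
    x * y ∈ pw T (a + b) := by
  rw [mem_pw] at *
  have := T.O.mul_mem hx hy
  convert this using 1
  rw [neg_add, zpow_add₀ T.ϖ_ne_zero]; ring

lemma zpow_mem_pw {a b : ℤ} (h : a ≤ b) : T.ϖ ^ b ∈ pw T a := by
  rw [mem_pw, zpow_mul_zpow]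
  obtain ⟨n, hn⟩ := Int.eq_ofNat_of_zero_le (show 0 ≤ -a + b by omega)
  rw [hn]; simp only [zpow_natCast]
  exact T.O.pow_mem T.ϖ_mem n

lemma pw_anti {a b : ℤ} (h : a ≤ b) {x : F} (hx : x ∈ pw T b) : x ∈ pw T a := by
  have h1 : T.ϖ ^ (b - a) ∈ pw T 0 := zpow_mem_pw T (by omega)
  rw [mem_pw0] at h1
  rw [mem_pw] at *
  have := T.O.mul_mem h1 hx
  rwa [← mul_assoc, zpow_mul_zpow, show b - a + -b = -a by ring] at this

lemma zpow_mul_mem {a b : ℤ} {x : F} : T.ϖ ^ a * x ∈ pw T b ↔ x ∈ pw T (b - a) := by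
  rw [mem_pw, mem_pw, ← mul_assoc, zpow_mul_zpow, show -b + a = -(b - a) by ring]

lemma O_mul_mem {a : ℤ} {c x : F} (hc : c ∈ T.O) (hx : x ∈ pw T a) : c * x ∈ pw T a := by
  have := pw_mul T ((mem_pw0 T).2 hc) hx
  rwa [zero_add] at this

lemma mem_pF {x : F} : x ∈ T.pF ↔ x ∈ pw T 1 := by
  rw [mem_pw]
  constructor
  · rintro ⟨z, hz, rfl⟩
    simpa [T.ϖ_ne_zero] using hz
  · intro h
    exact ⟨_, h, by simp [T.ϖ_ne_zero]⟩

lemma one_notMem : (1 : F) ∉ pw T 1 := by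
  rw [← mem_pF]
  rintro ⟨z, hz, h⟩
  exact T.ϖ_not_unit z hz h.symm

/-- units: an element of `O` outside `p` has inverse in `O` -/
lemma inv_mem {x : F} (hx : x ∈ T.O) (hx' : x ∉ pw T 1) : x ≠ 0 ∧ x⁻¹ ∈ T.O := by
  have h0 : x ≠ 0 := fun h => hx' (h ▸ (pw T 1).zero_mem)
  refine ⟨h0, ?_⟩
  by_contra hcon
  apply hx'
  rw [← mem_pF]
  refine T.unif x hx fun y hy hxy => hcon ?_
  rwa [inv_eq_of_mul_eq_one_right hxy]

lemma inv_mem_pw {k : ℤ} {x : F} (hx : x ∈ pw T k) (hx' : x ∉ pw T (k + 1)) :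
    x ≠ 0 ∧ x⁻¹ ∈ pw T (-k) := by
  have h := inv_mem T (x := T.ϖ ^ (-k) * x) hx (by
    rw [zpow_mul_mem]; rwa [show (1 : ℤ) - -k = k + 1 by ring])
  refine ⟨right_ne_zero_of_mul h.1, ?_⟩
  have h2 := h.2
  rw [mul_inv, ← zpow_neg, neg_neg] at h2
  rwa [mem_pw, neg_neg]

lemma notMem_of_inv {k : ℤ} {x : F} (hx : x ≠ 0) (hx' : x⁻¹ ∈ pw T (-k)) : x ∉ pw T (k + 1) := by
  intro h
  have := pw_mul T h hx'
  rw [mul_inv_cancel₀ hx, show k + 1 + -k = 1 by ring] at this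
  exact one_notMem T this

lemma zpow_mem_iff {a b : ℤ} : T.ϖ ^ b ∈ pw T a ↔ a ≤ b := by
  refine ⟨fun h => ?_, zpow_mem_pw T⟩
  by_contra hlt
  have h1 : T.ϖ ^ b ∈ pw T (b + 1) := pw_anti T (by omega) h
  refine notMem_of_inv T (zpow_ne_zero _ T.ϖ_ne_zero) ?_ h1
  rw [← zpow_neg]; exact zpow_mem_pw T le_rfl

/-- the standing hypotheses -/
structure Hyp : Prop where
  form : T.IsU4Form
  conjϖ : T.conj T.ϖ = T.ϖ
  two : (2 : F) ≠ 0
  two_inv : (2 : F)⁻¹ ∈ T.O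

lemma hyp_of (hodd : ¬ (2 ∣ T.residueChar)) (hform : T.IsU4Form)
    (hunram : T.IsUnramifiedQuadratic) : Hyp T := by
  have h2 : (2 : F) ∉ pw T 1 := by
    intro h
    apply hodd
    rw [← mem_pF] at h
    obtain ⟨z, hz, h⟩ := h
    set I : Ideal T.O := Ideal.span {(⟨T.ϖ, T.ϖ_mem⟩ : T.O)} with hI
    have h0 : ((2 : ℕ) : T.O ⧸ I) = 0 := by
      have : ((2 : ℕ) : T.O) ∈ I := by
        rw [hI, Ideal.mem_span_singleton]
        exact ⟨⟨z, hz⟩, Subtype.ext (by push_cast; exact h)⟩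
      have h3 := Ideal.Quotient.eq_zero_iff_mem.2 this
      rwa [map_natCast] at h3
    have hd : T.residueChar ∣ 2 := ringChar.dvd h0
    rcases (Nat.dvd_prime Nat.prime_two).1 hd with h1 | h1
    · exfalso
      have : Nontrivial (T.O ⧸ I) := by
        apply Ideal.Quotient.nontrivial_iff.2
        intro htop
        have : (1 : T.O) ∈ I := htop ▸ Submodule.mem_top
        rw [hI, Ideal.mem_span_singleton] at this
        obtain ⟨c, hc⟩ := this
        exact T.ϖ_not_unit c c.2 (by simpa using (congrArg Subtype.val hc).symm)
      have hc : ringChar (T.O ⧸ I) = 1 := h1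
      exact CharP.ringChar_ne_one hc
    · rw [h1]
  have := inv_mem T (x := 2) (by
    have := T.O.add_mem T.O.one_mem T.O.one_mem
    rwa [one_add_one_eq_two] at this) h2
  exact ⟨hform, hunram.1, this.1, this.2⟩

variable {T}

lemma Hyp.conj_zpow (H : Hyp T) (k : ℤ) : T.conj (T.ϖ ^ k) = T.ϖ ^ k := by
  rw [map_zpow₀, H.conjϖ]

lemma Hyp.conj_mem (H : Hyp T) {k : ℤ} {x : F} (hx : x ∈ pw T k) : T.conj x ∈ pw T k := by
  rw [mem_pw] at *
  have := T.conj_O _ hx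
  rwa [map_mul, H.conj_zpow] at this

lemma Hyp.conj_mem_iff (H : Hyp T) {k : ℤ} {x : F} : T.conj x ∈ pw T k ↔ x ∈ pw T k :=
  ⟨fun h => by simpa [T.conj_invol] using H.conj_mem h, H.conj_mem⟩

end basics

/-! ceiling division -/

def cd (a e : ℤ) : ℤ := -((-a) / e)

lemma cd_le {a e k : ℤ} (he : 0 < e) : cd a e ≤ k ↔ a ≤ k * e := by
  unfold cd
  rw [neg_le, Int.le_ediv_iff_mul_le he]
  constructor <;> intro h <;> linarith

lemma lt_cd {a e k : ℤ} (he : 0 < e) : k < cd a e ↔ k * e < a := by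
  rw [← not_le, cd_le he, not_le]

lemma le_cd_mul {a e : ℤ} (he : 0 < e) : a ≤ cd a e * e := (cd_le he).1 le_rfl

lemma cd_mul_lt {a e : ℤ} (he : 0 < e) : (cd a e - 1) * e < a := (lt_cd he).1 (by omega)

lemma cd_add_le {a b e : ℤ} (he : 0 < e) : cd (a + b) e ≤ cd a e + cd b e := by
  rw [cd_le he, add_mul]
  exact add_le_add (le_cd_mul he) (le_cd_mul he)

lemma cd_mono {a b e : ℤ} (he : 0 < e) (h : a ≤ b) : cd a e ≤ cd b e := by
  rw [cd_le he]; exact h.trans (le_cd_mul he)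

lemma cd_mul {k e : ℤ} (he : 0 < e) : cd (k * e) e = k := by
  apply le_antisymm
  · rw [cd_le he]
  · by_contra h
    have h1 := le_cd_mul (a := k * e) he
    have := le_of_mul_le_mul_right h1 he
    omega

lemma cd_add_mul {a k e : ℤ} (he : 0 < e) : cd (a + k * e) e = cd a e + k := by
  apply le_antisymm
  · have := cd_add_le (a := a) (b := k * e) he
    rwa [cd_mul he] at this
  · have := cd_add_le (a := a + k * e) (b := (-k) * e) he
    rw [cd_mul he, show a + k * e + -k * e = a by ring] at this
    omega

lemma cd_zero {e : ℤ} (he : 0 < e) : cd 0 e = 0 := by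
  have := cd_mul (k := 0) he; rwa [zero_mul] at this

lemma cd_one {e : ℤ} (he : 0 < e) : cd 1 e = 1 := by
  apply le_antisymm
  · rw [cd_le he]; omega
  · by_contra h
    have : cd 1 e ≤ 0 := by omega
    rw [cd_le he] at this; omega

/-- `cd (a+1)` jumps iff `e ∣ a` -/
lemma cd_succ_of_not_dvd {a e : ℤ} (he : 0 < e) (h : ¬ e ∣ a) : cd (a + 1) e = cd a e := by
  apply le_antisymm _ (cd_mono he (by omega))
  rw [cd_le he]
  have h1 := le_cd_mul (a := a) he
  rcases h1.lt_or_eq with h2 | h2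
  · omega
  · exact absurd ⟨cd a e, by rw [mul_comm]; exact h2⟩ h

lemma cd_of_dvd {a e : ℤ} (he : 0 < e) (h : e ∣ a) : cd a e = a / e := by
  obtain ⟨k, rfl⟩ := h
  rw [Int.mul_ediv_cancel_left _ he.ne', mul_comm, cd_mul he]

lemma cd_succ_of_dvd {a e : ℤ} (he : 0 < e) (h : e ∣ a) : cd (a + 1) e = a / e + 1 := by
  obtain ⟨k, rfl⟩ := h
  rw [Int.mul_ediv_cancel_left _ he.ne', add_comm (e * k), mul_comm, cd_add_mul he, cd_one he,
    add_comm]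

lemma cd_floor {a e : ℤ} (he : 0 < e) : cd (a + 1) e = a / e + 1 := by
  have h1 := Int.emod_nonneg a he.ne'
  have h2 := Int.emod_lt_of_pos a he
  have h3 := Int.mul_ediv_add_emod a e
  apply le_antisymm
  · rw [cd_le he, add_mul]; nlinarith
  · by_contra h
    have : cd (a + 1) e ≤ a / e := by omega
    rw [cd_le he] at this
    nlinarith

end U4H

namespace U4H
open USetting

/-- parameters of a standard lattice sequence -/
structure Par where
  e : ℤ
  he : 0 < e
  C : Fin 4 → ℤ
  d1 : C 0 + C 3 = 2 * C 2
  d2 : 2 * C 1 - e = 2 * C 2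

section lat
variable {F : Type u} [Field F] (T : USetting F (Fin 4 → F))

/-- exponents -/
def Par.x (p : Par) (i : ℤ) (j : Fin 4) : ℤ := cd (i - p.C j) p.e

lemma Par.x_add (p : Par) (i k : ℤ) (j : Fin 4) : p.x (i + k * p.e) j = p.x i j + k := by
  unfold Par.x
  rw [show i + k * p.e - p.C j = i - p.C j + k * p.e by ring, cd_add_mul p.he]

lemma mem_smul_box {a : ℤ} {m : Fin 4 → ℤ} {v : Fin 4 → F} :
    v ∈ T.ϖ ^ a • {v : Fin 4 → F | ∀ j, v j ∈ pw T (m j)} ↔ ∀ j, v j ∈ pw T (m j + a) := by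
  rw [Set.mem_smul_set_iff_inv_smul_mem₀ (zpow_ne_zero _ T.ϖ_ne_zero), Set.mem_ofPred_eq]
  refine forall_congr' fun j => ?_
  rw [Pi.smul_apply, smul_eq_mul, ← zpow_neg, zpow_mul_mem, sub_neg_eq_add]

lemma box_inj {m m' : Fin 4 → ℤ}
    (h : {v : Fin 4 → F | ∀ j, v j ∈ pw T (m j)} = {v : Fin 4 → F | ∀ j, v j ∈ pw T (m' j)}) :
    m = m' := by
  have key : ∀ m m' : Fin 4 → ℤ, {v : Fin 4 → F | ∀ j, v j ∈ pw T (m j)} ⊆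
      {v : Fin 4 → F | ∀ j, v j ∈ pw T (m' j)} → ∀ j, m' j ≤ m j := by
    intro m m' h j
    have h1 : (fun j => T.ϖ ^ (m j)) ∈ {v : Fin 4 → F | ∀ j, v j ∈ pw T (m j)} :=
      fun j => zpow_mem_pw T le_rfl
    exact (zpow_mem_iff T).1 (h h1 j)
  funext j
  exact le_antisymm (key m' m h.ge j) (key m m' h.le j)

/-- the lattice sequence attached to a parameter -/
def LS (p : Par) : T.LatSeq where
  L i := {v | ∀ j, v j ∈ pw T (p.x i j)}
  zero_mem i j := (pw T _).zero_mem
  add_mem i v w hv hw j := (pw T _).add_mem (hv j) (hw j)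
  smul_mem i c hc v hv j := O_mul_mem T hc (hv j)
  dec i v hv j := pw_anti T (cd_mono p.he (by omega)) (hv j)
  e := p.e
  e_pos := p.he
  periodic i := by
    ext v
    have := mem_smul_box T (a := 1) (m := p.x i) (v := v)
    rw [zpow_one] at this
    rw [this]
    have h2 := p.x_add i 1
    simp only [one_mul] at h2
    simp only [h2]
    rfl
  e_min e' he' h := by
    by_contra hlt
    have h1 := h (p.C 0 + 1)
    have h3 : T.ϖ • {v : Fin 4 → F | ∀ j, v j ∈ pw T (p.x (p.C 0 + 1) j)} =
        {v : Fin 4 → F | ∀ j, v j ∈ pw T (p.x (p.C 0 + 1) j + 1)} := by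
      ext v
      have := mem_smul_box T (a := 1) (m := p.x (p.C 0 + 1)) (v := v)
      rw [zpow_one] at this
      exact this
    rw [h3] at h1
    have h4 := congrFun (box_inj T (m := p.x (p.C 0 + 1 + e'))
      (m' := fun j => p.x (p.C 0 + 1) j + 1) h1) 0
    simp only [Par.x] at h4
    rw [show p.C 0 + 1 - p.C 0 = 1 by ring, cd_one p.he] at h4
    have h5 : cd (p.C 0 + 1 + e' - p.C 0) p.e ≤ 1 := by
      rw [cd_le p.he]; omega
    omega

lemma mem_LS {p : Par} {i : ℤ} {v : Fin 4 → F} :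
    v ∈ (LS T p).L i ↔ ∀ j, v j ∈ pw T (p.x i j) := Iff.rfl

/-- matrix exponents -/
def Par.y (p : Par) (n : ℤ) (i j : Fin 4) : ℤ := cd (n - p.C i + p.C j) p.e

abbrev mat (X : Module.End F (Fin 4 → F)) : Matrix (Fin 4) (Fin 4) F := LinearMap.toMatrix' X

lemma mat_apply (X : Module.End F (Fin 4 → F)) (i j : Fin 4) :
    mat X i j = X (Pi.single j 1) i := by
  simp [mat, LinearMap.toMatrix'_apply]

lemma app_eq (X : Module.End F (Fin 4 → F)) (v : Fin 4 → F) (i : Fin 4) :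
    X v i = ∑ j, mat X i j * v j := by
  rw [← LinearMap.toMatrix'_mulVec X v]; rfl

lemma mem_aFil {p : Par} {n : ℤ} {X : Module.End F (Fin 4 → F)} :
    X ∈ T.aFil (LS T p) n ↔ ∀ i j, mat X i j ∈ pw T (p.y n i j) := by
  constructor
  · intro h i j
    have h1 := h (p.C j) (T.ϖ ^ (0:ℤ) • Pi.single j 1) (by
      intro l
      rw [zpow_zero, one_smul]
      by_cases hl : l = j
      · subst hl
        simp [Par.x, cd_zero p.he, mem_pw0, T.O.one_mem]
      · simp [hl]) i
    rw [zpow_zero, one_smul, ← mat_apply] at h1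
    refine pw_anti T ?_ h1
    unfold Par.x Par.y
    exact cd_mono p.he (by omega)
  · intro h k v hv i
    rw [app_eq]
    refine AddSubgroup.sum_mem _ fun j _ => ?_
    refine pw_anti T ?_ (pw_mul T (h i j) (hv j))
    unfold Par.x Par.y
    refine le_trans (le_of_eq ?_) (cd_add_le p.he)
    congr 1; ring

lemma LS_full (p : Par) : T.IsFull (LS T p) := by
  intro i
  have hmem : ∀ j, T.ϖ ^ (p.x i j) • (Pi.single j 1 : Fin 4 → F) ∈ (LS T p).L i := by
    intro j l
    by_cases hl : l = j
    · subst hl; simp [zpow_mem_pw]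
    · simp [hl]
  constructor
  · rw [eq_top_iff]
    intro v _
    have : v = ∑ j, (v j * T.ϖ ^ (-(p.x i j))) • (T.ϖ ^ (p.x i j) • (Pi.single j 1 : Fin 4 → F)) := by
      funext l
      simp only [Finset.sum_apply, Pi.smul_apply, smul_eq_mul, Pi.single_apply]
      simp [zpow_ne_zero _ T.ϖ_ne_zero]
    rw [this]
    exact Submodule.sum_mem _ fun j _ => Submodule.smul_mem _ _ (Submodule.subset_span (hmem j))
  · let f : Fin 4 → (Fin 4 → F) := fun j => T.ϖ ^ (p.x i j) • (Pi.single j 1 : Fin 4 → F)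
    have hf : Function.Injective f := by
      intro a b hab
      by_contra hne
      have := congrFun hab a
      simp [f, hne, zpow_ne_zero _ T.ϖ_ne_zero] at this
    refine ⟨Finset.univ.image f, ?_, ?_⟩
    · intro w hw
      simp only [Finset.coe_image, Finset.coe_univ, Set.image_univ] at hw
      obtain ⟨j, rfl⟩ := hw
      exact hmem j
    · intro v hv
      refine ⟨fun w => ∑ j, if w = f j then T.ϖ ^ (-(p.x i j)) * v j else 0, ?_, ?_⟩
      · intro w _
        refine Subring.sum_mem _ fun j _ => ?_
        split_ifs
        · exact hv j
        · exact T.O.zero_mem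
      · rw [Finset.sum_image (fun a _ b _ h => hf h)]
        funext l
        simp only [Finset.sum_apply, Pi.smul_apply, smul_eq_mul, hf.eq_iff]
        simp [f, Pi.single_apply]
        field_simp [T.ϖ_ne_zero]

variable {T}

/-- `d(Λ)` -/
def Par.d (p : Par) : ℤ := 2 * p.C 2 - p.e + 1

lemma LS_dual (H : Hyp T) (p : Par) : T.selfDualWith (LS T p) p.d := by
  intro i
  have hx : ∀ (a b : ℤ), a + b = 1 - p.e → cd a p.e = - cd b p.e := by
    intro a b h
    have h1 := le_cd_mul (a := b) p.he
    have h2 := cd_mul_lt (a := b) p.he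
    apply le_antisymm
    · rw [cd_le p.he]; nlinarith
    · have h3 : - cd b p.e - 1 < cd a p.e := by
        rw [lt_cd p.he]; nlinarith
      omega
  have d1 := p.d1
  have d2 := p.d2
  have e0 : p.x (p.d - i) 0 = - p.x i 3 := hx _ _ (by unfold Par.d; linarith)
  have e3 : p.x (p.d - i) 3 = - p.x i 0 := hx _ _ (by unfold Par.d; linarith)
  have e2 : p.x (p.d - i) 2 = - p.x i 2 := hx _ _ (by unfold Par.d; linarith)
  have e1 : p.x (p.d - i) 1 = - p.x i 1 - 1 := by
    have := hx (p.d - i - p.C 1 + 1 * p.e) (i - p.C 1) (by unfold Par.d; linarith)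
    rw [cd_add_mul p.he] at this
    unfold Par.x
    linarith
  have hmem : ∀ j, T.ϖ ^ (p.x i j) • (Pi.single j 1 : Fin 4 → F) ∈ (LS T p).L i := by
    intro j l
    by_cases hl : l = j
    · subst hl; simp [zpow_mem_pw]
    · simp [hl]
  ext v
  constructor
  · intro hv
    have h0 := hv _ (hmem 0)
    have h1 := hv _ (hmem 1)
    have h2 := hv _ (hmem 2)
    have h3 := hv _ (hmem 3)
    rw [H.form] at h0 h1 h2 h3
    simp at h0 h1 h2 h3
    rw [mem_LS]
    intro j
    rw [← H.conj_mem_iff]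
    fin_cases j
    · simp only [Fin.zero_eta, e0]
      rw [mul_comm] at h3
      rwa [mem_pw, neg_neg]
    · simp only [Fin.mk_one, e1]
      rw [mem_pw, show -(-p.x i 1 - 1) = 1 + p.x i 1 by ring, zpow_add₀ T.ϖ_ne_zero, zpow_one,
        mul_assoc, mul_comm (T.ϖ ^ _)]
      exact h1
    · simp only [Fin.reduceFinMk, e2]
      rw [mul_comm] at h2
      rwa [mem_pw, neg_neg]
    · simp only [Fin.reduceFinMk, e3]
      rw [mul_comm] at h0
      rwa [mem_pw, neg_neg]
  · intro hv w hw
    rw [mem_LS] at hv hw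
    rw [H.form, ← mem_pw0]
    refine (pw T 0).add_mem ((pw T 0).add_mem ((pw T 0).add_mem ?_ ?_) ?_) ?_
    · have := pw_mul T (H.conj_mem (hv 0)) (hw 3)
      rwa [e0, neg_add_cancel] at this
    · have := pw_mul T (H.conj_mem (hv 1)) (hw 1)
      rw [e1] at this
      have h5 := pw_mul T (zpow_mem_pw T (le_refl 1)) this
      rw [zpow_one] at h5
      refine pw_anti T ?_ h5
      omega
    · have := pw_mul T (H.conj_mem (hv 2)) (hw 2)
      rwa [e2, neg_add_cancel] at this
    · have := pw_mul T (H.conj_mem (hv 3)) (hw 0)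
      rwa [e3, neg_add_cancel] at this

end lat

def par1 : Par := ⟨2, by norm_num, ![0, 1, 0, 0], by decide, by decide⟩
def par2 : Par := ⟨2, by norm_num, ![1, 1, 0, -1], by decide, by decide⟩
def par3 : Par := ⟨4, by norm_num, ![2, 3, 1, 0], by decide, by decide⟩
def par4 : Par := ⟨6, by norm_num, ![3, 5, 2, 1], by decide, by decide⟩
def par5 : Par := ⟨6, by norm_num, ![3, 4, 1, -1], by decide, by decide⟩

section lam
variable {F : Type u} [Field F] (T : USetting F (Fin 4 → F))

lemma N0_eq : T.N0 = {v : Fin 4 → F | ∀ j, v j ∈ pw T ((![0, 0, 0, 0] : Fin 4 → ℤ) j)} := by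
  ext v
  simp [N0, Fin.forall_fin_succ, mem_pw0]

lemma N1_eq : T.N1 = {v : Fin 4 → F | ∀ j, v j ∈ pw T ((![0, 0, 0, 1] : Fin 4 → ℤ) j)} := by
  ext v
  simp [N1, Fin.forall_fin_succ, mem_pw0, mem_pF]
  have : v 3 ∈ pw T 1 → v 3 ∈ T.O := fun h => (mem_pw0 T).1 (pw_anti T (by norm_num) h)
  tauto

lemma N0s_eq : T.N0s = {v : Fin 4 → F | ∀ j, v j ∈ pw T ((![0, -1, 0, 0] : Fin 4 → ℤ) j)} := by
  ext v
  simp [N0s, Fin.forall_fin_succ, mem_pw]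

lemma N1s_eq : T.N1s = {v : Fin 4 → F | ∀ j, v j ∈ pw T ((![-1, -1, 0, 0] : Fin 4 → ℤ) j)} := by
  ext v
  simp [N1s, Fin.forall_fin_succ, mem_pw]

lemma L_eq_smul {p : Par} {k a : ℤ} {m : Fin 4 → ℤ} {N : Set (Fin 4 → F)}
    (hN : N = {v : Fin 4 → F | ∀ j, v j ∈ pw T (m j)}) (h : ∀ j, p.x k j = m j + a) :
    (LS T p).L k = T.ϖ ^ a • N := by
  ext v
  rw [hN, mem_smul_box, mem_LS]
  simp only [h]

lemma isLam1 : T.IsLam1 (LS T par1) := by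
  refine ⟨rfl, fun i => ⟨L_eq_smul T (N0_eq T) ?_, L_eq_smul T (N0s_eq T) ?_⟩⟩ <;>
  · intro j
    fin_cases j <;> simp [Par.x, par1, cd] <;> omega

lemma isLam2 : T.IsLam2 (LS T par2) := by
  refine ⟨rfl, fun i => ⟨L_eq_smul T (N1_eq T) ?_, L_eq_smul T (N1s_eq T) ?_⟩⟩ <;>
  · intro j
    fin_cases j <;> simp [Par.x, par2, cd] <;> omega

lemma isLam3 : T.IsLam3 (LS T par3) := by
  refine ⟨rfl, fun i => ⟨L_eq_smul T (N0_eq T) ?_, L_eq_smul T (N1_eq T) ?_,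
    L_eq_smul T (N1s_eq T) ?_, L_eq_smul T (N0s_eq T) ?_⟩⟩ <;>
  · intro j
    fin_cases j <;> simp [Par.x, par3, cd] <;> omega

lemma isLam4 : T.IsLam4 (LS T par4) := by
  refine ⟨rfl, fun i => ⟨L_eq_smul T (N0_eq T) ?_, L_eq_smul T (N0_eq T) ?_,
    L_eq_smul T (N1_eq T) ?_, L_eq_smul T (N1s_eq T) ?_, L_eq_smul T (N0s_eq T) ?_,
    L_eq_smul T (N0s_eq T) ?_⟩⟩ <;>
  · intro j
    fin_cases j <;> simp [Par.x, par4, cd] <;> omega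

lemma isLam5 : T.IsLam5 (LS T par5) := by
  refine ⟨rfl, fun i => ⟨L_eq_smul T (N0_eq T) ?_, L_eq_smul T (N1_eq T) ?_,
    L_eq_smul T (N1_eq T) ?_, L_eq_smul T (N1s_eq T) ?_, L_eq_smul T (N1s_eq T) ?_,
    L_eq_smul T (N0s_eq T) ?_⟩⟩ <;>
  · intro j
    fin_cases j <;> simp [Par.x, par5, cd] <;> omega

end lam
end U4H

namespace U4H
open USetting

def st : Fin 4 → Fin 4 := ![3, 1, 2, 0]
def hw : Fin 4 → ℤ := ![0, 1, 0, 0]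

lemma st_st (i : Fin 4) : st (st i) = i := by fin_cases i <;> rfl
lemma hw_st (i : Fin 4) : hw (st i) = hw i := by fin_cases i <;> rfl

lemma C_st (p : Par) (i : Fin 4) : p.C (st i) = 2 * p.C 2 - p.C i + p.e * hw i := by
  have := p.d1
  have := p.d2
  fin_cases i <;> simp [st, hw] <;> linarith

lemma y_st (p : Par) (n : ℤ) (i j : Fin 4) : p.y n (st j) (st i) = p.y n i j + (hw i - hw j) := by
  unfold Par.y
  rw [← cd_add_mul p.he, C_st, C_st]
  congr 1; ring

section alg
variable {F : Type u} [Field F] {T : USetting F (Fin 4 → F)}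

lemma Hyp.form' (H : Hyp T) (v w : Fin 4 → F) :
    T.h v w = ∑ i, T.ϖ ^ hw i * (T.conj (v (st i)) * w i) := by
  rw [H.form]
  simp [Fin.sum_univ_four, hw, st]
  ring

lemma Hyp.mat_σ (H : Hyp T) (X : Module.End F (Fin 4 → F)) (i j : Fin 4) :
    mat (T.σA X) i j = T.ϖ ^ (hw j - hw i) * T.conj (mat X (st j) (st i)) := by
  have h := T.σA_adj X (Pi.single (st i) 1) (Pi.single j 1)
  rw [H.form', H.form'] at h
  have h1 : ∀ l, T.conj ((Pi.single (st i) (1 : F) : Fin 4 → F) (st l)) = if l = i then 1 else 0 := by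
    intro l
    by_cases hl : l = i
    · subst hl; simp
    · have : st l ≠ st i := fun h => hl (by rw [← st_st l, h, st_st])
      simp [hl, this]
  simp only [h1, ← mat_apply] at h
  simp [Pi.single_apply] at h
  rw [sub_eq_neg_add, zpow_add₀ T.ϖ_ne_zero, mat_apply X, mat_apply, mul_assoc, h, ← mul_assoc,
    zpow_mul_zpow]
  simp

lemma mat_mul (X Y : Module.End F (Fin 4 → F)) : mat (X * Y) = mat X * mat Y :=
  LinearMap.toMatrix'_mul X Y

lemma Hyp.σ_mem (H : Hyp T) {p : Par} {n : ℤ} {X : Module.End F (Fin 4 → F)}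
    (hX : X ∈ T.aFil (LS T p) n) : T.σA X ∈ T.aFil (LS T p) n := by
  rw [mem_aFil] at *
  intro i j
  rw [H.mat_σ, zpow_mul_mem]
  have := H.conj_mem (hX (st j) (st i))
  rw [y_st] at this
  rwa [show p.y n i j - (hw j - hw i) = p.y n i j + (hw i - hw j) by ring]

section afil
variable (Λ : T.LatSeq)

lemma a_mul {m n : ℤ} {X Y : Module.End F (Fin 4 → F)} (hX : X ∈ T.aFil Λ m)
    (hY : Y ∈ T.aFil Λ n) : X * Y ∈ T.aFil Λ (m + n) := by
  intro i v hv
  have := hX _ _ (hY i v hv)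
  rwa [show i + n + m = i + (m + n) by ring] at this

lemma a_add {n : ℤ} {X Y : Module.End F (Fin 4 → F)} (hX : X ∈ T.aFil Λ n)
    (hY : Y ∈ T.aFil Λ n) : X + Y ∈ T.aFil Λ n :=
  fun i v hv => Λ.add_mem _ _ _ (hX i v hv) (hY i v hv)

lemma a_smul {n : ℤ} {X : Module.End F (Fin 4 → F)} {c : F} (hc : c ∈ T.O)
    (hX : X ∈ T.aFil Λ n) : c • X ∈ T.aFil Λ n :=
  fun i v hv => Λ.smul_mem _ c hc _ (hX i v hv)

lemma a_neg {n : ℤ} {X : Module.End F (Fin 4 → F)} (hX : X ∈ T.aFil Λ n) : -X ∈ T.aFil Λ n := by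
  intro i v hv
  have := Λ.smul_mem _ (-1) (T.O.neg_mem T.O.one_mem) _ (hX i v hv)
  rw [neg_smul, one_smul] at this
  exact this

lemma a_sub {n : ℤ} {X Y : Module.End F (Fin 4 → F)} (hX : X ∈ T.aFil Λ n)
    (hY : Y ∈ T.aFil Λ n) : X - Y ∈ T.aFil Λ n := by
  rw [sub_eq_add_neg]; exact a_add Λ hX (a_neg Λ hY)

lemma a_zero {n : ℤ} : (0 : Module.End F (Fin 4 → F)) ∈ T.aFil Λ n :=
  fun _ _ _ => Λ.zero_mem _

lemma a_one : (1 : Module.End F (Fin 4 → F)) ∈ T.aFil Λ 0 := by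
  intro i v hv; simpa using hv

lemma L_anti {i j : ℤ} (h : i ≤ j) : Λ.L j ⊆ Λ.L i := by
  obtain ⟨n, rfl⟩ := Int.le.dest h
  induction n with
  | zero => simp
  | succ n ih =>
    intro v hv
    refine ih (by omega) (Λ.dec (i + n) ?_)
    push_cast at hv
    rwa [← add_assoc] at hv

lemma a_anti {m n : ℤ} (h : m ≤ n) {X : Module.End F (Fin 4 → F)} (hX : X ∈ T.aFil Λ n) :
    X ∈ T.aFil Λ m := fun i v hv => L_anti Λ (by omega) (hX i v hv)

end afil

lemma toE_mul (g h : T.GU) : T.toE (g * h) = T.toE g * T.toE h := rfl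

lemma toE_inv (g : T.GU) : T.toE g⁻¹ = T.σA (T.toE g) := g.2.symm

lemma toE_inv_mul (g : T.GU) : T.toE g⁻¹ * T.toE g = 1 := by
  rw [← toE_mul, inv_mul_cancel]; rfl

lemma toE_mul_inv (g : T.GU) : T.toE g * T.toE g⁻¹ = 1 := by
  rw [← toE_mul, mul_inv_cancel]; rfl

lemma σ_sub (X Y : Module.End F (Fin 4 → F)) : T.σA (X - Y) = T.σA X - T.σA Y := by
  have := T.σA_add (X - Y) Y
  rw [sub_add_cancel] at this
  rw [this]; abel

/-- the congruence subgroup -/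
def Pg (H : Hyp T) (p : Par) (n : ℕ) : Subgroup T.GU where
  carrier := T.Pset (LS T p) n
  one_mem' := by
    show T.toE 1 - 1 ∈ T.aFil (LS T p) n
    have : T.toE (1 : T.GU) = 1 := rfl
    rw [this, sub_self]; exact a_zero _
  mul_mem' := by
    intro g h hg hh
    show T.toE (g * h) - 1 ∈ T.aFil (LS T p) n
    have : T.toE (g * h) - 1 = (T.toE g - 1) * (T.toE h - 1) + ((T.toE g - 1) + (T.toE h - 1)) := by
      rw [toE_mul]; simp only [mul_sub, sub_mul, mul_one, one_mul]; abel
    rw [this]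
    exact a_add _ (a_anti _ (by omega) (a_mul _ hg hh)) (a_add _ hg hh)
  inv_mem' := by
    intro g hg
    show T.toE g⁻¹ - 1 ∈ T.aFil (LS T p) n
    have : T.toE g⁻¹ - 1 = T.σA (T.toE g - 1) := by
      rw [σ_sub, toE_inv, T.σA_one]
    rw [this]; exact H.σ_mem hg

lemma mem_Pg {H : Hyp T} {p : Par} {n : ℕ} {g : T.GU} :
    g ∈ Pg H p n ↔ T.toE g - 1 ∈ T.aFil (LS T p) n := Iff.rfl

lemma trace_eq (X : Module.End F (Fin 4 → F)) : LinearMap.trace F _ X = ∑ i, mat X i i := by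
  rw [LinearMap.trace_eq_matrix_trace F (Pi.basisFun F (Fin 4))]
  simp [Matrix.trace, mat]

lemma trace_a1 {p : Par} {X : Module.End F (Fin 4 → F)} (hX : X ∈ T.aFil (LS T p) 1) :
    LinearMap.trace F _ X ∈ pw T 1 := by
  rw [trace_eq]
  refine AddSubgroup.sum_mem _ fun i _ => ?_
  have := (mem_aFil T).1 hX i i
  rwa [Par.y, sub_add_cancel, cd_one p.he] at this

variable (F₀ : Type w) [Field F₀] [Algebra F₀ F] [FiniteDimensional F₀ F]

lemma Hyp.tr_eq (H : Hyp T) (hfix : T.FixedField F₀) (hdeg : Module.finrank F₀ F = 2) (x : F) :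
    algebraMap F₀ F (Algebra.trace F₀ F x) = x + T.conj x := by
  let c : F ≃ₐ[F₀] F := AlgEquiv.ofRingEquiv (f := T.conj) (fun a => (hfix _).2 ⟨a, rfl⟩)
  have hc : ∀ x, c x = T.conj x := fun _ => rfl
  have h2 : (2 : F₀) ≠ 0 := by
    intro h
    apply H.two
    have := congrArg (algebraMap F₀ F) h
    rwa [map_ofNat, map_zero] at this
  have hanti : ∀ y : F, T.conj y = -y → Algebra.trace F₀ F y = 0 := by
    intro y hy
    have := Algebra.trace_eq_of_algEquiv c y
    rw [hc, hy, map_neg] at this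
    have h3 : 2 * Algebra.trace F₀ F y = 0 := by linear_combination -this
    exact (mul_eq_zero.1 h3).resolve_left h2
  have hconj2 : T.conj 2 = 2 := map_ofNat T.conj 2
  have h1 : T.conj ((x + T.conj x) / 2) = (x + T.conj x) / 2 := by
    rw [map_div₀, map_add, T.conj_invol, add_comm, hconj2]
  obtain ⟨a, ha⟩ := (hfix _).1 h1
  have h3 := hanti ((x - T.conj x) / 2) (by
    rw [map_div₀, map_sub, T.conj_invol, hconj2]; ring)
  have hx : x = algebraMap F₀ F a + (x - T.conj x) / 2 := by
    rw [ha]; field_simp [H.two]; ring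
  have h4 : Algebra.trace F₀ F x = 2 * a := by
    conv_lhs => rw [hx]
    rw [map_add, h3, Algebra.trace_algebraMap, hdeg, add_zero, nsmul_eq_mul]; norm_num
  rw [h4, map_mul, ha, map_ofNat]
  field_simp [H.two]

end alg
end U4H

namespace U4H
open USetting

section res
variable {F : Type u} [Field F] (T : USetting F (Fin 4 → F))

lemma mat_add' (X Y : Module.End F (Fin 4 → F)) (i j : Fin 4) :
    mat (X + Y) i j = mat X i j + mat Y i j := by simp only [mat_apply]; rfl
lemma mat_sub' (X Y : Module.End F (Fin 4 → F)) (i j : Fin 4) :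
    mat (X - Y) i j = mat X i j - mat Y i j := by simp only [mat_apply]; rfl
lemma mat_neg' (X : Module.End F (Fin 4 → F)) (i j : Fin 4) :
    mat (-X) i j = - mat X i j := by simp only [mat_apply]; rfl
lemma mat_smul' (c : F) (X : Module.End F (Fin 4 → F)) (i j : Fin 4) :
    mat (c • X) i j = c * mat X i j := by simp only [mat_apply]; rfl

/-- the maximal ideal -/
def mI : Ideal T.O := Ideal.span {(⟨T.ϖ, T.ϖ_mem⟩ : T.O)}

variable {T} in
lemma mem_mI {x : T.O} : x ∈ mI T ↔ (x : F) ∈ pw T 1 := by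
  rw [mI, Ideal.mem_span_singleton, ← mem_pF]
  constructor
  · rintro ⟨c, hc⟩
    exact ⟨c, c.2, congrArg Subtype.val hc⟩
  · rintro ⟨z, hz, h⟩
    exact ⟨⟨z, hz⟩, Subtype.ext h⟩

instance mI_max : (mI T).IsMaximal := by
  rw [Ideal.isMaximal_iff]
  refine ⟨fun h => one_notMem T (mem_mI.1 h), ?_⟩
  intro J x _ hx hxJ
  rw [mem_mI] at hx
  obtain ⟨h0, h1⟩ := inv_mem T x.2 hx
  have := J.mul_mem_left ⟨_, h1⟩ hxJ
  convert this
  exact Subtype.ext (by simp [h0])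

/-- the residue field -/
def kk : Type u := T.O ⧸ mI T

instance : Field (kk T) := Ideal.Quotient.field (mI T)

instance : Finite (kk T) := T.res_fin

/-- the residue map -/
def rs : T.O →+* kk T := Ideal.Quotient.mk (mI T)

variable {T} in
lemma rs_zero {x : T.O} : rs T x = 0 ↔ (x : F) ∈ pw T 1 := by
  rw [← mem_mI]; exact Ideal.Quotient.eq_zero_iff_mem

/-- the residue map, extended by zero -/
def res (x : F) : kk T := if h : x ∈ T.O then rs T ⟨x, h⟩ else 0

variable {T}

lemma res_of {x : F} (h : x ∈ T.O) : res T x = rs T ⟨x, h⟩ := dif_pos h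

lemma res_eq_zero {x : F} (h : x ∈ T.O) : res T x = 0 ↔ x ∈ pw T 1 := by
  rw [res_of h, rs_zero]

lemma res_zero_of {x : F} (h : x ∈ pw T 1) : res T x = 0 :=
  (res_eq_zero (mem_pw0 T |>.1 (pw_anti T (by norm_num) h))).2 h

lemma res_add {x y : F} (hx : x ∈ T.O) (hy : y ∈ T.O) : res T (x + y) = res T x + res T y := by
  rw [res_of hx, res_of hy, res_of (T.O.add_mem hx hy), ← map_add]; rfl

lemma res_mul {x y : F} (hx : x ∈ T.O) (hy : y ∈ T.O) : res T (x * y) = res T x * res T y := by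
  rw [res_of hx, res_of hy, res_of (T.O.mul_mem hx hy), ← map_mul]; rfl

lemma res_neg {x : F} (hx : x ∈ T.O) : res T (-x) = - res T x := by
  rw [res_of hx, res_of (T.O.neg_mem hx), ← map_neg]; rfl

lemma res_sub {x y : F} (hx : x ∈ T.O) (hy : y ∈ T.O) : res T (x - y) = res T x - res T y := by
  rw [sub_eq_add_neg, res_add hx (T.O.neg_mem hy), res_neg hy, sub_eq_add_neg]

lemma res_one : res T 1 = 1 := by rw [res_of T.O.one_mem]; exact map_one _

lemma res_zero : res T 0 = 0 := by rw [res_of T.O.zero_mem]; exact map_zero _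

lemma res_sum {ι : Type*} (s : Finset ι) (f : ι → F) (hf : ∀ i ∈ s, f i ∈ T.O) :
    res T (∑ i ∈ s, f i) = ∑ i ∈ s, res T (f i) := by
  induction s using Finset.induction_on with
  | empty => simp [res_zero]
  | insert a s ha ih =>
    rw [Finset.sum_insert ha, Finset.sum_insert ha, res_add, ih]
    · intro i hi; exact hf i (Finset.mem_insert_of_mem hi)
    · exact hf a (Finset.mem_insert_self _ _)
    · exact T.O.sum_mem fun i hi => hf i (Finset.mem_insert_of_mem hi)

lemma res_surj (a : kk T) : ∃ x ∈ T.O, res T x = a := by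
  obtain ⟨x, hx⟩ := Ideal.Quotient.mk_surjective (I := mI T) a
  exact ⟨x, x.2, by rw [res_of x.2]; exact hx⟩

/-- conjugation on `O` -/
def conjO : T.O →+* T.O where
  toFun x := ⟨T.conj x, T.conj_O _ x.2⟩
  map_one' := Subtype.ext (by simp)
  map_mul' x y := Subtype.ext (by simp)
  map_zero' := Subtype.ext (by simp)
  map_add' x y := Subtype.ext (by simp)

/-- the induced conjugation on the residue field -/
def cc (H : Hyp T) : kk T →+* kk T :=
  Ideal.Quotient.lift (mI T) ((rs T).comp conjO) (by
    intro a ha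
    rw [mem_mI] at ha
    rw [RingHom.comp_apply, rs_zero]
    exact H.conj_mem ha)

lemma cc_res (H : Hyp T) {x : F} (hx : x ∈ T.O) : cc H (res T x) = res T (T.conj x) := by
  rw [res_of hx, res_of (T.conj_O _ hx)]
  exact Ideal.Quotient.lift_mk (mI T) _ _

lemma cc_cc (H : Hyp T) (a : kk T) : cc H (cc H a) = a := by
  obtain ⟨x, hx, rfl⟩ := res_surj a
  rw [cc_res H hx, cc_res H (T.conj_O _ hx), T.conj_invol]

lemma two_kk (H : Hyp T) : (2 : kk T) ≠ 0 := by
  intro h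
  have h2 : (2 : F) ∈ T.O := by
    have := T.O.add_mem T.O.one_mem T.O.one_mem
    rwa [one_add_one_eq_two] at this
  have h3 : res T 2 = 2 := by
    rw [← one_add_one_eq_two, res_add T.O.one_mem T.O.one_mem, res_one, one_add_one_eq_two]
  have := res_mul h2 H.two_inv
  rw [h3, h, zero_mul, mul_inv_cancel₀ H.two, res_one] at this
  exact one_ne_zero this

lemma cc_eq_zero (H : Hyp T) {a : kk T} : cc H a = 0 ↔ a = 0 := by
  rw [map_eq_zero]

def Par.v (p : Par) (n : ℤ) (i j : Fin 4) : ℤ := n - p.C i + p.C j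

lemma Par.y_eq (p : Par) (n : ℤ) (i j : Fin 4) : p.y n i j = cd (p.v n i j) p.e := rfl

lemma scaled_mem {p : Par} {n : ℤ} {i j : Fin 4} (h : p.e ∣ p.v n i j) {x : F}
    (hx : x ∈ pw T (p.y n i j)) : T.ϖ ^ (-(p.v n i j / p.e)) * x ∈ T.O := by
  rwa [← mem_pw0, zpow_mul_mem, zero_sub, neg_neg, ← cd_of_dvd p.he h]

/-- the residue matrix -/
def R (T : USetting F (Fin 4 → F)) (p : Par) (n : ℤ) (X : Module.End F (Fin 4 → F)) :
    Matrix (Fin 4) (Fin 4) (kk T) := fun i j =>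
  if p.e ∣ p.v n i j then res T (T.ϖ ^ (-(p.v n i j / p.e)) * mat X i j) else 0

lemma R_of_dvd {p : Par} {n : ℤ} {X : Module.End F (Fin 4 → F)} {i j : Fin 4}
    (h : p.e ∣ p.v n i j) : R T p n X i j = res T (T.ϖ ^ (-(p.v n i j / p.e)) * mat X i j) :=
  if_pos h

lemma R_of_not {p : Par} {n : ℤ} {X : Module.End F (Fin 4 → F)} {i j : Fin 4}
    (h : ¬ p.e ∣ p.v n i j) : R T p n X i j = 0 := if_neg h

lemma R_zero_mem {p : Par} {n : ℤ} {X : Module.End F (Fin 4 → F)} {i j : Fin 4}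
    (hX : X ∈ T.aFil (LS T p) n) (h : R T p n X i j = 0) : mat X i j ∈ pw T (p.y (n + 1) i j) := by
  have hm := (mem_aFil T).1 hX i j
  have e1 : p.y (n + 1) i j = cd (p.v n i j + 1) p.e := by
    rw [Par.y_eq, Par.v, Par.v]; congr 1; ring
  by_cases hd : p.e ∣ p.v n i j
  · rw [R_of_dvd hd, res_eq_zero (scaled_mem hd hm), zpow_mul_mem] at h
    rw [e1, cd_succ_of_dvd p.he hd]
    convert h using 2; ring
  · rw [e1, cd_succ_of_not_dvd p.he hd]; exact hm

lemma R_of_mem {p : Par} {n : ℤ} {X : Module.End F (Fin 4 → F)}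
    (hX : X ∈ T.aFil (LS T p) (n + 1)) : R T p n X = 0 := by
  ext i j
  by_cases hd : p.e ∣ p.v n i j
  · rw [R_of_dvd hd]
    apply res_zero_of
    rw [zpow_mul_mem]
    have := (mem_aFil T).1 hX i j
    have e1 : p.y (n + 1) i j = cd (p.v n i j + 1) p.e := by
      rw [Par.y_eq, Par.v, Par.v]; congr 1; ring
    rw [e1, cd_succ_of_dvd p.he hd] at this
    convert this using 2; ring
  · rw [R_of_not hd]; rfl

lemma R_sub {p : Par} {n : ℤ} {X Y : Module.End F (Fin 4 → F)}
    (hX : X ∈ T.aFil (LS T p) n) (hY : Y ∈ T.aFil (LS T p) n) :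
    R T p n (X - Y) = R T p n X - R T p n Y := by
  ext i j
  rw [Matrix.sub_apply]
  by_cases hd : p.e ∣ p.v n i j
  · rw [R_of_dvd hd, R_of_dvd hd, R_of_dvd hd, ← res_sub (scaled_mem hd ((mem_aFil T).1 hX i j))
      (scaled_mem hd ((mem_aFil T).1 hY i j)), ← mul_sub, mat_sub']
  · rw [R_of_not hd, R_of_not hd, R_of_not hd, sub_zero]

lemma R_eq_sub_mem {p : Par} {n : ℤ} {X Y : Module.End F (Fin 4 → F)}
    (hX : X ∈ T.aFil (LS T p) n) (hY : Y ∈ T.aFil (LS T p) n) (h : R T p n X = R T p n Y) :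
    X - Y ∈ T.aFil (LS T p) (n + 1) := by
  rw [mem_aFil]
  intro i j
  apply R_zero_mem (a_sub _ hX hY)
  rw [R_sub hX hY, h, sub_self]; rfl

lemma R_mul {p : Par} {m n : ℤ} {X Y : Module.End F (Fin 4 → F)}
    (hX : X ∈ T.aFil (LS T p) m) (hY : Y ∈ T.aFil (LS T p) n) :
    R T p (m + n) (X * Y) = R T p m X * R T p n Y := by
  ext i j
  rw [Matrix.mul_apply]
  have hv : ∀ l, p.v (m + n) i j = p.v m i l + p.v n l j := by intro l; simp only [Par.v]; ring
  have hX' := (mem_aFil T).1 hX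
  have hY' := (mem_aFil T).1 hY
  by_cases hd : p.e ∣ p.v (m + n) i j
  · rw [R_of_dvd hd, mat_mul, Matrix.mul_apply, Finset.mul_sum]
    have key : ∀ l, T.ϖ ^ (-(p.v (m + n) i j / p.e)) * (mat X i l * mat Y l j) ∈ T.O ∧
        res T (T.ϖ ^ (-(p.v (m + n) i j / p.e)) * (mat X i l * mat Y l j)) =
          R T p m X i l * R T p n Y l j := by
      intro l
      by_cases h1 : p.e ∣ p.v m i l
      · have h2 : p.e ∣ p.v n l j := by rw [hv l] at hd; exact (dvd_add_right h1).1 hd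
        have e1 : T.ϖ ^ (-(p.v (m + n) i j / p.e)) * (mat X i l * mat Y l j) =
            (T.ϖ ^ (-(p.v m i l / p.e)) * mat X i l) * (T.ϖ ^ (-(p.v n l j / p.e)) * mat Y l j) := by
          rw [hv l, Int.add_ediv_of_dvd_left h1, neg_add, ← zpow_mul_zpow]; ring
        rw [e1, R_of_dvd h1, R_of_dvd h2]
        have a1 := scaled_mem h1 (hX' i l)
        have a2 := scaled_mem h2 (hY' l j)
        exact ⟨T.O.mul_mem a1 a2, res_mul a1 a2⟩
      · have : T.ϖ ^ (-(p.v (m + n) i j / p.e)) * (mat X i l * mat Y l j) ∈ pw T 1 := by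
          rw [zpow_mul_mem]
          refine pw_anti T ?_ (pw_mul T (hX' i l) (hY' l j))
          rw [Par.y_eq, Par.y_eq, ← cd_of_dvd p.he hd]
          obtain ⟨q, hq⟩ := hd
          have h3 : cd (p.v (m + n) i j) p.e = q := by rw [hq, mul_comm, cd_mul p.he]
          rw [h3]
          have h4 := le_cd_mul (a := p.v m i l) p.he
          have h5 := le_cd_mul (a := p.v n l j) p.he
          have h6 : p.v m i l ≠ cd (p.v m i l) p.e * p.e := fun h => h1 ⟨_, by rw [mul_comm]; exact h⟩
          have h7 := hv l
          have h8 : q * p.e < (cd (p.v m i l) p.e + cd (p.v n l j) p.e) * p.e := by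
            rw [add_mul]
            have : p.v m i l < cd (p.v m i l) p.e * p.e := lt_of_le_of_ne h4 h6
            linarith
          have h9 := lt_of_mul_lt_mul_right h8 p.he.le
          linarith
        refine ⟨mem_pw0 T |>.1 (pw_anti T (by norm_num) this), ?_⟩
        rw [res_zero_of this, R_of_not h1, zero_mul]
    rw [res_sum _ _ fun l _ => (key l).1]
    exact Finset.sum_congr rfl fun l _ => (key l).2
  · rw [R_of_not hd]
    symm
    apply Finset.sum_eq_zero
    intro l _
    by_cases h1 : p.e ∣ p.v m i l
    · have h2 : ¬ p.e ∣ p.v n l j := fun h => hd (by rw [hv l]; exact dvd_add h1 h)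
      rw [R_of_not h2, mul_zero]
    · rw [R_of_not h1, zero_mul]

lemma R_one {p : Par} : R T p 0 1 = 1 := by
  ext i j
  have h1 : mat (1 : Module.End F (Fin 4 → F)) = 1 := LinearMap.toMatrix'_one
  by_cases hij : i = j
  · subst hij
    have : p.v 0 i i = 0 := by simp [Par.v]
    rw [R_of_dvd (by rw [this]; exact dvd_zero _), this, h1]
    simp [res_one]
  · rw [Matrix.one_apply_ne hij]
    unfold R
    split_ifs
    · rw [h1, Matrix.one_apply_ne hij, mul_zero, res_zero]
    · rfl

lemma a_pow {Λ : T.LatSeq} {n : ℤ} {X : Module.End F (Fin 4 → F)} (hX : X ∈ T.aFil Λ n) (k : ℕ) :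
    X ^ k ∈ T.aFil Λ (k * n) := by
  induction k with
  | zero => simpa using a_one Λ
  | succ k ih =>
    rw [pow_succ]
    have := a_mul Λ ih hX
    rwa [show ((k + 1 : ℕ) : ℤ) * n = k * n + n by push_cast; ring]

lemma R_pow {p : Par} {n : ℤ} {X : Module.End F (Fin 4 → F)}
    (hX : X ∈ T.aFil (LS T p) n) (k : ℕ) : R T p (k * n) (X ^ k) = R T p n X ^ k := by
  induction k with
  | zero => simpa using R_one
  | succ k ih =>
    rw [pow_succ, pow_succ, ← ih, ← R_mul (a_pow hX k) hX]
    congr 1; push_cast; ring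

lemma R_smul {p : Par} {n k : ℤ} {X : Module.End F (Fin 4 → F)} :
    R T p (n + k * p.e) (T.ϖ ^ k • X) = R T p n X := by
  ext i j
  have hv : p.v (n + k * p.e) i j = p.v n i j + k * p.e := by simp only [Par.v]; ring
  have hd : p.e ∣ p.v (n + k * p.e) i j ↔ p.e ∣ p.v n i j := by
    rw [hv]; exact (Int.dvd_add_left (Dvd.intro_left k rfl))
  unfold R
  simp only [hd]
  split_ifs with h
  · congr 1
    rw [mat_smul', ← mul_assoc, zpow_mul_zpow, hv,
      Int.add_mul_ediv_right _ _ p.he.ne']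
    congr 2; ring
  · rfl

lemma smul_a {p : Par} {n k : ℤ} {X : Module.End F (Fin 4 → F)} (hX : X ∈ T.aFil (LS T p) n) :
    T.ϖ ^ k • X ∈ T.aFil (LS T p) (n + k * p.e) := by
  rw [mem_aFil] at *
  intro i j
  rw [mat_smul', zpow_mul_mem]
  convert hX i j using 2
  rw [Par.y_eq, Par.y_eq, show p.v (n + k * p.e) i j = p.v n i j + k * p.e by
    simp only [Par.v]; ring, cd_add_mul p.he]
  ring

lemma R_skew (H : Hyp T) {p : Par} {n : ℤ} {X : Module.End F (Fin 4 → F)}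
    (hX : X ∈ T.aFil (LS T p) n) (hs : X ∈ T.Aminus) (i j : Fin 4) :
    R T p n X i j = - cc H (R T p n X (st j) (st i)) := by
  have hv : p.v n (st j) (st i) = p.v n i j + (hw i - hw j) * p.e := by
    simp only [Par.v, C_st]; ring
  have hd : p.e ∣ p.v n (st j) (st i) ↔ p.e ∣ p.v n i j := by
    rw [hv]; exact (Int.dvd_add_left (Dvd.intro_left _ rfl))
  by_cases h : p.e ∣ p.v n i j
  · have hm := scaled_mem (hd.2 h) ((mem_aFil T).1 hX (st j) (st i))
    rw [R_of_dvd h, R_of_dvd (hd.2 h), cc_res H hm, ← res_neg (T.conj_O _ hm)]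
    congr 1
    have h1 : T.σA X = -X := hs
    have h2 := H.mat_σ X i j
    rw [h1, mat_neg'] at h2
    rw [map_mul, H.conj_zpow, hv, Int.add_mul_ediv_right _ _ p.he.ne']
    rw [neg_eq_iff_eq_neg] at h2
    rw [h2, mul_neg, ← mul_assoc, zpow_mul_zpow]
    congr 4; ring
  · rw [R_of_not h, R_of_not (fun h' => h (hd.1 h')), map_zero, neg_zero]

end res
end U4H

namespace U4H
open USetting

section fourier_abs

lemma fourier_abs {G : Type*} [Group G] {W : Type*} [AddCommGroup W] [Module ℂ W]
    (π : G →* Module.End ℂ W) (K : Subgroup G) (N : Subgroup K) [Finite (K ⧸ N)]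
    (D : Set (K → ℂ)) [Finite D]
    (h1 : ∀ χ ∈ D, ∀ g h, χ (g * h) = χ g * χ h) (h2 : ∀ χ ∈ D, ∀ g ∈ N, χ g = 1)
    (h3 : ∀ χ ∈ D, ∀ χ' ∈ D, χ * χ' ∈ D) (hD : D.Nonempty)
    (h4 : ∀ g : K, g ∉ N → ∃ χ ∈ D, χ g ≠ 1)
    (w : W) (hw : w ≠ 0) (hN : ∀ g : K, g ∈ N → π g w = w) :
    ∃ χ ∈ D, ∃ w' : W, w' ≠ 0 ∧ ∀ g : K, π g w' = χ g • w' := by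
  have : Fintype (K ⧸ N) := Fintype.ofFinite _
  have : Fintype D := Fintype.ofFinite _
  have hone : ∀ χ ∈ D, χ 1 = 1 := fun χ hχ => h2 χ hχ 1 N.one_mem
  have hinv : ∀ χ ∈ D, ∀ g, χ g⁻¹ * χ g = 1 := fun χ hχ g => by
    rw [← h1 χ hχ, inv_mul_cancel, hone χ hχ]
  have hne : ∀ χ ∈ D, ∀ g, χ g ≠ 0 := fun χ hχ g h => by
    have := hinv χ hχ g; rw [h, mul_zero] at this; exact zero_ne_one this
  have hπ1 : ∀ g h : K, π ((g * h : K) : G) = π g * π h := fun g h => by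
    rw [← map_mul]; rfl
  -- the summand
  have hwd : ∀ χ : D, ∀ a b : K, (QuotientGroup.leftRel N) a b →
      (χ : K → ℂ) a⁻¹ • π a w = (χ : K → ℂ) b⁻¹ • π b w := by
    intro χ a b hab
    rw [QuotientGroup.leftRel_apply] at hab
    have hb : b = a * (a⁻¹ * b) := by group
    have e1 : π (b : G) w = π (a : G) w := by
      rw [hb, hπ1, Module.End.mul_apply, hN _ hab]
    have e2 : (χ : K → ℂ) b⁻¹ = (χ : K → ℂ) a⁻¹ := by
      have : b⁻¹ = (a⁻¹ * b)⁻¹ * a⁻¹ := by group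
      rw [this, h1 _ χ.2, h2 _ χ.2 _ (N.inv_mem hab), one_mul]
    rw [e1, e2]
  let f : D → K ⧸ N → W := fun χ q => Quotient.liftOn' q _ (hwd χ)
  have hf : ∀ χ a, f χ (QuotientGroup.mk a) = (χ : K → ℂ) a⁻¹ • π a w := fun χ a => rfl
  have heig : ∀ χ : D, ∀ g : K, π g (∑ q, f χ q) = (χ : K → ℂ) g • ∑ q, f χ q := by
    intro χ g
    rw [map_sum]
    have : ∀ q, π (g : G) (f χ q) = (χ : K → ℂ) g • f χ (g • q) := by
      intro q
      induction q using QuotientGroup.induction_on with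
      | H a =>
        rw [MulAction.Quotient.smul_mk, smul_eq_mul, hf, hf, map_smul, hπ1, Module.End.mul_apply,
          smul_smul, mul_inv_rev, h1 _ χ.2]
        have h5 := hinv _ χ.2 g
        congr 1
        linear_combination (-(χ : K → ℂ) a⁻¹) * h5
    simp only [this]
    rw [← Finset.smul_sum]
    congr 1
    exact Fintype.sum_equiv (MulAction.toPerm g) _ _ (fun q => rfl)
  -- total sum
  have hsum0 : ∀ g : K, g ∉ N → ∑ χ : D, (χ : K → ℂ) g = 0 := by
    intro g hg
    obtain ⟨χ₀, hχ₀, hne1⟩ := h4 g hg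
    let m : D → D := fun χ => ⟨χ₀ * χ, h3 _ hχ₀ _ χ.2⟩
    have hm : Function.Injective m := by
      intro a b hab
      ext x
      have := congrFun (congrArg Subtype.val hab) x
      exact mul_left_cancel₀ (hne _ hχ₀ x) this
    have hb := Finite.injective_iff_bijective.1 hm
    have e1 : ∑ χ : D, (χ : K → ℂ) g = ∑ χ : D, ((m χ : D) : K → ℂ) g :=
      (Fintype.sum_bijective m hb _ _ (fun _ => rfl)).symm
    have e2 : ∑ χ : D, ((m χ : D) : K → ℂ) g = χ₀ g * ∑ χ : D, (χ : K → ℂ) g := by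
      rw [Finset.mul_sum]; rfl
    rw [e2] at e1
    have : (χ₀ g - 1) * ∑ χ : D, (χ : K → ℂ) g = 0 := by linear_combination -e1
    exact (mul_eq_zero.1 this).resolve_left (sub_ne_zero.2 hne1)
  have htot : ∑ χ : D, ∑ q, f χ q = (Fintype.card D : ℂ) • w := by
    rw [Finset.sum_comm]
    rw [Finset.sum_eq_single (QuotientGroup.mk (1 : K))]
    · have : ∀ χ : D, f χ (QuotientGroup.mk (1 : K)) = w := by
        intro χ
        rw [hf, inv_one, hone _ χ.2, one_smul]
        simp
      simp only [this, Finset.sum_const, Finset.card_univ]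
      rw [Nat.cast_smul_eq_nsmul]
    · intro q _ hq
      induction q using QuotientGroup.induction_on with
      | H a =>
        simp only [hf]
        rw [← Finset.sum_smul, hsum0, zero_smul]
        intro ha
        apply hq
        rw [QuotientGroup.eq]
        simpa using ha
    · intro h; exact absurd (Finset.mem_univ _) h
  by_contra hcon
  push Not at hcon
  have hz : ∀ χ : D, ∑ q, f χ q = 0 := by
    intro χ
    by_contra hn
    obtain ⟨g, hg⟩ := hcon χ χ.2 _ hn
    exact hg (heig χ g)
  simp only [hz, Finset.sum_const_zero] at htot
  have hcard : (Fintype.card D : ℂ) ≠ 0 := by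
    have : Nonempty D := hD.to_subtype
    exact_mod_cast Fintype.card_ne_zero
  exact (smul_ne_zero hcard hw) htot.symm

end fourier_abs

section fourier
variable {F : Type u} [Field F] {T : USetting F (Fin 4 → F)}
  {F₀ : Type w} [Field F₀] [Algebra F₀ F] [FiniteDimensional F₀ F] {ψ₀ : F₀ → ℂ}

/-- all the standing data -/
structure Dat (T : USetting F (Fin 4 → F)) (F₀ : Type w) [Field F₀] [Algebra F₀ F]
    [FiniteDimensional F₀ F] (ψ₀ : F₀ → ℂ) : Prop where
  H : Hyp T
  hfix : T.FixedField F₀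
  hdeg : Module.finrank F₀ F = 2
  hψ : T.IsAddCh F₀ ψ₀

variable (F₀ ψ₀) in
/-- the additive character of `A` -/
def ph (X : Module.End F (Fin 4 → F)) : ℂ := ψ₀ (trA0 F₀ X)

lemma psi_eq (β : Module.End F (Fin 4 → F)) (g : T.GU) :
    T.psiCh F₀ ψ₀ β g = ph F₀ ψ₀ (β * (T.toE g - 1)) := rfl

lemma ph_add (D : Dat T F₀ ψ₀) (X Y : Module.End F (Fin 4 → F)) :
    ph F₀ ψ₀ (X + Y) = ph F₀ ψ₀ X * ph F₀ ψ₀ Y := by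
  unfold ph trA0
  rw [map_add, map_add, D.hψ.1]

lemma ph_one (D : Dat T F₀ ψ₀) {X : Module.End F (Fin 4 → F)}
    (hX : LinearMap.trace F _ X ∈ pw T 1) : ph F₀ ψ₀ X = 1 := by
  apply D.hψ.2.1
  rw [trA0, D.H.tr_eq F₀ D.hfix D.hdeg, mem_pF]
  exact (pw T 1).add_mem hX (D.H.conj_mem hX)

lemma trace_σ (H : Hyp T) (X : Module.End F (Fin 4 → F)) :
    LinearMap.trace F _ (T.σA X) = T.conj (LinearMap.trace F _ X) := by
  rw [trace_eq, trace_eq, map_sum]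
  simp only [H.mat_σ, sub_self, zpow_zero, one_mul]
  simp [Fin.sum_univ_four, st]
  ring

lemma σ_smul (H : Hyp T) (c : F) (X : Module.End F (Fin 4 → F)) :
    T.σA (c • X) = T.conj c • T.σA X := by
  apply LinearMap.toMatrix'.injective
  ext i j
  change mat _ i j = mat _ i j
  rw [H.mat_σ, mat_smul', mat_smul', map_mul, H.mat_σ]; ring

lemma toE_a0 {p : Par} {n : ℤ} (hn : 0 ≤ n) {g : T.GU} (hg : T.toE g - 1 ∈ T.aFil (LS T p) n) :
    T.toE g ∈ T.aFil (LS T p) 0 := by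
  have := a_add _ (a_anti _ hn hg) (a_one (LS T p))
  rwa [sub_add_cancel] at this

lemma e_mul_neg (X Y : Module.End F (Fin 4 → F)) : X * (-Y) = -(X * Y) := by
  ext i j; simp

lemma e_neg_smul (c : F) (X : Module.End F (Fin 4 → F)) : (-c) • X = -(c • X) := by
  ext i j; simp

lemma nontriv (D : Dat T F₀ ψ₀) {p : Par} {n : ℕ} (hn : 1 ≤ n) {g : T.GU} (hg : g ∈ Pg D.H p n)
    (hg' : g ∉ Pg D.H p (n + 1)) :
    ∃ β ∈ T.aFil (LS T p) (-n), β ∈ T.Aminus ∧ T.psiCh F₀ ψ₀ β g ≠ 1 := by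
  set X := T.toE g - T.toE g⁻¹ with hXd
  have hgi := (Pg D.H p n).inv_mem hg
  rw [mem_Pg] at hg hg' hgi
  push_cast at hg'
  have hX : X ∈ T.aFil (LS T p) n := by
    have := a_sub _ hg hgi
    rwa [sub_sub_sub_cancel_right] at this
  have hXs : T.σA X = -X := by
    rw [hXd, σ_sub, ← toE_inv, ← toE_inv, inv_inv]; abel
  have hE : T.toE g - 1 = (2 : F)⁻¹ • (X - (T.toE g - 1) * (T.toE g⁻¹ - 1)) := by
    have : X - (T.toE g - 1) * (T.toE g⁻¹ - 1) = (2 : F) • (T.toE g - 1) := by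
      simp only [mul_sub, sub_mul, toE_mul_inv, mul_one, one_mul, two_smul, hXd]; abel
    rw [this, smul_smul, inv_mul_cancel₀ D.H.two, one_smul]
  have hq : (T.toE g - 1) * (T.toE g⁻¹ - 1) ∈ T.aFil (LS T p) (n + 1) :=
    a_anti _ (by omega) (a_mul _ hg hgi)
  have hX' : X ∉ T.aFil (LS T p) (n + 1) := by
    intro h
    apply hg'
    rw [hE]
    exact a_smul _ D.H.two_inv (a_sub _ h hq)
  rw [mem_aFil] at hX'
  push Not at hX'
  obtain ⟨i, j, hij⟩ := hX'
  have hR : R T p n X i j ≠ 0 := fun h => hij (R_zero_mem hX h)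
  have hd : p.e ∣ p.v n i j := by
    by_contra h; exact hR (R_of_not h)
  set q := p.v n i j / p.e with hqd
  have hvq : p.v n i j = q * p.e := (Int.ediv_mul_cancel hd).symm
  have hx1 : mat X i j ∈ pw T q := by
    have := (mem_aFil T).1 hX i j
    rwa [Par.y_eq, cd_of_dvd p.he hd] at this
  have hx2 : mat X i j ∉ pw T (q + 1) := by
    have e1 : p.y (n + 1) i j = cd (p.v n i j + 1) p.e := by
      rw [Par.y_eq, Par.v, Par.v]; congr 1; ring
    rwa [e1, cd_succ_of_dvd p.he hd] at hij
  obtain ⟨hx0, hxi⟩ := inv_mem_pw T hx1 hx2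
  obtain ⟨x0, hx0O, hx0ψ⟩ := D.hψ.2.2
  set a := algebraMap F₀ F x0 with had
  have hca : T.conj a = a := (D.hfix a).2 ⟨x0, rfl⟩
  set l := (2 : F)⁻¹ * (a * (mat X i j)⁻¹) with hld
  have hl : l ∈ pw T (-q) := O_mul_mem T D.H.two_inv (O_mul_mem T hx0O hxi)
  set Z : Module.End F (Fin 4 → F) := Matrix.toLin' (Matrix.single j i l) with hZd
  have hmZ : mat Z = Matrix.single j i l := LinearMap.toMatrix'_toLin' _
  have hZ : Z ∈ T.aFil (LS T p) (-n) := by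
    rw [mem_aFil]
    intro r s
    rw [hmZ, Matrix.single_apply]
    split_ifs with h
    · obtain ⟨rfl, rfl⟩ := h
      have : p.y (-n) j i = -q := by
        rw [Par.y_eq, show p.v (-n) j i = (-q) * p.e by
          have := hvq; simp only [Par.v] at this ⊢; linarith, cd_mul p.he]
      rwa [this]
    · exact (pw T _).zero_mem
  have hβ : Z - T.σA Z ∈ T.aFil (LS T p) (-n) := a_sub _ hZ (D.H.σ_mem hZ)
  have hβs : T.σA (Z - T.σA Z) = -(Z - T.σA Z) := by
    rw [σ_sub, T.σA_invol]; abel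
  refine ⟨Z - T.σA Z, hβ, hβs, ?_⟩
  have htZ : LinearMap.trace F _ (Z * X) = 2⁻¹ * a := by
    rw [trace_eq]
    simp only [mat_mul, hmZ, Matrix.mul_apply, Matrix.single_apply]
    rw [Finset.sum_eq_single j, Finset.sum_eq_single i]
    · simp only [and_self, if_true]
      rw [hld]
      field_simp
    · intro b _ hb; simp [Ne.symm hb]
    · simp
    · intro b _ hb; simp [Ne.symm hb]
    · simp
  have htσ : LinearMap.trace F _ (T.σA Z * X) = - (2⁻¹ * a) := by
    have : T.σA Z * X = - T.σA (X * Z) := by rw [T.σA_mul, hXs, e_mul_neg, neg_neg]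
    rw [this, map_neg, trace_σ D.H, LinearMap.trace_mul_comm, htZ, map_mul, hca, map_inv₀]
    rw [show T.conj 2 = 2 from map_ofNat T.conj 2]
  have h2 := D.H.two
  have key : LinearMap.trace F _ ((Z - T.σA Z) * ((2 : F)⁻¹ • X)) = 2⁻¹ * a := by
    rw [mul_smul_comm, map_smul, sub_mul, map_sub, htZ, htσ, smul_eq_mul]
    field_simp; ring
  rw [psi_eq]
  have e3 : (Z - T.σA Z) * (T.toE g - 1) = (Z - T.σA Z) * ((2 : F)⁻¹ • X) +
      (Z - T.σA Z) * ((-(2 : F)⁻¹) • ((T.toE g - 1) * (T.toE g⁻¹ - 1))) := by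
    conv_lhs => rw [hE]
    rw [← mul_add, smul_sub, e_neg_smul, ← sub_eq_add_neg]
  rw [e3, ph_add D, ph_one D (X := (Z - T.σA Z) * ((-(2 : F)⁻¹) • _)) ?_, mul_one]
  · have : trA0 F₀ ((Z - T.σA Z) * ((2 : F)⁻¹ • X)) = x0 := by
      apply (algebraMap F₀ F).injective
      rw [trA0, key, D.H.tr_eq F₀ D.hfix D.hdeg, map_mul, hca, map_inv₀]
      rw [show T.conj 2 = 2 from map_ofNat T.conj 2]
      field_simp; ring
    rw [ph, this]; exact hx0ψ
  · refine trace_a1 (a_anti _ ?_ (a_mul _ hβ (a_smul _ (T.O.neg_mem D.H.two_inv) hq)))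
    omega

variable {Wπ : Type*} [AddCommGroup Wπ] [Module ℂ Wπ]

/-- existence of a nonzero `P_{n+1}`-fixed vector -/
def Fix (π : T.GU →* Module.End ℂ Wπ) (p : Par) (n : ℕ) : Prop :=
  ∃ w : Wπ, w ≠ 0 ∧ ∀ g : T.GU, T.toE g - 1 ∈ T.aFil (LS T p) (n + 1) → π g w = w

variable (F₀ ψ₀) in
/-- existence of an eigenvector -/
def Eig (π : T.GU →* Module.End ℂ Wπ) (p : Par) (n : ℕ) (β : Module.End F (Fin 4 → F)) : Prop :=
  ∃ w : Wπ, w ≠ 0 ∧ ∀ g : T.GU, T.toE g - 1 ∈ T.aFil (LS T p) n →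
    π g w = T.psiCh F₀ ψ₀ β g • w

lemma exists_eig (D : Dat T F₀ ψ₀) (π : T.GU →* Module.End ℂ Wπ) {p : Par} {n : ℕ} (hn : 1 ≤ n)
    (h : Fix π p n) :
    ∃ β ∈ T.aFil (LS T p) (-n), β ∈ T.Aminus ∧ Eig F₀ ψ₀ π p n β := by
  obtain ⟨w, hw, hfix⟩ := h
  let K := Pg D.H p n
  let N := (Pg D.H p (n + 1)).subgroupOf K
  have hKm : ∀ g : K, T.toE g - 1 ∈ T.aFil (LS T p) n := fun g => g.2
  have hfin : Finite (K ⧸ N) := by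
    refine Finite.of_injective (β := Matrix (Fin 4) (Fin 4) (kk T))
      (fun q => R T p n (T.toE (q.out : K) - 1)) ?_
    intro a b hab
    have h1 := R_eq_sub_mem (hKm b.out) (hKm a.out) hab.symm
    rw [sub_sub_sub_cancel_right] at h1
    rw [← Quotient.out_eq' a, ← Quotient.out_eq' b]
    apply Quotient.sound'
    rw [QuotientGroup.leftRel_apply, Subgroup.mem_subgroupOf, mem_Pg]
    have h2 : T.toE ((a.out : K)⁻¹ : K) ∈ T.aFil (LS T p) 0 :=
      toE_a0 (Int.natCast_nonneg n) (hKm (a.out : K)⁻¹)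
    have h3 := a_mul _ h2 h1
    rw [mul_sub] at h3
    rw [zero_add] at h3
    have h4 := toE_inv_mul (a.out : K).1
    push_cast at h3 h4 ⊢
    rw [toE_mul]
    rwa [h4] at h3
  let S : Set (K → ℂ) := {χ | ∃ β, β ∈ T.aFil (LS T p) (-n) ∧ β ∈ T.Aminus ∧
    χ = fun g : K => T.psiCh F₀ ψ₀ β g}
  have hSfin : Finite S := by
    have hch : ∀ χ : S, ∃ β, β ∈ T.aFil (LS T p) (-n) ∧ β ∈ T.Aminus ∧
      (χ : K → ℂ) = fun g : K => T.psiCh F₀ ψ₀ β g := fun χ => χ.2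
    choose bf hb1 hb2 hb3 using hch
    refine Finite.of_injective (β := Matrix (Fin 4) (Fin 4) (kk T)) (fun χ => R T p (-n) (bf χ)) ?_
    intro a b hab
    have h1 := R_eq_sub_mem (hb1 a) (hb1 b) hab
    apply Subtype.ext
    rw [hb3 a, hb3 b]
    funext g
    rw [psi_eq, psi_eq]
    have : bf a * (T.toE (g : T.GU) - 1) = bf b * (T.toE (g : T.GU) - 1) +
        (bf a - bf b) * (T.toE (g : T.GU) - 1) := by rw [← add_mul]; congr 1; abel
    rw [this, ph_add D, ph_one D (X := (bf a - bf b) * _), mul_one]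
    exact trace_a1 (a_anti _ (by omega) (a_mul _ h1 (hKm g)))
  suffices hh : ∃ χ ∈ S, ∃ w' : Wπ, w' ≠ 0 ∧ ∀ g : K, π g w' = χ g • w' by
    obtain ⟨χ, ⟨β, hβ, hβs, rfl⟩, w', hw', he⟩ := hh
    exact ⟨β, hβ, hβs, w', hw', fun g hg => he ⟨g, hg⟩⟩
  refine fourier_abs π K N S ?_ ?_ ?_ ?_ ?_ w hw ?_
  · rintro χ ⟨β, hβ, hβs, rfl⟩ g h
    simp only [psi_eq]
    have : β * (T.toE ((g * h : K) : T.GU) - 1) = β * (T.toE (g : T.GU) - 1) +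
        β * (T.toE (h : T.GU) - 1) + β * ((T.toE (g : T.GU) - 1) * (T.toE (h : T.GU) - 1)) := by
      rw [← mul_add, ← mul_add]
      congr 1
      push_cast
      rw [toE_mul]; simp only [mul_sub, sub_mul, mul_one, one_mul]; abel
    rw [this, ph_add D, ph_add D, ph_one D (X := β * (_ * _)), mul_one]
    exact trace_a1 (a_anti _ (by omega) (a_mul _ hβ (a_mul _ (hKm g) (hKm h))))
  · rintro χ ⟨β, hβ, hβs, rfl⟩ g hg
    rw [Subgroup.mem_subgroupOf, mem_Pg] at hg
    simp only [psi_eq]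
    exact ph_one D (trace_a1 (a_anti _ (by push_cast; omega) (a_mul _ hβ hg)))
  · rintro χ ⟨β, hβ, hβs, rfl⟩ χ' ⟨γ, hγ, hγs, rfl⟩
    refine ⟨β + γ, a_add _ hβ hγ, ?_, ?_⟩
    · change T.σA (β + γ) = -(β + γ)
      have h1 : T.σA β = -β := hβs
      have h2 : T.σA γ = -γ := hγs
      rw [T.σA_add, h1, h2]; abel
    · funext g
      simp only [psi_eq, Pi.mul_apply]
      rw [← ph_add D, ← add_mul]
  · refine ⟨_, 0, a_zero _, ?_, rfl⟩
    change T.σA 0 = -0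
    have := T.σA_add 0 0
    rw [add_zero] at this
    rw [neg_zero]
    exact left_eq_add.1 this
  · intro g hg
    rw [Subgroup.mem_subgroupOf] at hg
    obtain ⟨β, hβ, hβs, h⟩ := nontriv (ψ₀ := ψ₀) D hn g.2 hg
    exact ⟨_, ⟨β, hβ, hβs, rfl⟩, h⟩
  · intro g hg
    rw [Subgroup.mem_subgroupOf, mem_Pg] at hg
    push_cast at hg
    exact hfix g hg

end fourier
end U4H

namespace U4H
open USetting

section red
variable {F : Type u} [Field F] {T : USetting F (Fin 4 → F)}
  {F₀ : Type w} [Field F₀] [Algebra F₀ F] [FiniteDimensional F₀ F] {ψ₀ : F₀ → ℂ}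

lemma nilp_four {k : Type*} [Field k] {B : Matrix (Fin 4) (Fin 4) k} (h : IsNilpotent B) :
    B ^ 4 = 0 := by
  have h1 := Matrix.isNilpotent_charpoly_sub_pow_of_isNilpotent h
  have h2 := h1.eq_zero
  rw [sub_eq_zero, Fintype.card_fin] at h2
  have h3 := Matrix.aeval_self_charpoly B
  rw [h2, map_pow, Polynomial.aeval_X] at h3
  exact h3

lemma nonfund {p : Par} {n : ℕ} {β : Module.End F (Fin 4 → F)}
    (hβ : β ∈ T.aFil (LS T p) (-n)) (hf : ¬ T.IsFundamental (LS T p) n β) :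
    R T p (-n) β ^ 4 = 0 := by
  unfold IsFundamental at hf
  rw [not_not] at hf
  have hfr : Module.finrank F (Fin 4 → F) = 4 := by simp
  rw [hfr] at hf
  set y := T.ybeta (LS T p) n β with hy
  set b := ((LS T p).e / (Int.gcd (LS T p).e n : ℤ)).toNat with hb
  set a := ((n : ℤ) / (Int.gcd (LS T p).e n : ℤ)).toNat with ha
  have hee : (LS T p).e = p.e := rfl
  have hab : (b : ℤ) * n = a * p.e := by
    rw [hee] at hb ha
    have hgpos : 0 < (Int.gcd p.e n : ℤ) := by
      exact_mod_cast Int.gcd_pos_of_ne_zero_left _ p.he.ne'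
    obtain ⟨s, hs⟩ := Int.gcd_dvd_left p.e (n : ℤ)
    obtain ⟨t, ht⟩ := Int.gcd_dvd_right p.e (n : ℤ)
    have hs0 : 0 ≤ s := by
      by_contra hneg
      have := p.he
      rw [hs] at this
      nlinarith
    have ht0 : 0 ≤ t := by
      by_contra hneg
      have h0 : (0 : ℤ) ≤ n := Int.natCast_nonneg n
      rw [ht] at h0
      nlinarith
    have h1 : p.e / (Int.gcd p.e n : ℤ) = s := by
      conv_lhs => enter [1]; rw [hs]
      exact Int.mul_ediv_cancel_left _ hgpos.ne'
    have h2 : (n : ℤ) / (Int.gcd p.e n : ℤ) = t := by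
      conv_lhs => enter [1]; rw [ht]
      exact Int.mul_ediv_cancel_left _ hgpos.ne'
    rw [hb, ha, h1, h2, Int.toNat_of_nonneg hs0, Int.toNat_of_nonneg ht0]
    conv_lhs => rw [ht]
    conv_rhs => rw [hs]
    ring
  have hyd : y = T.ϖ ^ (a : ℤ) • β ^ b := by rw [zpow_natCast]; rfl
  have h0 : (0 : ℤ) = b * (-n) + a * p.e := by linarith
  have hya : y ∈ T.aFil (LS T p) 0 := by
    rw [hyd, h0]; exact smul_a (a_pow hβ b)
  have hyR : R T p 0 y = R T p (-n) β ^ b := by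
    rw [hyd, h0, R_smul, R_pow hβ]
  have hy4 : y ^ 4 ∈ T.aFil (LS T p) (0 + 1) := by
    have h1 := LinearMap.aeval_self_charpoly y
    rw [Polynomial.aeval_eq_sum_range, LinearMap.charpoly_natDegree, hfr, Finset.sum_range_succ] at h1
    have h2 : (LinearMap.charpoly y).coeff 4 = 1 := by
      have := LinearMap.charpoly_monic y
      rw [Polynomial.Monic, Polynomial.leadingCoeff, LinearMap.charpoly_natDegree, hfr] at this
      exact this
    rw [h2, one_smul] at h1
    have h3 : y ^ 4 = -∑ i ∈ Finset.range 4, (LinearMap.charpoly y).coeff i • y ^ i :=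
      eq_neg_of_add_eq_zero_right h1
    rw [h3]
    apply a_neg
    have : ∀ s : Finset ℕ, (∀ i ∈ s, i < 4) →
        ∑ i ∈ s, (LinearMap.charpoly y).coeff i • y ^ i ∈ T.aFil (LS T p) (0 + 1) := by
      intro s hs
      induction s using Finset.induction_on with
      | empty => rw [Finset.sum_empty]; exact a_zero _
      | insert i s hi ih =>
        rw [Finset.sum_insert hi]
        refine a_add _ ?_ (ih fun j hj => hs j (Finset.mem_insert_of_mem hj))
        obtain ⟨z, hz, hze⟩ := hf i (hs i (Finset.mem_insert_self _ _))
        rw [hze, mul_comm, mul_smul]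
        refine a_smul _ hz ?_
        have h5 := smul_a (k := 1) (a_pow hya i)
        rw [zpow_one] at h5
        exact a_anti _ (by have := p.he; simp; omega) h5
    exact this _ fun i hi => Finset.mem_range.1 hi
  have h6 := R_of_mem hy4
  have h7 := R_pow hya 4
  rw [mul_zero, h6, hyR, ← pow_mul] at h7
  exact nilp_four ⟨_, h7.symm⟩

variable {Wπ : Type*} [AddCommGroup Wπ] [Module ℂ Wπ] {π : T.GU →* Module.End ℂ Wπ}

/-- numerical condition for a reduction step -/
def okc (p p' : Par) (ρ ρ' : ℤ) (al : Fin 4 → Fin 4 → Bool) : Prop :=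
  ∀ i j, 1 ≤ (if al i j then p.y (-ρ) i j else p.y (1 - ρ) i j) + p'.y (ρ' + 1) j i ∧
    p.y ρ i j ≤ p'.y (ρ' + 1) i j

lemma y_shift (p : Par) (n q : ℤ) (i j : Fin 4) : p.y (n + p.e * q) i j = p.y n i j + q := by
  unfold Par.y
  rw [← cd_add_mul p.he]; congr 1; ring

lemma reduce (D : Dat T F₀ ψ₀) {p p' : Par} {n n' : ℕ} (q ρ ρ' : ℤ) (al : Fin 4 → Fin 4 → Bool)
    (hn : (n : ℤ) = ρ + p.e * q) (hn' : (n' : ℤ) = ρ' + p'.e * q) (hok : okc p p' ρ ρ' al)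
    {β : Module.End F (Fin 4 → F)} (hβ : β ∈ T.aFil (LS T p) (-n)) (he : Eig F₀ ψ₀ π p n β)
    (hz : ∀ i j, al i j = false → R T p (-n) β i j = 0) : Fix π p' n' := by
  obtain ⟨w, hw, he⟩ := he
  refine ⟨w, hw, fun g hg => ?_⟩
  have hg1 : T.toE g - 1 ∈ T.aFil (LS T p) n := by
    rw [mem_aFil] at *
    intro i j
    refine pw_anti T ?_ (hg i j)
    have := (hok i j).2
    rw [hn, hn', y_shift, show ρ' + p'.e * q + 1 = (ρ' + 1) + p'.e * q by ring, y_shift]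
    linarith
  rw [he g hg1, psi_eq, ph_one D, one_smul]
  rw [trace_eq, mat_mul]
  refine AddSubgroup.sum_mem _ fun i _ => ?_
  rw [Matrix.mul_apply]
  refine AddSubgroup.sum_mem _ fun j _ => ?_
  have h2 := (mem_aFil T).1 hg j i
  rw [hn', show ρ' + p'.e * q + 1 = (ρ' + 1) + p'.e * q by ring, y_shift] at h2
  have h3 := (hok i j).1
  cases hal : al i j with
  | true =>
    rw [hal, if_pos rfl] at h3
    have h4 := (mem_aFil T).1 hβ i j
    rw [hn, show -(ρ + p.e * q) = -ρ + p.e * (-q) by ring, y_shift] at h4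
    exact pw_anti T (by linarith) (pw_mul T h4 h2)
  | false =>
    rw [hal, if_neg (by simp)] at h3
    have h4 := R_zero_mem hβ (hz i j hal)
    rw [hn, show -(ρ + p.e * q) + 1 = (1 - ρ) + p.e * (-q) by ring, y_shift] at h4
    exact pw_anti T (by linarith) (pw_mul T h4 h2)

lemma R_supp {p : Par} {n : ℕ} {q ρ : ℤ} (hn : (n : ℤ) = ρ + p.e * q)
    {β : Module.End F (Fin 4 → F)} {i j : Fin 4} (h : ¬ p.e ∣ p.v (-ρ) i j) :
    R T p (-n) β i j = 0 := by
  apply R_of_not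
  intro hd
  apply h
  rw [hn, show p.v (-(ρ + p.e * q)) i j = p.v (-ρ) i j + p.e * (-q) by simp only [Par.v]; ring] at hd
  exact (Int.dvd_add_left (Dvd.intro _ rfl)).1 hd

lemma conj_eig (D : Dat T F₀ ψ₀) {p : Par} {n : ℕ}
    {β : Module.End F (Fin 4 → F)} (hβ : β ∈ T.aFil (LS T p) (-n)) (hs : β ∈ T.Aminus)
    (he : Eig F₀ ψ₀ π p n β) (g : T.GU) (hg : T.toE g ∈ T.aFil (LS T p) 0) :
    ∃ β' ∈ T.aFil (LS T p) (-n), β' ∈ T.Aminus ∧ Eig F₀ ψ₀ π p n β' ∧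
      ∃ M : Matrix (Fin 4) (Fin 4) (kk T), M * R T p 0 (T.toE g) = 1 ∧
        R T p 0 (T.toE g) * M = 1 ∧ R T p (-n) β' = M * R T p (-n) β * R T p 0 (T.toE g) := by
  have hg' : T.toE g⁻¹ ∈ T.aFil (LS T p) 0 := by rw [toE_inv]; exact D.H.σ_mem hg
  have h1 := a_mul _ hg' hβ
  have h2 := a_mul _ h1 hg
  rw [zero_add] at h1
  rw [zero_add, add_zero] at h2
  have e1 := R_mul hg' hβ
  have e2 := R_mul h1 hg
  rw [zero_add] at e1
  rw [add_zero, e1] at e2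
  refine ⟨_, h2, ?_, ?_, R T p 0 (T.toE g⁻¹), ?_, ?_, e2⟩
  · change T.σA _ = -_
    have hs' : T.σA β = -β := hs
    rw [T.σA_mul, T.σA_mul, hs', ← toE_inv, ← toE_inv, inv_inv, ← mul_assoc, e_mul_neg]
    ext i j; simp
  · obtain ⟨w, hw, he⟩ := he
    refine ⟨π g⁻¹ w, ?_, ?_⟩
    · intro h0
      apply hw
      have : π g (π g⁻¹ w) = w := by
        rw [← Module.End.mul_apply, ← map_mul, mul_inv_cancel, map_one]; rfl
      rw [← this, h0, map_zero]
    · intro x hx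
      have e3 : T.toE (g * x * g⁻¹) - 1 = T.toE g * (T.toE x - 1) * T.toE g⁻¹ := by
        rw [toE_mul, toE_mul, mul_sub, sub_mul, mul_one, toE_mul_inv]
      have e4 := he (g * x * g⁻¹) (by
        rw [e3]
        have := a_mul _ (a_mul _ hg hx) hg'
        rwa [zero_add, add_zero] at this)
      have e5 : π x (π g⁻¹ w) = π g⁻¹ (π (g * x * g⁻¹) w) := by
        rw [← Module.End.mul_apply, ← Module.End.mul_apply, ← map_mul, ← map_mul]
        congr 2; group
      rw [e5, e4, map_smul, psi_eq, psi_eq, e3]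
      congr 1
      unfold ph trA0
      congr 2
      rw [← mul_assoc, ← mul_assoc, LinearMap.trace_mul_comm]
      simp only [mul_assoc]
  · rw [← R_mul hg' hg, toE_inv_mul, add_zero, R_one]
  · rw [← R_mul hg hg', toE_mul_inv, add_zero, R_one]

/-! building elements of the group -/

lemma mkG (H : Hyp T) (M : Matrix (Fin 4) (Fin 4) F)
    (hM : (Matrix.of fun i j => T.ϖ ^ (hw j - hw i) * T.conj (M (st j) (st i))) * M = 1) :
    ∃ g : T.GU, mat (T.toE g) = M := by
  set X : Module.End F (Fin 4 → F) := Matrix.toLin' M with hX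
  have hm : mat X = M := LinearMap.toMatrix'_toLin' _
  have hσ : mat (T.σA X) = Matrix.of fun i j => T.ϖ ^ (hw j - hw i) * T.conj (M (st j) (st i)) := by
    ext i j; rw [H.mat_σ, hm]; rfl
  have h1 : T.σA X * X = 1 := by
    apply LinearMap.toMatrix'.injective
    change mat _ = mat _
    rw [mat_mul, hσ, hm, hM]; exact LinearMap.toMatrix'_one.symm
  have h2 : X * T.σA X = 1 := mul_eq_one_comm.1 h1
  exact ⟨⟨⟨X, T.σA X, h2, h1⟩, rfl⟩, hm⟩

lemma lift_iso (H : Hyp T) (a t : kk T) (h : t + cc H t + a * cc H a = 0) :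
    ∃ x ∈ T.O, ∃ z ∈ T.O, res T x = a ∧ res T z = t ∧ z + T.conj z + x * T.conj x = 0 := by
  obtain ⟨x, hx, hxa⟩ := res_surj a
  obtain ⟨z, hz, hzt⟩ := res_surj t
  have hx' := T.conj_O _ hx
  have hz' := T.conj_O _ hz
  have h2 : T.conj 2 = 2 := map_ofNat T.conj 2
  have h20 := H.two
  have hxx := T.O.mul_mem hx hx'
  have hm : (2 : F)⁻¹ * ((z - T.conj z) - x * T.conj x) ∈ T.O :=
    T.O.mul_mem H.two_inv (T.O.sub_mem (T.O.sub_mem hz hz') hxx)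
  refine ⟨x, hx, 2⁻¹ * ((z - T.conj z) - x * T.conj x), hm, hxa, ?_, ?_⟩
  · have h2O : (2 : F) ∈ T.O := by
      have := T.O.add_mem T.O.one_mem T.O.one_mem
      rwa [one_add_one_eq_two] at this
    have e2 : res T 2 = 2 := by
      rw [← one_add_one_eq_two, res_add T.O.one_mem T.O.one_mem, res_one, one_add_one_eq_two]
    have e1 : res T 2 * res T (2⁻¹ * ((z - T.conj z) - x * T.conj x)) =
        (t - cc H t) - a * cc H a := by
      rw [← res_mul h2O hm, mul_inv_cancel_left₀ h20, res_sub (T.O.sub_mem hz hz') hxx,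
        res_sub hz hz', res_mul hx hx', ← cc_res H hx, ← cc_res H hz, hxa, hzt]
    rw [e2] at e1
    have e3 : (2 : kk T) * res T (2⁻¹ * ((z - T.conj z) - x * T.conj x)) = 2 * t := by
      rw [e1]; linear_combination -h
    exact mul_left_cancel₀ (two_kk H) e3
  · simp only [map_mul, map_sub, map_inv₀, h2, T.conj_invol]
    field_simp; ring

end red
end U4H

namespace U4H
open USetting

section steps
variable {F : Type u} [Field F] {T : USetting F (Fin 4 → F)}
  {F₀ : Type w} [Field F₀] [Algebra F₀ F] [FiniteDimensional F₀ F] {ψ₀ : F₀ → ℂ}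
  {Wπ : Type*} [AddCommGroup Wπ] [Module ℂ Wπ] {π : T.GU →* Module.End ℂ Wπ}

def alv (l : List (Fin 4 × Fin 4)) (i j : Fin 4) : Bool := l.contains (i, j)

lemma p4 {k : Type*} [Field k] {b : Matrix (Fin 4) (Fin 4) k} (h : b ^ 4 = 0) (i j : Fin 4) :
    ∑ x, (∑ y, b i y * b y x) * (∑ y, b x y * b y j) = 0 := by
  have : (b * b) * (b * b) = 0 := by rw [← h, pow_succ, pow_succ, pow_succ, pow_one]; simp only [mul_assoc]
  have := congrFun (congrFun this i) j
  simpa only [Matrix.mul_apply, Matrix.zero_apply] using this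

structure Sta (π : T.GU →* Module.End ℂ Wπ) (F₀ : Type w) [Field F₀] [Algebra F₀ F] (ψ₀ : F₀ → ℂ) (p : Par) (n : ℕ)
    (β : Module.End F (Fin 4 → F)) : Prop where
  hβ : β ∈ T.aFil (LS T p) (-n)
  hs : β ∈ T.Aminus
  he : Eig F₀ ψ₀ π p n β
  h4 : R T p (-n) β ^ 4 = 0

lemma Sta.go (D : Dat T F₀ ψ₀) {p : Par} {n : ℕ} {β : Module.End F (Fin 4 → F)}
    (S : Sta π F₀ ψ₀ p n β) {q ρ : ℤ} (hn : (n : ℤ) = ρ + p.e * q) (p' : Par) {n' : ℕ} (ρ' : ℤ)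
    (l : List (Fin 4 × Fin 4)) (hn' : (n' : ℤ) = ρ' + p'.e * q) 
    (hok : okc p p' ρ ρ' (alv l))
    (hz : ∀ i j, p.e ∣ p.v (-ρ) i j → alv l i j = false → R T p (-n) β i j = 0) : Fix π p' n' := by
  refine reduce D q ρ ρ' (alv l) hn hn' hok S.hβ S.he fun i j h => ?_
  by_cases hd : p.e ∣ p.v (-ρ) i j
  · exact hz i j hd h
  · exact R_supp hn hd

lemma Sta.fin (D : Dat T F₀ ψ₀) {p : Par} {n : ℕ} {β : Module.End F (Fin 4 → F)}
    (S : Sta π F₀ ψ₀ p n β) {q ρ : ℤ} (hn : (n : ℤ) = ρ + p.e * q) (p' : Par) {n' : ℕ} (ρ' : ℤ)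
    (l dead : List (Fin 4 × Fin 4)) (hn' : (n' : ℤ) = ρ' + p'.e * q)
    (hok : okc p p' ρ ρ' (alv l))
    (hc : ∀ i j : Fin 4, p.e ∣ p.v (-ρ) i j → alv l i j = false → (i, j) ∈ dead)
    (hz : ∀ x ∈ dead, R T p (-n) β x.1 x.2 = 0) : Fix π p' n' :=
  S.go D hn p' ρ' l hn' hok fun i j h1 h2 => hz (i, j) (hc i j h1 h2)

lemma step31 (D : Dat T F₀ ψ₀) {q : ℕ} {β} (S : Sta π F₀ ψ₀ par3 (4 * q + 1) β) :
    Fix π par2 (2 * q + 0) ∨ Fix π par1 (2 * q + 0) := by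
  have hn : ((4 * q + 1 : ℕ) : ℤ) = 1 + par3.e * q := by simp [par3]; ring
  have h := p4 S.h4 0 0
  have sk := R_skew D.H S.hβ S.hs
  have sp := fun i j => R_supp (T := T) hn (β := β) (i := i) (j := j)
  set b := R T par3 (-((4 * q + 1 : ℕ) : ℤ)) β with hb
  have sA : b 0 1 = - cc D.H (b 1 3) := sk 0 1
  have sB : b 2 0 = - cc D.H (b 3 2) := sk 2 0
  simp only [Fin.sum_univ_four, sp 0 0 (by decide), sp 0 2 (by decide), sp 0 3 (by decide), sp 1 0 (by decide), sp 1 1 (by decide), sp 1 2 (by decide), sp 2 1 (by decide), sp 2 2 (by decide), sp 2 3 (by decide), sp 3 0 (by decide), sp 3 1 (by decide), sp 3 3 (by decide), sA, sB] at h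
  simp at h
  have h : b 3 2 = 0 ∨ b 1 3 = 0 := by tauto
  rcases h with h | h
  · left
    refine S.fin D hn par2 0 [(0, 1), (1, 3)] [(2, 0), (3, 2)] (by simp [par2]; try ring) (by unfold okc; decide) (by decide) ?_
    have h0 := sB
    rw [h, map_zero, neg_zero] at h0
    rw [← hb]
    simpa using ⟨h0, h⟩
  · right
    refine S.fin D hn par1 0 [(2, 0), (3, 2)] [(0, 1), (1, 3)] (by simp [par1]; try ring) (by unfold okc; decide) (by decide) ?_
    have h0 := sA
    rw [h, map_zero, neg_zero] at h0
    rw [← hb]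
    simpa using ⟨h0, h⟩

lemma step33 (D : Dat T F₀ ψ₀) {q : ℕ} {β} (S : Sta π F₀ ψ₀ par3 (4 * q + 3) β) :
    Fix π par5 (6 * q + 4) ∨ Fix π par4 (6 * q + 4) := by
  have hn : ((4 * q + 3 : ℕ) : ℤ) = 3 + par3.e * q := by simp [par3]; ring
  have h := p4 S.h4 0 0
  have sk := R_skew D.H S.hβ S.hs
  have sp := fun i j => R_supp (T := T) hn (β := β) (i := i) (j := j)
  set b := R T par3 (-((4 * q + 3 : ℕ) : ℤ)) β with hb
  have sA : b 0 2 = - cc D.H (b 2 3) := sk 0 2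
  have sB : b 1 0 = - cc D.H (b 3 1) := sk 1 0
  simp only [Fin.sum_univ_four, sp 0 0 (by decide), sp 0 1 (by decide), sp 0 3 (by decide), sp 1 1 (by decide), sp 1 2 (by decide), sp 1 3 (by decide), sp 2 0 (by decide), sp 2 1 (by decide), sp 2 2 (by decide), sp 3 0 (by decide), sp 3 2 (by decide), sp 3 3 (by decide), sA, sB] at h
  simp at h
  have h : b 3 1 = 0 ∨ b 2 3 = 0 := by tauto
  rcases h with h | h
  · left
    refine S.fin D hn par5 4 [(0, 2), (2, 3)] [(1, 0), (3, 1)] (by simp [par5]; try ring) (by unfold okc; decide) (by decide) ?_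
    have h0 := sB
    rw [h, map_zero, neg_zero] at h0
    rw [← hb]
    simpa using ⟨h0, h⟩
  · right
    refine S.fin D hn par4 4 [(1, 0), (3, 1)] [(0, 2), (2, 3)] (by simp [par4]; try ring) (by unfold okc; decide) (by decide) ?_
    have h0 := sA
    rw [h, map_zero, neg_zero] at h0
    rw [← hb]
    simpa using ⟨h0, h⟩

lemma step42 (D : Dat T F₀ ψ₀) {q : ℕ} {β} (S : Sta π F₀ ψ₀ par4 (6 * q + 2) β) :
    Fix π par1 (2 * q + 0) ∨ Fix π par3 (4 * q + 1) := by
  have hn : ((6 * q + 2 : ℕ) : ℤ) = 2 + par4.e * q := by simp [par4]; ring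
  have h := p4 S.h4 0 1
  have sk := R_skew D.H S.hβ S.hs
  have sp := fun i j => R_supp (T := T) hn (β := β) (i := i) (j := j)
  set b := R T par4 (-((6 * q + 2 : ℕ) : ℤ)) β with hb
  have sB : b 0 1 = - cc D.H (b 1 3) := sk 0 1
  simp only [Fin.sum_univ_four, sp 0 0 (by decide), sp 0 2 (by decide), sp 0 3 (by decide), sp 1 0 (by decide), sp 1 1 (by decide), sp 1 2 (by decide), sp 2 0 (by decide), sp 2 1 (by decide), sp 2 2 (by decide), sp 2 3 (by decide), sp 3 1 (by decide), sp 3 2 (by decide), sp 3 3 (by decide), sB] at h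
  simp at h
  have h : b 1 3 = 0 ∨ b 3 0 = 0 := by tauto
  rcases h with h | h
  · left
    refine S.fin D hn par1 0 [(3, 0)] [(0, 1), (1, 3)] (by simp [par1]; try ring) (by unfold okc; decide) (by decide) ?_
    have h0 := sB
    rw [h, map_zero, neg_zero] at h0
    rw [← hb]
    simpa using ⟨h0, h⟩
  · right
    refine S.fin D hn par3 1 [(0, 1), (1, 3)] [(3, 0)] (by simp [par3]; try ring) (by unfold okc; decide) (by decide) ?_
    rw [← hb]
    simpa using h

lemma step44 (D : Dat T F₀ ψ₀) {q : ℕ} {β} (S : Sta π F₀ ψ₀ par4 (6 * q + 4) β) :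
    Fix π par3 (4 * q + 2) ∨ Fix π par1 (2 * q + 1) := by
  have hn : ((6 * q + 4 : ℕ) : ℤ) = 4 + par4.e * q := by simp [par4]; ring
  have h := p4 S.h4 0 3
  have sk := R_skew D.H S.hβ S.hs
  have sp := fun i j => R_supp (T := T) hn (β := β) (i := i) (j := j)
  set b := R T par4 (-((6 * q + 4 : ℕ) : ℤ)) β with hb
  have sB : b 1 0 = - cc D.H (b 3 1) := sk 1 0
  simp only [Fin.sum_univ_four, sp 0 0 (by decide), sp 0 1 (by decide), sp 0 2 (by decide), sp 1 1 (by decide), sp 1 2 (by decide), sp 1 3 (by decide), sp 2 0 (by decide), sp 2 1 (by decide), sp 2 2 (by decide), sp 2 3 (by decide), sp 3 0 (by decide), sp 3 2 (by decide), sp 3 3 (by decide), sB] at h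
  simp at h
  have h : b 3 1 = 0 ∨ b 0 3 = 0 := by tauto
  rcases h with h | h
  · left
    refine S.fin D hn par3 2 [(0, 3)] [(1, 0), (3, 1)] (by simp [par3]; try ring) (by unfold okc; decide) (by decide) ?_
    have h0 := sB
    rw [h, map_zero, neg_zero] at h0
    rw [← hb]
    simpa using ⟨h0, h⟩
  · right
    refine S.fin D hn par1 1 [(1, 0), (3, 1)] [(0, 3)] (by simp [par1]; try ring) (by unfold okc; decide) (by decide) ?_
    rw [← hb]
    simpa using h

lemma step52 (D : Dat T F₀ ψ₀) {q : ℕ} {β} (S : Sta π F₀ ψ₀ par5 (6 * q + 2) β) :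
    Fix π par2 (2 * q + 0) ∨ Fix π par3 (4 * q + 1) := by
  have hn : ((6 * q + 2 : ℕ) : ℤ) = 2 + par5.e * q := by simp [par5]; ring
  have h := p4 S.h4 0 3
  have sk := R_skew D.H S.hβ S.hs
  have sp := fun i j => R_supp (T := T) hn (β := β) (i := i) (j := j)
  set b := R T par5 (-((6 * q + 2 : ℕ) : ℤ)) β with hb
  have sB : b 2 0 = - cc D.H (b 3 2) := sk 2 0
  simp only [Fin.sum_univ_four, sp 0 0 (by decide), sp 0 1 (by decide), sp 0 2 (by decide), sp 1 0 (by decide), sp 1 1 (by decide), sp 1 2 (by decide), sp 1 3 (by decide), sp 2 1 (by decide), sp 2 2 (by decide), sp 2 3 (by decide), sp 3 0 (by decide), sp 3 1 (by decide), sp 3 3 (by decide), sB] at h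
  simp at h
  have h : b 3 2 = 0 ∨ b 0 3 = 0 := by tauto
  rcases h with h | h
  · left
    refine S.fin D hn par2 0 [(0, 3)] [(2, 0), (3, 2)] (by simp [par2]; try ring) (by unfold okc; decide) (by decide) ?_
    have h0 := sB
    rw [h, map_zero, neg_zero] at h0
    rw [← hb]
    simpa using ⟨h0, h⟩
  · right
    refine S.fin D hn par3 1 [(2, 0), (3, 2)] [(0, 3)] (by simp [par3]; try ring) (by unfold okc; decide) (by decide) ?_
    rw [← hb]
    simpa using h

lemma step54 (D : Dat T F₀ ψ₀) {q : ℕ} {β} (S : Sta π F₀ ψ₀ par5 (6 * q + 4) β) :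
    Fix π par2 (2 * q + 1) ∨ Fix π par3 (4 * q + 2) := by
  have hn : ((6 * q + 4 : ℕ) : ℤ) = 4 + par5.e * q := by simp [par5]; ring
  have h := p4 S.h4 0 2
  have sk := R_skew D.H S.hβ S.hs
  have sp := fun i j => R_supp (T := T) hn (β := β) (i := i) (j := j)
  set b := R T par5 (-((6 * q + 4 : ℕ) : ℤ)) β with hb
  have sA : b 0 2 = - cc D.H (b 2 3) := sk 0 2
  simp only [Fin.sum_univ_four, sp 0 0 (by decide), sp 0 1 (by decide), sp 0 3 (by decide), sp 1 0 (by decide), sp 1 1 (by decide), sp 1 2 (by decide), sp 1 3 (by decide), sp 2 0 (by decide), sp 2 1 (by decide), sp 2 2 (by decide), sp 3 1 (by decide), sp 3 2 (by decide), sp 3 3 (by decide), sA] at h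
  simp at h
  have h : b 3 0 = 0 ∨ b 2 3 = 0 := by tauto
  rcases h with h | h
  · left
    refine S.fin D hn par2 1 [(0, 2), (2, 3)] [(3, 0)] (by simp [par2]; try ring) (by unfold okc; decide) (by decide) ?_
    rw [← hb]
    simpa using h
  · right
    refine S.fin D hn par3 2 [(3, 0)] [(0, 2), (2, 3)] (by simp [par3]; try ring) (by unfold okc; decide) (by decide) ?_
    have h0 := sA
    rw [h, map_zero, neg_zero] at h0
    rw [← hb]
    simpa using ⟨h0, h⟩

lemma step32 (D : Dat T F₀ ψ₀) {q : ℕ} {β} (S : Sta π F₀ ψ₀ par3 (4 * q + 2) β) :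
    Fix π par5 (6 * q + 2) ∨ Fix π par4 (6 * q + 2) := by
  have hn : ((4 * q + 2 : ℕ) : ℤ) = 2 + par3.e * q := by simp [par3]; ring
  have h := p4 S.h4 0 0
  have h' := p4 S.h4 1 1
  have sk := R_skew D.H S.hβ S.hs
  have sp := fun i j => R_supp (T := T) hn (β := β) (i := i) (j := j)
  set b := R T par3 (-((4 * q + 2 : ℕ) : ℤ)) β with hb
  have sA : b 1 2 = - cc D.H (b 2 1) := sk 1 2
  simp only [Fin.sum_univ_four, sp 0 0 (by decide), sp 0 1 (by decide), sp 0 2 (by decide), sp 1 0 (by decide), sp 1 1 (by decide), sp 1 3 (by decide), sp 2 0 (by decide), sp 2 2 (by decide), sp 2 3 (by decide), sp 3 1 (by decide), sp 3 2 (by decide), sp 3 3 (by decide), sA] at h h'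
  simp at h h'
  have h0 := sA
  rw [h', map_zero, neg_zero] at h0
  rcases h with h | h
  · right
    refine S.fin D hn par4 2 [(3, 0)] [(0, 3), (1, 2), (2, 1)] (by simp [par4]; try ring) (by unfold okc; decide) (by decide) ?_
    rw [← hb]
    simpa using ⟨h, h0, h'⟩
  · left
    refine S.fin D hn par5 2 [(0, 3)] [(3, 0), (1, 2), (2, 1)] (by simp [par5]; try ring) (by unfold okc; decide) (by decide) ?_
    rw [← hb]
    simpa using ⟨h, h0, h'⟩

end steps
end U4H

namespace U4H
open USetting

section vert
variable {F : Type u} [Field F] {T : USetting F (Fin 4 → F)}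

lemma vc1 (H : Hyp T) (u : Fin 4 → kk T) (h1 : u 1 = 0) (hu : u ≠ 0)
    (hi : cc H (u 0) * u 3 + cc H (u 2) * u 2 + cc H (u 3) * u 0 = 0) :
    ∃ g : T.GU, T.toE g ∈ T.aFil (LS T par1) 0 ∧ ∃ s, s ≠ 0 ∧
      ∀ i, R T par1 0 (T.toE g) i 0 = s * u i := by
  by_cases h3 : u 3 = 0
  · have h2 : u 2 = 0 := by
      rw [h3] at hi; simpa using hi
    have h0 : u 0 ≠ 0 := fun h0 => hu (by ext i; fin_cases i <;> simp [*])
    refine ⟨1, a_one _, (u 0)⁻¹, inv_ne_zero h0, fun i => ?_⟩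
    have : T.toE 1 = 1 := rfl
    rw [this, R_one]
    fin_cases i <;> simp [h0, h1, h2, h3]
    rfl
  · have h3' : cc H (u 3) ≠ 0 := by rwa [Ne, cc_eq_zero]
    obtain ⟨x, hx, z, hz, hxa, hzt, e⟩ := lift_iso H (u 2 / u 3) (u 0 / u 3) (by
      rw [map_div₀, map_div₀]; field_simp; linear_combination hi)
    obtain ⟨g, hg⟩ := mkG H !![z, 0, -T.conj x, 1; 0, 1, 0, 0; x, 0, 1, 0; 1, 0, 0, 0] (by
      ext i j
      rw [Matrix.mul_apply, Fin.sum_univ_four]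
      have := T.ϖ_ne_zero
      fin_cases i <;> fin_cases j <;> simp [st, hw, T.conj_invol]
      linear_combination e)
    refine ⟨g, ?_, (u 3)⁻¹, inv_ne_zero h3, fun i => ?_⟩
    · rw [mem_aFil, hg]
      intro i j
      have hxc := T.conj_O _ hx
      fin_cases i <;> fin_cases j <;> simp [Par.y, par1, cd, mem_pw0, hx, hz, hxc, T.O.one_mem, T.O.zero_mem, T.O.neg_mem, AddSubgroup.zero_mem]
    · have := hg
      by_cases hd : par1.e ∣ par1.v 0 i 0
      · rw [R_of_dvd hd, hg]
        fin_cases i <;> simp [Par.v, par1, hxa, hzt, h3, res_one] at hd ⊢ <;> field_simp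
      · rw [R_of_not hd]
        fin_cases i <;> simp [Par.v, par1, h1] at hd ⊢

lemma vc2 (H : Hyp T) (u : Fin 4 → kk T) (h1 : u 2 = 0) (hu : u ≠ 0)
    (hi : cc H (u 0) * u 3 + cc H (u 1) * u 1 + cc H (u 3) * u 0 = 0) :
    ∃ g : T.GU, T.toE g ∈ T.aFil (LS T par2) 0 ∧ ∃ s, s ≠ 0 ∧
      ∀ i, R T par2 0 (T.toE g) i 3 = s * u i := by
  by_cases h3 : u 0 = 0
  · have h2 : u 1 = 0 := by
      rw [h3] at hi; simpa using hi
    have h0 : u 3 ≠ 0 := fun h0 => hu (by ext i; fin_cases i <;> simp [*])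
    refine ⟨1, a_one _, (u 3)⁻¹, inv_ne_zero h0, fun i => ?_⟩
    have : T.toE 1 = 1 := rfl
    rw [this, R_one]
    fin_cases i <;> simp [h0, h1, h2, h3]
    rfl
  · have h3' : cc H (u 0) ≠ 0 := by rwa [Ne, cc_eq_zero]
    obtain ⟨x, hx, z, hz, hxa, hzt, e⟩ := lift_iso H (u 1 / u 0) (u 3 / u 0) (by
      rw [map_div₀, map_div₀]; field_simp; linear_combination hi)
    have hϖ := T.ϖ_ne_zero
    obtain ⟨g, hg⟩ := mkG H !![0, 0, 0, T.ϖ⁻¹; 0, 1, 0, x * T.ϖ⁻¹; 0, 0, 1, 0; T.ϖ, -T.conj x * T.ϖ, 0, z] (by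
      ext i j
      rw [Matrix.mul_apply, Fin.sum_univ_four]
      fin_cases i <;> fin_cases j <;> simp [st, hw, T.conj_invol, H.conjϖ, hϖ] <;> field_simp
      all_goals first | linear_combination e | ring)
    refine ⟨g, ?_, (u 0)⁻¹, inv_ne_zero h3, fun i => ?_⟩
    · rw [mem_aFil, hg]
      intro i j
      have hxc := T.conj_O _ hx
      fin_cases i <;> fin_cases j <;> simp [Par.y, par2, cd, mem_pw0, hx, hz, hxc, T.O.one_mem, T.O.zero_mem, T.O.neg_mem, AddSubgroup.zero_mem]
      · have := zpow_mem_pw T (le_refl (-1)); rwa [zpow_neg_one] at this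
      · rw [mul_comm, ← zpow_neg_one, zpow_mul_mem, sub_self, mem_pw0]; exact hx
      · have := zpow_mem_pw T (le_refl 1); rwa [zpow_one] at this
      · have := zpow_mul_mem T (a := 1) (b := 1) (x := T.conj x)
        rw [zpow_one, sub_self, mem_pw0, mul_comm] at this
        exact this.2 hxc
    · have := hg
      by_cases hd : par2.e ∣ par2.v 0 i 3
      · rw [R_of_dvd hd, hg]
        fin_cases i <;> simp [Par.v, par2, hxa, hzt, h3, res_one] at hd ⊢ 
        · rw [mul_inv_cancel₀ hϖ, res_one]
        · rw [mul_left_comm, mul_inv_cancel₀ hϖ, mul_one, hxa, div_eq_inv_mul]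
        · rw [div_eq_inv_mul]
      · rw [R_of_not hd]
        fin_cases i <;> simp [Par.v, par2, h1] at hd ⊢


lemma skew_sum {k : Type*} [AddCommMonoid k] (f : Fin 4 → k) : ∑ m, f (st m) = ∑ m, f m :=
  Equiv.sum_comp ⟨st, st, st_st, st_st⟩ f

lemma even_aux {k : Type*} [Field k] (c : k →+* k) {b C E : Matrix (Fin 4) (Fin 4) k} {ε : k}
    (h0 : C ≠ 0) (hbC : b * C = 0) (hCC : C * C = 0) (hE : C = b * E)
    (hc : ∀ i j, c (C (st j) (st i)) = ε * C i j) :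
    ∃ u : Fin 4 → k, u ≠ 0 ∧ (∀ i, ∑ j, b i j * u j = 0) ∧
      ∑ i, c (u (st i)) * u i = 0 ∧ ∀ i, (∀ j, b i j = 0) → u i = 0 := by
  obtain ⟨l, hl⟩ : ∃ l, (fun i => C i l) ≠ 0 := by
    by_contra h
    push Not at h
    apply h0
    ext i j
    exact congrFun (h j) i
  refine ⟨_, hl, fun i => ?_, ?_, fun i hi => ?_⟩
  · have := congrFun (congrFun hbC i) l
    rwa [Matrix.mul_apply] at this
  · have : ∀ i, c (C (st i) l) * C i l = ε * (C (st l) i * C i l) := by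
      intro i
      have := hc (st l) i
      rw [st_st] at this
      rw [this]; ring
    simp only [this]
    rw [← Finset.mul_sum, ← Matrix.mul_apply, hCC]; simp
  · change C i l = 0
    rw [hE, Matrix.mul_apply]
    simp [hi]

lemma even_u {k : Type*} [Field k] (c : k →+* k) {b : Matrix (Fin 4) (Fin 4) k}
    (h4 : b ^ 4 = 0) (h0 : b ≠ 0) (sk : ∀ i j, b i j = - c (b (st j) (st i))) :
    ∃ u : Fin 4 → k, u ≠ 0 ∧ (∀ i, ∑ j, b i j * u j = 0) ∧
      ∑ i, c (u (st i)) * u i = 0 ∧ ∀ i, (∀ j, b i j = 0) → u i = 0 := by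
  have s1 : ∀ i j, c (b (st j) (st i)) = - b i j := fun i j => by rw [sk i j, neg_neg]
  have s2 : ∀ i j, c ((b * b) (st j) (st i)) = (b * b) i j := fun i j => by
    rw [Matrix.mul_apply, ← skew_sum, map_sum, Matrix.mul_apply]
    refine Finset.sum_congr rfl fun m _ => ?_
    rw [map_mul, s1, s1]; ring
  have s3 : ∀ i j, c ((b * (b * b)) (st j) (st i)) = -(b * (b * b)) i j := fun i j => by
    rw [← mul_assoc b b b, Matrix.mul_apply, ← skew_sum, map_sum, mul_assoc b b b, Matrix.mul_apply, ← Finset.sum_neg_distrib]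
    refine Finset.sum_congr rfl fun m _ => ?_
    rw [map_mul, s1, s2]; ring
  have e4 : b * (b * (b * b)) = 0 := by
    rw [← h4, pow_succ, pow_succ, pow_succ, pow_one]; simp only [mul_assoc]
  by_cases h2 : b * b = 0
  · exact even_aux c h0 h2 h2 (mul_one b).symm (ε := -1) (fun i j => by rw [s1]; ring)
  by_cases h3 : b * (b * b) = 0
  · exact even_aux c h2 h3 (by rw [mul_assoc, h3, mul_zero]) rfl (ε := 1)
      (fun i j => by rw [s2]; ring)
  · exact even_aux c h3 e4 (by rw [mul_assoc, mul_assoc, e4, mul_zero, mul_zero]) rfl (ε := -1)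
      (fun i j => by rw [s3]; ring)

lemma conj_mat {k : Type*} [Field k] {b b' M N : Matrix (Fin 4) (Fin 4) k} (m2 : N * M = 1)
    (h4 : b ^ 4 = 0) (hR : b' = M * b * N) : b' ^ 4 = 0 := by
  have e4 : M * (b ^ 4) * N = 0 := by rw [h4, mul_zero, zero_mul]
  rw [hR, ← e4]
  have e : ∀ X : Matrix (Fin 4) (Fin 4) k, N * (M * X) = X := fun X => by
    rw [← mul_assoc, m2, one_mul]
  simp only [mul_assoc, e, pow_succ, pow_zero, one_mul]

lemma conj_col {k : Type*} [Field k] {b b' M N : Matrix (Fin 4) (Fin 4) k}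
    (hR : b' = M * b * N) {u : Fin 4 → k} (hu : ∀ i, ∑ j, b i j * u j = 0) {l : Fin 4} {s : k}
    (hgs : ∀ i, N i l = s * u i) (i : Fin 4) : b' i l = 0 := by
  rw [hR, mul_assoc, Matrix.mul_apply]
  refine Finset.sum_eq_zero fun j _ => ?_
  have : (b * N) j l = 0 := by
    rw [Matrix.mul_apply]
    simp only [hgs]
    have : ∀ x, b j x * (s * u x) = s * (b j x * u x) := fun x => by ring
    simp only [this]
    rw [← Finset.mul_sum, hu, mul_zero]
  rw [this, mul_zero]

variable {F₀ : Type w} [Field F₀] [Algebra F₀ F] [FiniteDimensional F₀ F] {ψ₀ : F₀ → ℂ}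
  {Wπ : Type*} [AddCommGroup Wπ] [Module ℂ Wπ] {π : T.GU →* Module.End ℂ Wπ}

lemma conj_zero (D : Dat T F₀ ψ₀) {p : Par} {n : ℕ} {β : Module.End F (Fin 4 → F)}
    (S : Sta π F₀ ψ₀ p n β) {u : Fin 4 → kk T} (hu : ∀ i, ∑ j, R T p (-n) β i j * u j = 0)
    {l : Fin 4} (hg : ∃ g : T.GU, T.toE g ∈ T.aFil (LS T p) 0 ∧ ∃ s, s ≠ 0 ∧
      ∀ i, R T p 0 (T.toE g) i l = s * u i) :
    ∃ β', Sta π F₀ ψ₀ p n β' ∧ (∀ i, R T p (-n) β' i l = 0) ∧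
      ∀ j, R T p (-n) β' (st l) j = 0 := by
  obtain ⟨g, hg, s, -, hgs⟩ := hg
  obtain ⟨β', h1, h2, h3, M, m1, m2, hR⟩ := conj_eig D S.hβ S.hs S.he g hg
  have hz := conj_col hR hu hgs
  refine ⟨β', ⟨h1, h2, h3, conj_mat m2 S.h4 hR⟩, hz, fun j => ?_⟩
  rw [R_skew D.H h1 h2, st_st, hz, map_zero, neg_zero]

lemma Sta.zero (D : Dat T F₀ ψ₀) {p : Par} {n : ℕ} {β : Module.End F (Fin 4 → F)}
    (S : Sta π F₀ ψ₀ p n β) {q ρ : ℤ} (hn : (n : ℤ) = ρ + p.e * q) (p' : Par) {n' : ℕ} (ρ' : ℤ)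
    (l : List (Fin 4 × Fin 4)) (hn' : (n' : ℤ) = ρ' + p'.e * q)
    (hok : okc p p' ρ ρ' (alv l)) (h : R T p (-n) β = 0) : Fix π p' n' :=
  S.go D hn p' ρ' l hn' hok fun i j _ _ => by rw [h]; rfl

lemma step10 (D : Dat T F₀ ψ₀) {q : ℕ} {β} (S : Sta π F₀ ψ₀ par1 (2 * (q + 1)) β) :
    Fix π par3 (4 * q + 3) := by
  have hn : ((2 * (q + 1) : ℕ) : ℤ) = 0 + par1.e * ((q : ℤ) + 1) := by simp [par1]
  have hn' : ((4 * q + 3 : ℕ) : ℤ) = -1 + par3.e * ((q : ℤ) + 1) := by simp [par3]; ring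
  have hok : okc par1 par3 0 (-1) (alv [(0, 2), (0, 3), (2, 3)]) := by unfold okc; decide
  by_cases hb0 : R T par1 (-((2 * (q + 1) : ℕ) : ℤ)) β = 0
  · exact S.zero D hn par3 (-1) _ hn' hok hb0
  have sp := fun (β : Module.End F (Fin 4 → F)) i j => R_supp (T := T) hn (β := β) (i := i) (j := j)
  have key : ∀ β, Sta π F₀ ψ₀ par1 (2 * (q + 1)) β → R T par1 (-((2 * (q + 1) : ℕ) : ℤ)) β 1 1 = 0 := by
    intro β S
    have h := p4 S.h4 1 1
    simp only [Fin.sum_univ_four, sp β 1 0 (by decide), sp β 1 2 (by decide), sp β 1 3 (by decide)] at h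
    simpa using h
  obtain ⟨u, hu, hbu, hi, hr⟩ := even_u (cc D.H) S.h4 hb0 (R_skew D.H S.hβ S.hs)
  have hu1 : u 1 = 0 := hr 1 fun j => by
    fin_cases j
    · exact sp β 1 0 (by decide)
    · exact key β S
    · exact sp β 1 2 (by decide)
    · exact sp β 1 3 (by decide)
  obtain ⟨β', S', hc, hr'⟩ := conj_zero D S hbu (vc1 D.H u hu1 hu (by
    rw [Fin.sum_univ_four] at hi
    simp only [st] at hi
    simp [hu1] at hi
    linear_combination hi))
  have h11 := key β' S'
  have h := p4 S'.h4 2 2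
  have r3 : ∀ j, R T par1 (-((2 * (q + 1) : ℕ) : ℤ)) β' 3 j = 0 := hr'
  simp only [Fin.sum_univ_four, sp β' 2 1 (by decide), hc, r3] at h
  simp at h
  refine S'.fin D hn par3 (-1) _ [(0,0),(1,1),(2,0),(2,2),(3,0),(3,2),(3,3)] hn' hok (by decide) ?_
  simp only [List.mem_cons, List.not_mem_nil, or_false]
  rintro x (rfl | rfl | rfl | rfl | rfl | rfl | rfl)
  · exact hc _
  · exact h11
  · exact hc _
  · simpa using h
  · exact hc _
  · exact r3 _
  · exact r3 _

lemma step20 (D : Dat T F₀ ψ₀) {q : ℕ} {β} (S : Sta π F₀ ψ₀ par2 (2 * (q + 1)) β) :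
    Fix π par3 (4 * q + 3) := by
  have hn : ((2 * (q + 1) : ℕ) : ℤ) = 0 + par2.e * ((q : ℤ) + 1) := by simp [par2]
  have hn' : ((4 * q + 3 : ℕ) : ℤ) = -1 + par3.e * ((q : ℤ) + 1) := by simp [par3]; ring
  have hok : okc par2 par3 0 (-1) (alv [(3, 1), (3, 0), (1, 0)]) := by unfold okc; decide
  by_cases hb0 : R T par2 (-((2 * (q + 1) : ℕ) : ℤ)) β = 0
  · exact S.zero D hn par3 (-1) _ hn' hok hb0
  have sp := fun (β : Module.End F (Fin 4 → F)) i j => R_supp (T := T) hn (β := β) (i := i) (j := j)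
  have key : ∀ β, Sta π F₀ ψ₀ par2 (2 * (q + 1)) β → R T par2 (-((2 * (q + 1) : ℕ) : ℤ)) β 2 2 = 0 := by
    intro β S
    have h := p4 S.h4 2 2
    simp only [Fin.sum_univ_four, sp β 2 0 (by decide), sp β 2 1 (by decide), sp β 2 3 (by decide)] at h
    simpa using h
  obtain ⟨u, hu, hbu, hi, hr⟩ := even_u (cc D.H) S.h4 hb0 (R_skew D.H S.hβ S.hs)
  have hu1 : u 2 = 0 := hr 2 fun j => by
    fin_cases j
    · exact sp β 2 0 (by decide)
    · exact sp β 2 1 (by decide)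
    · exact key β S
    · exact sp β 2 3 (by decide)
  obtain ⟨β', S', hc, hr'⟩ := conj_zero D S hbu (vc2 D.H u hu1 hu (by
    rw [Fin.sum_univ_four] at hi
    simp only [st] at hi
    simp [hu1] at hi
    linear_combination hi))
  have h11 := key β' S'
  have h := p4 S'.h4 1 1
  have r3 : ∀ j, R T par2 (-((2 * (q + 1) : ℕ) : ℤ)) β' 0 j = 0 := hr'
  simp only [Fin.sum_univ_four, sp β' 1 2 (by decide), hc, r3] at h
  simp at h
  refine S'.fin D hn par3 (-1) _ [(0,0),(2,2),(0,1),(1,1),(0,3),(1,3),(3,3)] hn' hok (by decide) ?_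
  simp only [List.mem_cons, List.not_mem_nil, or_false]
  rintro x (rfl | rfl | rfl | rfl | rfl | rfl | rfl)
  · exact r3 _
  · exact h11
  · exact r3 _
  · simpa using h
  · exact hc _
  · exact hc _
  · exact hc _

lemma step11 (D : Dat T F₀ ψ₀) {q : ℕ} {β} (S : Sta π F₀ ψ₀ par1 (2 * q + 1) β) :
    Fix π par4 (6 * q + 2) := by
  have hn : ((2 * q + 1 : ℕ) : ℤ) = 1 + par1.e * (q : ℤ) := by simp [par1]; ring
  have hn' : ((6 * q + 2 : ℕ) : ℤ) = 2 + par4.e * (q : ℤ) := by simp [par4]; ring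
  have hok : okc par1 par4 1 2 (alv [(0, 1), (1, 3)]) := by unfold okc; decide
  have sp := fun (β : Module.End F (Fin 4 → F)) i j => R_supp (T := T) hn (β := β) (i := i) (j := j)
  have key : ∀ β, Sta π F₀ ψ₀ par1 (2 * q + 1) β →
      ∑ j, R T par1 (-((2 * q + 1 : ℕ) : ℤ)) β 1 j * R T par1 (-((2 * q + 1 : ℕ) : ℤ)) β j 1 = 0 := by
    intro β S
    have h := p4 S.h4 1 1
    simp only [Fin.sum_univ_four, sp β 0 0 (by decide), sp β 0 2 (by decide), sp β 0 3 (by decide), sp β 1 1 (by decide), sp β 2 0 (by decide), sp β 2 2 (by decide), sp β 2 3 (by decide), sp β 3 0 (by decide), sp β 3 2 (by decide), sp β 3 3 (by decide)] at h ⊢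
    simpa using h
  have sk := R_skew D.H S.hβ S.hs
  by_cases hu : (fun i => R T par1 (-((2 * q + 1 : ℕ) : ℤ)) β i 1) = 0
  · apply S.zero D hn par4 2 _ hn' hok
    have hc : ∀ i, R T par1 (-((2 * q + 1 : ℕ) : ℤ)) β i 1 = 0 := fun i => congrFun hu i
    have hr : ∀ i, R T par1 (-((2 * q + 1 : ℕ) : ℤ)) β 1 i = 0 := fun i => by
      have := sk 1 i
      rwa [show st 1 = 1 from rfl, hc, map_zero, neg_zero] at this
    ext i j
    fin_cases i <;> fin_cases j <;> first | exact hc _ | exact hr _ | exact sp _ _ _ (by decide)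
  obtain ⟨β', S', hc, hr'⟩ := conj_zero D S (u := fun i => R T par1 (-((2 * q + 1 : ℕ) : ℤ)) β i 1) (fun i => by
      have hk := key β S
      by_cases hi : i = 1
      · rw [hi]; exact hk
      · refine Finset.sum_eq_zero fun j _ => ?_
        by_cases hj : j = 1
        · rw [hj, sp β 1 1 (by decide), mul_zero]
        · have h0 : R T par1 (-((2 * q + 1 : ℕ) : ℤ)) β i j = 0 := sp β i j (by revert i j; decide)
          rw [h0, zero_mul])
    (vc1 D.H _ (sp β 1 1 (by decide)) hu (by
      have hk := key β S
      have s0 : R T par1 (-((2 * q + 1 : ℕ) : ℤ)) β 1 0 = - cc D.H (R T par1 (-((2 * q + 1 : ℕ) : ℤ)) β 3 1) := sk 1 0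
      have s1 : R T par1 (-((2 * q + 1 : ℕ) : ℤ)) β 1 2 = - cc D.H (R T par1 (-((2 * q + 1 : ℕ) : ℤ)) β 2 1) := sk 1 2
      have s3 : R T par1 (-((2 * q + 1 : ℕ) : ℤ)) β 1 3 = - cc D.H (R T par1 (-((2 * q + 1 : ℕ) : ℤ)) β 0 1) := sk 1 3
      have s2 : R T par1 (-((2 * q + 1 : ℕ) : ℤ)) β 1 1 = 0 := sp β 1 1 (by decide)
      rw [Fin.sum_univ_four, s0, s1, s3, s2] at hk
      linear_combination -hk))
  have h := key β' S'
  have r3 : ∀ j, R T par1 (-((2 * q + 1 : ℕ) : ℤ)) β' 3 j = 0 := hr'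
  have s1 : R T par1 (-((2 * q + 1 : ℕ) : ℤ)) β' 1 2 = - cc D.H (R T par1 (-((2 * q + 1 : ℕ) : ℤ)) β' 2 1) := R_skew D.H S'.hβ S'.hs 1 2
  simp only [Fin.sum_univ_four, sp β' 1 1 (by decide), hc, r3, s1] at h
  simp at h
  have ha : R T par1 (-((2 * q + 1 : ℕ) : ℤ)) β' 2 1 = 0 := by simpa using h
  have hb : R T par1 (-((2 * q + 1 : ℕ) : ℤ)) β' 1 2 = 0 := by rw [s1, ha, map_zero, neg_zero]
  refine S'.fin D hn par4 2 _ [(1, 0), (3, 1), (2, 1), (1, 2)] hn' hok (by decide) ?_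
  simp only [List.mem_cons, List.not_mem_nil, or_false]
  rintro x (rfl | rfl | rfl | rfl)
  · exact hc _
  · exact r3 _
  · exact ha
  · exact hb

lemma step21 (D : Dat T F₀ ψ₀) {q : ℕ} {β} (S : Sta π F₀ ψ₀ par2 (2 * q + 1) β) :
    Fix π par5 (6 * q + 2) := by
  have hn : ((2 * q + 1 : ℕ) : ℤ) = 1 + par2.e * (q : ℤ) := by simp [par2]; ring
  have hn' : ((6 * q + 2 : ℕ) : ℤ) = 2 + par5.e * (q : ℤ) := by simp [par5]; ring
  have hok : okc par2 par5 1 2 (alv [(3, 2), (2, 0)]) := by unfold okc; decide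
  have sp := fun (β : Module.End F (Fin 4 → F)) i j => R_supp (T := T) hn (β := β) (i := i) (j := j)
  have key : ∀ β, Sta π F₀ ψ₀ par2 (2 * q + 1) β →
      ∑ j, R T par2 (-((2 * q + 1 : ℕ) : ℤ)) β 2 j * R T par2 (-((2 * q + 1 : ℕ) : ℤ)) β j 2 = 0 := by
    intro β S
    have h := p4 S.h4 2 2
    simp only [Fin.sum_univ_four, sp β 0 0 (by decide), sp β 0 1 (by decide), sp β 0 3 (by decide), sp β 1 0 (by decide), sp β 1 1 (by decide), sp β 1 3 (by decide), sp β 2 2 (by decide), sp β 3 0 (by decide), sp β 3 1 (by decide), sp β 3 3 (by decide)] at h ⊢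
    simpa using h
  have sk := R_skew D.H S.hβ S.hs
  by_cases hu : (fun i => R T par2 (-((2 * q + 1 : ℕ) : ℤ)) β i 2) = 0
  · apply S.zero D hn par5 2 _ hn' hok
    have hc : ∀ i, R T par2 (-((2 * q + 1 : ℕ) : ℤ)) β i 2 = 0 := fun i => congrFun hu i
    have hr : ∀ i, R T par2 (-((2 * q + 1 : ℕ) : ℤ)) β 2 i = 0 := fun i => by
      have := sk 2 i
      rwa [show st 2 = 2 from rfl, hc, map_zero, neg_zero] at this
    ext i j
    fin_cases i <;> fin_cases j <;> first | exact hc _ | exact hr _ | exact sp _ _ _ (by decide)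
  obtain ⟨β', S', hc, hr'⟩ := conj_zero D S (u := fun i => R T par2 (-((2 * q + 1 : ℕ) : ℤ)) β i 2) (fun i => by
      have hk := key β S
      by_cases hi : i = 2
      · rw [hi]; exact hk
      · refine Finset.sum_eq_zero fun j _ => ?_
        by_cases hj : j = 2
        · rw [hj, sp β 2 2 (by decide), mul_zero]
        · have h0 : R T par2 (-((2 * q + 1 : ℕ) : ℤ)) β i j = 0 := sp β i j (by revert i j; decide)
          rw [h0, zero_mul])
    (vc2 D.H _ (sp β 2 2 (by decide)) hu (by
      have hk := key β S
      have s0 : R T par2 (-((2 * q + 1 : ℕ) : ℤ)) β 2 0 = - cc D.H (R T par2 (-((2 * q + 1 : ℕ) : ℤ)) β 3 2) := sk 2 0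
      have s1 : R T par2 (-((2 * q + 1 : ℕ) : ℤ)) β 2 1 = - cc D.H (R T par2 (-((2 * q + 1 : ℕ) : ℤ)) β 1 2) := sk 2 1
      have s3 : R T par2 (-((2 * q + 1 : ℕ) : ℤ)) β 2 3 = - cc D.H (R T par2 (-((2 * q + 1 : ℕ) : ℤ)) β 0 2) := sk 2 3
      have s2 : R T par2 (-((2 * q + 1 : ℕ) : ℤ)) β 2 2 = 0 := sp β 2 2 (by decide)
      rw [Fin.sum_univ_four, s0, s1, s3, s2] at hk
      linear_combination -hk))
  have h := key β' S'
  have r3 : ∀ j, R T par2 (-((2 * q + 1 : ℕ) : ℤ)) β' 0 j = 0 := hr'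
  have s1 : R T par2 (-((2 * q + 1 : ℕ) : ℤ)) β' 2 1 = - cc D.H (R T par2 (-((2 * q + 1 : ℕ) : ℤ)) β' 1 2) := R_skew D.H S'.hβ S'.hs 2 1
  simp only [Fin.sum_univ_four, sp β' 2 2 (by decide), hc, r3, s1] at h
  simp at h
  have ha : R T par2 (-((2 * q + 1 : ℕ) : ℤ)) β' 1 2 = 0 := by simpa using h
  have hb : R T par2 (-((2 * q + 1 : ℕ) : ℤ)) β' 2 1 = 0 := by rw [s1, ha, map_zero, neg_zero]
  refine S'.fin D hn par5 2 _ [(2, 3), (0, 2), (1, 2), (2, 1)] hn' hok (by decide) ?_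
  simp only [List.mem_cons, List.not_mem_nil, or_false]
  rintro x (rfl | rfl | rfl | rfl)
  · exact hc _
  · exact r3 _
  · exact ha
  · exact hb

end vert
end U4H

namespace U4H
open USetting

section fin
variable {F : Type u} [Field F] {T : USetting F (Fin 4 → F)}
  {F₀ : Type w} [Field F₀] [Algebra F₀ F] [FiniteDimensional F₀ F] {ψ₀ : F₀ → ℂ}
  {Wπ : Type*} [AddCommGroup Wπ] [Module ℂ Wπ] {π : T.GU →* Module.End ℂ Wπ}

def Cls (T : USetting F (Fin 4 → F)) (Λ : T.LatSeq) (n : ℤ) : Prop :=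
  ((T.IsLam1 Λ ∨ T.IsLam2 Λ ∨ T.IsLam3 Λ ∨ T.IsLam4 Λ ∨ T.IsLam5 Λ) ∧ Int.gcd Λ.e n = 2) ∨
    ((T.IsLam1 Λ ∨ T.IsLam2 Λ ∨ T.IsLam3 Λ) ∧ Int.gcd Λ.e n = 1)

def Good (F₀ : Type w) [Field F₀] [Algebra F₀ F] (ψ₀ : F₀ → ℂ)
    (π : T.GU →* Module.End ℂ Wπ) : Prop :=
  ∃ (Λ : T.LatSeq) (n : ℤ) (β : Module.End F (Fin 4 → F)) (d : ℤ),
      0 < n ∧ T.selfDualWith Λ d ∧ β ∈ T.aFil Λ (-n) ∧ β ∈ T.Aminus ∧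
      T.IsFundamental Λ n β ∧
      T.ContainsChar π (T.Pset Λ n) (T.psiCh F₀ ψ₀ β) ∧ Cls T Λ n

lemma alt (D : Dat T F₀ ψ₀) {p : Par} {n : ℕ} (hn : 1 ≤ n) (hc : Cls T (LS T p) n)
    (h : Fix π p n) (hb : ∀ β, Sta π F₀ ψ₀ p n β → Good F₀ ψ₀ π) : Good F₀ ψ₀ π := by
  obtain ⟨β, h1, h2, h3⟩ := exists_eig D π hn h
  by_cases hf : T.IsFundamental (LS T p) n β
  · exact ⟨LS T p, n, β, p.d, by exact_mod_cast hn, LS_dual D.H p, h1, h2, hf, h3, hc⟩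
  · exact hb β ⟨h1, h2, h3, nonfund h1 hf⟩

lemma no_zero (H : Hyp T) (hpos : T.PositiveLevel π) {p : Par} (h : Fix π p 0) : False := by
  obtain ⟨w, hw, h⟩ := h
  exact hw (hpos _ (LS_full T p) ⟨_, LS_dual H p⟩ w fun g hg => h g (by rw [Nat.cast_zero, zero_add]; exact hg))

lemma gcd_2e (q : ℕ) : Int.gcd 2 ((2 * q : ℕ) : ℤ) = 2 := by
  change Nat.gcd 2 (2 * q) = 2
  simp
lemma gcd_2o (q : ℕ) : Int.gcd 2 ((2 * q + 1 : ℕ) : ℤ) = 1 := by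
  change Nat.gcd 2 (2 * q + 1) = 1
  simp
lemma gcd_41 (q : ℕ) : Int.gcd 4 ((4 * q + 1 : ℕ) : ℤ) = 1 := by
  change Nat.gcd 4 (4 * q + 1) = 1
  simp
lemma gcd_42 (q : ℕ) : Int.gcd 4 ((4 * q + 2 : ℕ) : ℤ) = 2 := by
  change Nat.gcd 4 (4 * q + 2) = 2
  simp
lemma gcd_43 (q : ℕ) : Int.gcd 4 ((4 * q + 3 : ℕ) : ℤ) = 1 := by
  change Nat.gcd 4 (4 * q + 3) = 1
  simp
lemma gcd_62 (q : ℕ) : Int.gcd 6 ((6 * q + 2 : ℕ) : ℤ) = 2 := by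
  change Nat.gcd 6 (6 * q + 2) = 2
  simp
lemma gcd_64 (q : ℕ) : Int.gcd 6 ((6 * q + 4 : ℕ) : ℤ) = 2 := by
  change Nat.gcd 6 (6 * q + 4) = 2
  simp

lemma block (D : Dat T F₀ ψ₀) (q : ℕ) (h1 : Fix π par1 (2 * q) → Good F₀ ψ₀ π)
    (h2 : Fix π par2 (2 * q) → Good F₀ ψ₀ π) :
    (Fix π par1 (2 * q + 1) → Good F₀ ψ₀ π) ∧ (Fix π par3 (4 * q + 3) → Good F₀ ψ₀ π) := by
  have a31 : Fix π par3 (4 * q + 1) → Good F₀ ψ₀ π := fun h =>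
    alt D (by omega) (Or.inr ⟨Or.inr (Or.inr (isLam3 T)), gcd_41 q⟩) h
      fun β S => (step31 D S).elim h2 h1
  have a42 : Fix π par4 (6 * q + 2) → Good F₀ ψ₀ π := fun h =>
    alt D (by omega) (Or.inl ⟨Or.inr (Or.inr (Or.inr (Or.inl (isLam4 T)))), gcd_62 q⟩) h
      fun β S => (step42 D S).elim h1 a31
  have a52 : Fix π par5 (6 * q + 2) → Good F₀ ψ₀ π := fun h =>
    alt D (by omega) (Or.inl ⟨Or.inr (Or.inr (Or.inr (Or.inr (isLam5 T)))), gcd_62 q⟩) h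
      fun β S => (step52 D S).elim h2 a31
  have a11 : Fix π par1 (2 * q + 1) → Good F₀ ψ₀ π := fun h =>
    alt D (by omega) (Or.inr ⟨Or.inl (isLam1 T), gcd_2o q⟩) h fun β S => a42 (step11 D S)
  have a21 : Fix π par2 (2 * q + 1) → Good F₀ ψ₀ π := fun h =>
    alt D (by omega) (Or.inr ⟨Or.inr (Or.inl (isLam2 T)), gcd_2o q⟩) h fun β S => a52 (step21 D S)
  have a32 : Fix π par3 (4 * q + 2) → Good F₀ ψ₀ π := fun h =>
    alt D (by omega) (Or.inl ⟨Or.inr (Or.inr (Or.inl (isLam3 T))), gcd_42 q⟩) h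
      fun β S => (step32 D S).elim a52 a42
  have a44 : Fix π par4 (6 * q + 4) → Good F₀ ψ₀ π := fun h =>
    alt D (by omega) (Or.inl ⟨Or.inr (Or.inr (Or.inr (Or.inl (isLam4 T)))), gcd_64 q⟩) h
      fun β S => (step44 D S).elim a32 a11
  have a54 : Fix π par5 (6 * q + 4) → Good F₀ ψ₀ π := fun h =>
    alt D (by omega) (Or.inl ⟨Or.inr (Or.inr (Or.inr (Or.inr (isLam5 T)))), gcd_64 q⟩) h
      fun β S => (step54 D S).elim a21 a32
  exact ⟨a11, fun h =>
    alt D (by omega) (Or.inr ⟨Or.inr (Or.inr (isLam3 T)), gcd_43 q⟩) h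
      fun β S => (step33 D S).elim a54 a44⟩

lemma blocks (D : Dat T F₀ ψ₀) (hpos : T.PositiveLevel π) (q : ℕ) :
    (Fix π par1 (2 * q) → Good F₀ ψ₀ π) ∧ (Fix π par2 (2 * q) → Good F₀ ψ₀ π) := by
  induction q with
  | zero => exact ⟨fun h => (no_zero D.H hpos h).elim, fun h => (no_zero D.H hpos h).elim⟩
  | succ q ih =>
    have h3 := (block D q ih.1 ih.2).2
    exact ⟨fun h => alt D (by omega) (Or.inl ⟨Or.inl (isLam1 T), gcd_2e _⟩) h
        fun β S => h3 (step10 D S),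
      fun h => alt D (by omega) (Or.inl ⟨Or.inr (Or.inl (isLam2 T)), gcd_2e _⟩) h
        fun β S => h3 (step20 D S)⟩

lemma final_of_fix (D : Dat T F₀ ψ₀) (hpos : T.PositiveLevel π) (n : ℕ) (h : Fix π par1 n) :
    Good F₀ ψ₀ π := by
  obtain ⟨q, hq | hq⟩ := Nat.even_or_odd' n
  · subst hq; exact (blocks D hpos q).1 h
  · subst hq; exact (block D q (blocks D hpos q).1 (blocks D hpos q).2).1 h

end fin
end U4H

namespace U4H
open USetting

section ex
variable {F : Type u} [Field F] {T : USetting F (Fin 4 → F)}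

lemma notMem_inv {k : ℤ} {x : F} (hx : x ∉ pw T k) : x ≠ 0 ∧ x⁻¹ ∈ pw T (1 - k) := by
  have h0 : x ≠ 0 := fun h => hx (h ▸ (pw T k).zero_mem)
  refine ⟨h0, ?_⟩
  rw [mem_pw] at hx
  have hz0 : T.ϖ ^ (-k) * x ≠ 0 := mul_ne_zero (zpow_ne_zero _ T.ϖ_ne_zero) h0
  have h1 : (T.ϖ ^ (-k) * x)⁻¹ ∈ T.O := (T.O_val _ hz0).resolve_left hx
  by_contra hc
  have h2 := inv_mem T h1 (fun h => hc (by
    rw [mul_inv, ← zpow_neg, neg_neg, zpow_mul_mem] at h; exact h))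
  rw [inv_inv] at h2
  exact hx h2.2

lemma norm_mem (H : Hyp T) {m : ℤ} (hm : 0 ≤ m) {x : F} (h : x * T.conj x ∈ pw T (-m)) :
    x ∈ pw T (-m) := by
  by_contra hx
  obtain ⟨h0, h1⟩ := notMem_inv hx
  have h2 := H.conj_mem h1
  have h3 := pw_mul T h (pw_mul T h1 h2)
  have hc : T.conj x ≠ 0 := by simpa using h0
  rw [map_inv₀, show x * T.conj x * (x⁻¹ * (T.conj x)⁻¹) = 1 by field_simp] at h3
  exact one_notMem T (pw_anti T (by omega) h3)

lemma unit_one_add (H : Hyp T) {τ : F} (hτ : τ ∈ T.O) :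
    1 + T.ϖ * (τ * T.conj τ) ≠ 0 ∧ (1 + T.ϖ * (τ * T.conj τ))⁻¹ ∈ T.O := by
  have h1 : T.ϖ * (τ * T.conj τ) ∈ pw T 1 :=
    (mem_pF T).1 ⟨_, T.O.mul_mem hτ (T.conj_O _ hτ), rfl⟩
  refine inv_mem T (T.O.add_mem T.O.one_mem
    ((mem_pw0 T).1 (pw_anti T (by omega) h1))) fun h => one_notMem T ?_
  have := (pw T 1).sub_mem h h1
  rwa [add_sub_cancel_right] at this

lemma aniso (H : Hyp T) {b : ℤ} (hb : 0 ≤ b) {a c : F}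
    (h : T.ϖ * (T.conj a * a) + T.conj c * c ∈ pw T (-b)) :
    a ∈ pw T (-(b + 1)) ∧ c ∈ pw T (-(b + 1)) := by
  have key : (∃ τ ∈ T.O, a = c * τ) ∨ ∃ τ ∈ T.O, c = a * (T.ϖ * τ) := by
    by_cases hc : c = 0
    · right; exact ⟨0, T.O.zero_mem, by simp [hc]⟩
    by_cases hac : a / c ∈ pw T 0
    · left; exact ⟨a / c, (mem_pw0 T).1 hac, by field_simp⟩
    · right
      obtain ⟨h0, h1⟩ := notMem_inv hac
      rw [sub_zero, ← mem_pF] at h1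
      obtain ⟨z, hz, e⟩ := h1
      refine ⟨z, hz, ?_⟩
      rw [← e]
      have : a ≠ 0 := fun h => h0 (by simp [h])
      field_simp
  rcases key with ⟨τ, hτ, rfl⟩ | ⟨τ, hτ, rfl⟩
  · obtain ⟨u0, u1⟩ := unit_one_add H hτ
    have h2 := O_mul_mem T u1 h
    have e : (1 + T.ϖ * (τ * T.conj τ))⁻¹ * (T.ϖ * (T.conj (c * τ) * (c * τ)) + T.conj c * c)
        = c * T.conj c := by
      rw [inv_mul_eq_iff_eq_mul₀ u0, map_mul]; ring
    rw [e] at h2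
    have h3 := norm_mem H hb h2
    refine ⟨pw_anti T (by omega) (?_ : c * τ ∈ pw T (-b)), pw_anti T (by omega) h3⟩
    rw [mul_comm]; exact O_mul_mem T hτ h3
  · obtain ⟨u0, u1⟩ := unit_one_add H hτ
    have h2 := O_mul_mem T u1 h
    have e : (1 + T.ϖ * (τ * T.conj τ))⁻¹ * (T.ϖ * (T.conj a * a) +
        T.conj (a * (T.ϖ * τ)) * (a * (T.ϖ * τ))) = T.ϖ ^ (1 : ℤ) * (a * T.conj a) := by
      rw [inv_mul_eq_iff_eq_mul₀ u0, map_mul, map_mul, H.conjϖ, zpow_one]; ring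
    rw [e, zpow_mul_mem, show -b - 1 = -(b + 1) by ring] at h2
    have h3 := norm_mem H (by omega) h2
    refine ⟨h3, ?_⟩
    rw [mul_comm]; exact O_mul_mem T (T.O.mul_mem T.ϖ_mem hτ) h3

lemma exists_max (f : (Fin 4 → F) → F) (s : Finset (Fin 4 → F)) (hs : s.Nonempty) :
    ∃ w ∈ s, ∀ w' ∈ s, ∃ c ∈ T.O, f w' = c * f w := by
  induction hs using Finset.Nonempty.cons_induction with
  | singleton a =>
    exact ⟨a, by simp, fun w' hw' => ⟨1, T.O.one_mem, by simp [Finset.mem_singleton.1 hw']⟩⟩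
  | cons a s ha hs ih =>
    obtain ⟨w, hw, h⟩ := ih
    have key : (∃ c ∈ T.O, f a = c * f w) ∨ ∃ c ∈ T.O, f w = c * f a := by
      by_cases h1 : f a = 0
      · left; exact ⟨0, T.O.zero_mem, by simp [h1]⟩
      by_cases h2 : f w = 0
      · right; exact ⟨0, T.O.zero_mem, by simp [h2]⟩
      rcases T.O_val (f a / f w) (div_ne_zero h1 h2) with h3 | h3
      · left; exact ⟨_, h3, by field_simp⟩
      · right; exact ⟨_, h3, by field_simp⟩
    rcases key with ⟨c, hc, e⟩ | ⟨c, hc, e⟩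
    · refine ⟨w, by simp [hw], fun w' hw' => ?_⟩
      rcases Finset.mem_cons.1 hw' with rfl | hw'
      · exact ⟨c, hc, e⟩
      · exact h w' hw'
    · refine ⟨a, by simp, fun w' hw' => ?_⟩
      rcases Finset.mem_cons.1 hw' with rfl | hw'
      · exact ⟨1, T.O.one_mem, by simp⟩
      · obtain ⟨c', hc', e'⟩ := h w' hw'
        exact ⟨c' * c, T.O.mul_mem hc' hc, by rw [e', e, mul_assoc]⟩

lemma L_per (Λ : T.LatSeq) (m i : ℤ) (v : Fin 4 → F) :
    T.ϖ ^ m • v ∈ Λ.L (i + Λ.e * m) ↔ v ∈ Λ.L i := by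
  have h1 : ∀ j (v : Fin 4 → F), T.ϖ • v ∈ Λ.L (j + Λ.e) ↔ v ∈ Λ.L j := fun j v => by
    rw [Λ.periodic, Set.smul_mem_smul_set_iff₀ T.ϖ_ne_zero]
  induction m using Int.induction_on with
  | zero => simp
  | succ n ih =>
    refine Iff.trans ?_ ih
    rw [← h1 (i + Λ.e * n), smul_smul, zpow_add₀ T.ϖ_ne_zero, zpow_one, mul_comm T.ϖ,
      show i + Λ.e * ((n : ℤ) + 1) = i + Λ.e * n + Λ.e by ring]
  | pred n ih =>
    refine Iff.trans ((h1 _ _).symm.trans ?_) ih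
    rw [smul_smul, zpow_sub₀ T.ϖ_ne_zero, zpow_one, mul_div_cancel₀ _ T.ϖ_ne_zero,
      show i + Λ.e * (-(n : ℤ) - 1) + Λ.e = i + Λ.e * -n by ring]

lemma h_g (g : T.GU) (v w : Fin 4 → F) : T.h (T.toE g v) (T.toE g w) = T.h v w := by
  rw [T.σA_adj, ← toE_inv, ← Module.End.mul_apply, toE_inv_mul]; rfl

lemma core (H : Hyp T) (Λ : T.LatSeq) (hfull : T.IsFull Λ) (b : ℤ) (hb : 0 ≤ b)
    (hh : ∀ v ∈ Λ.L 0, ∀ w ∈ Λ.L 0, T.h v w ∈ pw T (-b)) :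
    ∃ g : T.GU, ∀ v ∈ Λ.L 0, ∀ i, T.toE g v i ∈ pw T (-(b + 1)) := by
  obtain ⟨hspan, s, hsL, hs⟩ := hfull 0
  have hne : s.Nonempty := by
    by_contra h
    rw [Finset.not_nonempty_iff_eq_empty] at h
    have h0 : Λ.L 0 ⊆ {0} := fun v hv => by
      obtain ⟨c, -, e⟩ := hs v hv
      rw [h, Finset.sum_empty] at e; exact e
    have := Submodule.span_mono (R := F) h0
    rw [hspan, Submodule.span_zero_singleton, top_le_iff] at this
    exact bot_ne_top this
  obtain ⟨y, hys, hmax⟩ := exists_max (T := T) (fun v => v 3) s hne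
  have hy := hsL hys
  set t := y 3 with ht
  have hmaxL : ∀ v ∈ Λ.L 0, ∃ c ∈ T.O, v 3 = c * t := by
    intro v hv
    obtain ⟨c, hc, e⟩ := hs v hv
    choose! d hd1 hd2 using hmax
    refine ⟨∑ w ∈ s, c w * d w, T.O.sum_mem fun w hw => T.O.mul_mem (hc w hw) (hd1 w hw), ?_⟩
    rw [e, Finset.sum_apply, Finset.sum_mul]
    refine Finset.sum_congr rfl fun w hw => ?_
    rw [Pi.smul_apply, smul_eq_mul, hd2 w hw, mul_assoc]
  have ht0 : t ≠ 0 := by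
    intro h0
    have hle : Submodule.span F (Λ.L 0) ≤ LinearMap.ker (LinearMap.proj (R := F) (φ := fun _ : Fin 4 => F) 3) := by
      rw [Submodule.span_le]
      intro v hv
      obtain ⟨c, -, e⟩ := hmaxL v hv
      simp [e, h0]
    rw [hspan, top_le_iff] at hle
    have : (Pi.single 3 1 : Fin 4 → F) ∈ LinearMap.ker (LinearMap.proj (R := F) (φ := fun _ : Fin 4 => F) 3) := by
      rw [hle]; trivial
    simp at this
  have htc : T.conj t ≠ 0 := by simpa using ht0
  have h2 : T.conj 2 = 2 := map_ofNat T.conj 2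
  have h20 := H.two
  set δ : F := -((T.ϖ * (y 1 * T.conj (y 1)) + y 2 * T.conj (y 2)) +
    (T.conj t * y 0 - t * T.conj (y 0))) / 2 with hδ
  have hϖ := T.ϖ_ne_zero
  have eδ : δ + T.conj δ + (T.ϖ * (y 1 * T.conj (y 1)) + y 2 * T.conj (y 2)) = 0 := by
    rw [hδ]
    simp only [map_div₀, map_neg, map_add, map_sub, map_mul, T.conj_invol, h2, H.conjϖ]
    field_simp; ring
  obtain ⟨g, hg⟩ := mkG H !![T.conj t, T.ϖ * T.conj (y 1), T.conj (y 2), δ * t⁻¹;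
      0, 1, 0, -(y 1) * t⁻¹; 0, 0, 1, -(y 2) * t⁻¹; 0, 0, 0, t⁻¹] (by
    ext i j
    rw [Matrix.mul_apply, Fin.sum_univ_four]
    fin_cases i <;> fin_cases j <;> simp [st, hw, T.conj_invol, H.conjϖ, hϖ, ht0, htc] <;> field_simp
    all_goals first | linear_combination eδ | ring)
  have hga : ∀ v i, T.toE g v i = ∑ j, mat (T.toE g) i j * v j := fun v i => app_eq _ v i
  refine ⟨g, ?_⟩
  have g3 : ∀ v ∈ Λ.L 0, T.toE g v 3 ∈ T.O := by
    intro v hv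
    obtain ⟨c, hc, e⟩ := hmaxL v hv
    rw [hga, hg, Fin.sum_univ_four]
    simp [e]
    rwa [mul_comm c, inv_mul_cancel_left₀ ht0]
  set Y := T.toE g y with hY
  have Y3 : Y 3 = 1 := by
    rw [hY, hga, hg, Fin.sum_univ_four]; simp [← ht, ht0]
  have Y1 : Y 1 = 0 := by
    rw [hY, hga, hg, Fin.sum_univ_four]; simp [← ht, ht0]
  have Y2 : Y 2 = 0 := by
    rw [hY, hga, hg, Fin.sum_univ_four]; simp [← ht, ht0]
  have Y0 : Y 0 = 2⁻¹ * T.h y y := by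
    rw [hY, hga, hg, Fin.sum_univ_four, H.form]; simp [← ht, ht0]
    rw [hδ]; field_simp; ring
  have Y0m : Y 0 ∈ pw T (-b) := by
    rw [Y0]; exact O_mul_mem T H.two_inv (hh y hy y hy)
  have g0 : ∀ v ∈ Λ.L 0, T.toE g v 0 ∈ pw T (-b) := by
    intro v hv
    have e1 := hh y hy v hv
    rw [← h_g g, ← hY, H.form, Y3, Y1, Y2] at e1
    have e2 := O_mul_mem T (g3 v hv) (H.conj_mem Y0m)
    have := (pw T (-b)).sub_mem e1 e2
    simpa [mul_comm] using this
  intro v hv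
  have e1 := hh v hv v hv
  rw [← h_g g, H.form] at e1
  set V := T.toE g v with hV
  have hv0 := g0 v hv
  have hv3 := g3 v hv
  have e2 := O_mul_mem T hv3 (H.conj_mem hv0)
  have e3 := O_mul_mem T (T.conj_O _ hv3) hv0
  have e4 := (pw T (-b)).sub_mem ((pw T (-b)).sub_mem e1 e2) e3
  obtain ⟨a1, a2⟩ := aniso H hb (a := V 1) (c := V 2) (by
    convert e4 using 1; ring)
  intro i
  fin_cases i
  · exact pw_anti T (by omega) hv0
  · exact a1
  · exact a2
  · exact pw_anti T (by omega) ((mem_pw0 T).2 hv3)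

end ex
end U4H

namespace U4H
open USetting

section ex2
variable {F : Type u} [Field F] {T : USetting F (Fin 4 → F)}

lemma exists_fix (H : Hyp T) {Wπ : Type*} [AddCommGroup Wπ] [Module ℂ Wπ]
    (π : T.GU →* Module.End ℂ Wπ) {w : Wπ} (hw : w ≠ 0) (Λ : T.LatSeq) (hfull : T.IsFull Λ)
    (d : ℤ) (hd : T.selfDualWith Λ d) (k : ℤ) (hk : 1 ≤ k)
    (hfx : ∀ g ∈ T.Pset Λ k, π g w = w) : ∃ n : ℕ, Fix π par1 n := by
  obtain ⟨b, hb0, hb1, hb2⟩ : ∃ b : ℤ, 0 ≤ b ∧ d ≤ b ∧ -d ≤ b :=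
    ⟨|d|, abs_nonneg d, le_abs_self d, neg_le_abs d⟩
  have he := Λ.e_pos
  have heb : b ≤ Λ.e * b := by nlinarith
  have hd0 := hd 0
  rw [sub_zero] at hd0
  have hh : ∀ v ∈ Λ.L 0, ∀ w ∈ Λ.L 0, T.h v w ∈ pw T (-b) := by
    intro v hv w hw
    have h1 := L_anti Λ (show d ≤ 0 + Λ.e * b by omega) ((L_per Λ b 0 v).2 hv)
    rw [← hd0] at h1
    have h2 := h1 w hw
    rw [T.h_smul_left, H.conj_zpow] at h2
    rwa [mem_pw, neg_neg]
  obtain ⟨g, hg⟩ := core H Λ hfull b hb0 hh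
  have hdual : ∀ v' : Fin 4 → F, (∀ i, v' i ∈ pw T (b + 1)) → T.toE g⁻¹ v' ∈ Λ.L d := by
    intro v' hv'
    rw [← hd0]
    intro v hv
    have e1 : T.h (T.toE g⁻¹ v') v = T.h v' (T.toE g v) := by
      rw [← h_g g, ← Module.End.mul_apply, toE_mul_inv]; rfl
    have hm : ∀ i j, T.conj (v' i) * T.toE g v j ∈ T.O := fun i j => by
      have := pw_mul T (H.conj_mem (hv' i)) (hg v hv j)
      rwa [add_neg_cancel, mem_pw0] at this
    rw [e1, H.form]
    exact T.O.add_mem (T.O.add_mem (T.O.add_mem (hm _ _) (T.O.mul_mem T.ϖ_mem (hm _ _)))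
      (hm _ _)) (hm _ _)
  have hback : ∀ (v' : Fin 4 → F) (m : ℤ), (∀ i, v' i ∈ pw T (m + b + 1 + b)) →
      T.toE g⁻¹ v' ∈ Λ.L (Λ.e * m) := by
    intro v' m hv'
    have h1 := hdual (T.ϖ ^ (-(m + b)) • v') (fun i => by
      rw [Pi.smul_apply, smul_eq_mul, zpow_mul_mem]
      convert hv' i using 2; ring)
    have h2 := (L_per Λ (m + b) d _).2 h1
    rw [map_smul, smul_smul, zpow_mul_zpow, add_neg_cancel, zpow_zero, one_smul] at h2
    refine L_anti Λ ?_ h2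
    have : Λ.e * (m + b) = Λ.e * m + Λ.e * b := by ring
    omega
  obtain ⟨N, hN⟩ : ∃ N : ℕ, (N : ℤ) = (1 + k) + b + 1 + b + (b + 1) :=
    ⟨((1 + k) + b + 1 + b + (b + 1)).toNat, Int.toNat_of_nonneg (by omega)⟩
  refine ⟨2 * N, π g w, ?_, ?_⟩
  · intro h0
    apply hw
    have := congrArg (π g⁻¹) h0
    rwa [map_zero, ← Module.End.mul_apply, ← map_mul, inv_mul_cancel, map_one] at this
  intro x hx
  rw [mem_aFil] at hx
  have hx' : ∀ i j, mat (T.toE x - 1) i j ∈ pw T N := fun i j => by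
    refine pw_anti T ?_ (hx i j)
    fin_cases i <;> fin_cases j <;> simp [Par.y, par1, cd] <;> omega
  have key : g⁻¹ * x * g ∈ T.Pset Λ k := by
    intro i v hv
    have e0 : T.toE (g⁻¹ * x * g) - 1 = T.toE g⁻¹ * (T.toE x - 1) * T.toE g := by
      rw [toE_mul, toE_mul, mul_sub, sub_mul, mul_one, toE_inv_mul]
    rw [e0]
    set m := i / Λ.e with hm
    have h1 := Int.mul_ediv_add_emod i Λ.e
    have h2 := Int.emod_nonneg i he.ne'
    have h3 := Int.emod_lt_of_pos i he
    rw [← hm] at h1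
    have hv1 : T.ϖ ^ (-m) • v ∈ Λ.L 0 := by
      have := (L_per Λ (-m) (Λ.e * m) v).2 (L_anti Λ (by omega) hv)
      rwa [show Λ.e * m + Λ.e * -m = 0 by ring] at this
    have h4 := hg _ hv1
    have h5 := hback ((T.toE x - 1) (T.toE g (T.ϖ ^ (-m) • v))) (1 + k) (fun i => by
      rw [app_eq]
      refine AddSubgroup.sum_mem _ fun j _ => ?_
      have := pw_mul T (hx' i j) (h4 j)
      rw [hN] at this
      convert this using 2; ring)
    have h6 := (L_per Λ m _ _).2 h5
    rw [← map_smul, ← map_smul, ← map_smul, smul_smul, zpow_mul_zpow, add_neg_cancel, zpow_zero,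
      one_smul] at h6
    refine L_anti Λ ?_ h6
    nlinarith
  have h7 := hfx _ key
  have h8 := congrArg (π g) h7
  rwa [← Module.End.mul_apply, ← map_mul, show g * (g⁻¹ * x * g) = x * g by group, map_mul,
    Module.End.mul_apply] at h8

end ex2
end U4H

open USetting in
/-- **Theorem 3.1.** Let `G` be the non quasi-split unramified
unitary group in four variables over `F₀`, and let `π` be an irreducible smooth
representation of `G` of positive level.  Then `π` contains a fundamental skew
stratum `[Λ, n, n-1, β]` with either `Λ ∈ {Λ₁, …, Λ₅}` and `gcd(e(Λ), n) = 2`,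
or `Λ ∈ {Λ₁, Λ₂, Λ₃}` and `gcd(e(Λ), n) = 1`. -/
theorem statement_15
    {F : Type u} [Field F] (T : USetting F (Fin 4 → F))
    (hodd : ¬ (2 ∣ T.residueChar))
    (hform : T.IsU4Form) (hunram : T.IsUnramifiedQuadratic)
    (F₀ : Type w) [Field F₀] [Algebra F₀ F] [FiniteDimensional F₀ F]
    (hfix : T.FixedField F₀) (hdeg : Module.finrank F₀ F = 2)
    (ψ₀ : F₀ → ℂ) (hψ : T.IsAddCh F₀ ψ₀)
    (Wπ : Type*) [AddCommGroup Wπ] [Module ℂ Wπ]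
    (π : T.GU →* Module.End ℂ Wπ)
    (hsm : T.Smooth π) (hirr : T.Irred π) (hpos : T.PositiveLevel π) :
    ∃ (Λ : T.LatSeq) (n : ℤ) (β : Module.End F (Fin 4 → F)) (d : ℤ),
      0 < n ∧ T.selfDualWith Λ d ∧ β ∈ T.aFil Λ (-n) ∧ β ∈ T.Aminus ∧
      T.IsFundamental Λ n β ∧
      T.ContainsChar π (T.Pset Λ n) (T.psiCh F₀ ψ₀ β) ∧
      (((T.IsLam1 Λ ∨ T.IsLam2 Λ ∨ T.IsLam3 Λ ∨ T.IsLam4 Λ ∨ T.IsLam5 Λ) ∧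
          Int.gcd Λ.e n = 2) ∨
        ((T.IsLam1 Λ ∨ T.IsLam2 Λ ∨ T.IsLam3 Λ) ∧ Int.gcd Λ.e n = 1)) := by
  obtain ⟨w, hw⟩ := hirr.1
  obtain ⟨Λ, hfull, ⟨d, hd⟩, k, hk, hfx⟩ := hsm w
  have D : U4H.Dat T F₀ ψ₀ := ⟨U4H.hyp_of T hodd hform hunram, hfix, hdeg, hψ⟩
  obtain ⟨n, hn⟩ := U4H.exists_fix D.H π hw Λ hfull d hd k hk hfx
  exact U4H.final_of_fix D hpos n hn
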